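/- arXiv:1206.0319 — 2 statements merged into one kernel-verified Lean document; each statement's English description precedes it below -/
import Mathlib

section
/- Let f, h_1, …, h_{m1}, g_1, …, g_{m2} be real polynomials in x = (x_1, …, x_n), let K = {x ∈ ℝⁿ : h_i(x) = 0 (i = 1,…,m1), g_j(x) ≥ 0 (j = 1,…,m2)}, and suppose ⟨h⟩ + Q(g) is archimedean. Let f_min ∈ ℝ be the minimum of f on K, i.e., f(x) ≥ f_min for all x ∈ K and f(u) = f_min for some u ∈ K. Assume that at every global minimizer u ∈ K (i.e., every u ∈ K with f(u) = f_min): (i) the constraint qualification condition holds, (ii) there exist Lagrange multipliers λ ∈ ℝ^{m1}, μ ∈ ℝ^{m2} with ∇f(u) = Σ_i λ_i ∇h_i(u) + Σ_j μ_j ∇g_j(u), μ_j g_j(u) = 0 and μ_j ≥ 0 for all j, satisfying strict complementarity μ_j + g_j(u) > 0 for all j, and (iii) the second order sufficiency condition holds for these multipliers. Then Lasserre's hierarchy has finite convergence: there exists k₀ ∈ ℕ such that for every ε > 0, f − f_min + ε ∈ ⟨h⟩_{2k₀} + Q_{k₀}(g); equivalently, the optimal value f_k of the k-th Lasserre relaxation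 equals f_min for all k ≥ k₀. -/
open MvPolynomial Matrix
open scoped Matrix

noncomputable section

/-- A polynomial is a sum of squares (SOS). -/
def IsSOS {n : ℕ} (p : MvPolynomial (Fin n) ℝ) : Prop :=
  ∃ (k : ℕ) (q : Fin k → MvPolynomial (Fin n) ℝ), p = ∑ i, q i ^ 2

/-- The truncated ideal `⟨h⟩_{2k}`. -/
def truncIdeal {n m1 : ℕ} (h : Fin m1 → MvPolynomial (Fin n) ℝ) (k : ℕ) :
    Set (MvPolynomial (Fin n) ℝ) :=
  { p | ∃ φ : Fin m1 → MvPolynomial (Fin n) ℝ,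
      (∀ i, (φ i * h i).totalDegree ≤ 2 * k) ∧ p = ∑ i, φ i * h i }

/-- The truncated quadratic module `Q_k(g)` (with `g₀ = 1`). -/
def truncQM {n m2 : ℕ} (g : Fin m2 → MvPolynomial (Fin n) ℝ) (k : ℕ) :
    Set (MvPolynomial (Fin n) ℝ) :=
  { p | ∃ (σ0 : MvPolynomial (Fin n) ℝ) (σ : Fin m2 → MvPolynomial (Fin n) ℝ),
      IsSOS σ0 ∧ (∀ j, IsSOS (σ j)) ∧
      σ0.totalDegree ≤ 2 * k ∧ (∀ j, (σ j * g j).totalDegree ≤ 2 * k) ∧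
      p = σ0 + ∑ j, σ j * g j }

/-- The quadratic module `Q(g) = ∪_k Q_k(g)` (with `g₀ = 1`). -/
def QM {n m2 : ℕ} (g : Fin m2 → MvPolynomial (Fin n) ℝ) :
    Set (MvPolynomial (Fin n) ℝ) :=
  { p | ∃ (σ0 : MvPolynomial (Fin n) ℝ) (σ : Fin m2 → MvPolynomial (Fin n) ℝ),
      IsSOS σ0 ∧ (∀ j, IsSOS (σ j)) ∧ p = σ0 + ∑ j, σ j * g j }

/-- The set `⟨h⟩ + Q(g)`. -/
def idealPlusQM {n m1 m2 : ℕ} (h : Fin m1 → MvPolynomial (Fin n) ℝ)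
    (g : Fin m2 → MvPolynomial (Fin n) ℝ) : Set (MvPolynomial (Fin n) ℝ) :=
  { p | ∃ a ∈ Ideal.span (Set.range h), ∃ b ∈ QM g, p = a + b }

/-- `⟨h⟩ + Q(g)` is archimedean: `R − (x₁² + ⋯ + xₙ²) ∈ ⟨h⟩ + Q(g)` for some `R > 0`. -/
def ArchimedeanCond {n m1 m2 : ℕ} (h : Fin m1 → MvPolynomial (Fin n) ℝ)
    (g : Fin m2 → MvPolynomial (Fin n) ℝ) : Prop :=
  ∃ R : ℝ, 0 < R ∧ (C R - ∑ i : Fin n, X i ^ 2) ∈ idealPlusQM h g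

/-- The gradient of a polynomial at a point. -/
def gradAt {n : ℕ} (p : MvPolynomial (Fin n) ℝ) (u : Fin n → ℝ) : Fin n → ℝ :=
  fun i => eval u (pderiv i p)

/-- The Hessian matrix of a polynomial at a point. -/
def hessAt {n : ℕ} (p : MvPolynomial (Fin n) ℝ) (u : Fin n → ℝ) :
    Matrix (Fin n) (Fin n) ℝ :=
  Matrix.of fun i j => eval u (pderiv i (pderiv j p))

/-- The constraint qualification condition at `u`: the gradients of the equality
constraints together with those of the active inequality constraints are linearly
independent. -/
def CQC {n m1 m2 : ℕ} (h : Fin m1 → MvPolynomial (Fin n) ℝ)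
    (g : Fin m2 → MvPolynomial (Fin n) ℝ) (u : Fin n → ℝ) : Prop :=
  LinearIndependent ℝ
    (Sum.elim (fun i : Fin m1 => gradAt (h i) u)
      (fun j : {j : Fin m2 // eval u (g j) = 0} => gradAt (g j.1) u))

/-- The second order sufficiency condition at `u` with multipliers `lam, mu`
(assuming complementarity, the Lagrangian may be taken with all multipliers):
`vᵀ ∇²L(u) v > 0` for every nonzero `v` orthogonal to the gradients of the
equality constraints and of the active inequality constraints. -/
def SOSC {n m1 m2 : ℕ} (f : MvPolynomial (Fin n) ℝ)
    (h : Fin m1 → MvPolynomial (Fin n) ℝ) (g : Fin m2 → MvPolynomial (Fin n) ℝ)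
    (u : Fin n → ℝ) (lam : Fin m1 → ℝ) (mu : Fin m2 → ℝ) : Prop :=
  ∀ v : Fin n → ℝ, v ≠ 0 →
    (∀ i : Fin m1, gradAt (h i) u ⬝ᵥ v = 0) →
    (∀ j : Fin m2, eval u (g j) = 0 → gradAt (g j) u ⬝ᵥ v = 0) →
    0 < v ⬝ᵥ (hessAt (f - (∑ i, C (lam i) * h i) - ∑ j, C (mu j) * g j) u).mulVec v

section PureStates

variable {A V : Type*} [CommRing A] [Algebra ℝ A] [AddCommGroup V] [Module ℝ V] [Module A V]
  [IsScalarTower ℝ A V]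

/-- A point outside a convex cone with order unit `e` is separated from it by a state. -/
theorem exists_state_nonpos_of_notMem {V : Type*} [AddCommGroup V] [Module ℝ V]
    (M : PointedCone ℝ V) {e F : V} (he : e ∈ M)
    (hunit : ∀ v, ∃ k : ℝ, k • e + v ∈ M) (hF : F ∉ M) :
    ∃ φ : V →ₗ[ℝ] ℝ, (∀ v ∈ M, 0 ≤ φ v) ∧ φ e = 1 ∧ φ F ≤ 0 := by
  have smul_mem : ∀ {c : ℝ} {v : V}, 0 ≤ c → v ∈ M → c • v ∈ M := fun {c v} hc hv =>
    M.smul_mem hc hv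
  have hneg : -e ∉ M := by
    intro hne
    obtain ⟨k, hk⟩ := hunit F
    apply hF
    rcases le_total 0 k with h0 | h0
    · have := M.add_mem hk (smul_mem h0 hne)
      convert this using 1
      module
    · have := M.add_mem hk (smul_mem (neg_nonneg.2 h0) he)
      convert this using 1
      module
  have he0 : e ≠ 0 := by
    rintro rfl
    exact hneg (by simp)
  let s : PointedCone ℝ V :=
    { carrier := {v | ∃ t : ℝ, 0 ≤ t ∧ v + t • F ∈ M}
      zero_mem' := ⟨0, le_rfl, by simp⟩
      add_mem' := by
        rintro a b ⟨t, ht, hat⟩ ⟨r, hr, hbr⟩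
        refine ⟨t + r, add_nonneg ht hr, ?_⟩
        convert M.add_mem hat hbr using 1
        module
      smul_mem' := by
        rintro ⟨c, hc⟩ a ⟨t, ht, hat⟩
        refine ⟨c * t, mul_nonneg hc ht, ?_⟩
        convert smul_mem hc hat using 1
        change c • a + _ = _
        module }
  have hMs : ∀ v ∈ M, v ∈ s := fun v hv => ⟨0, le_rfl, by simpa using hv⟩
  obtain ⟨φ, hφ, hφs⟩ := riesz_extension s ((LinearPMap.mkSpanSingleton e (1 : ℝ) he0 : V →ₗ.[ℝ] ℝ)) (by
      rintro ⟨x, hx⟩ hxs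
      obtain ⟨c, rfl⟩ := Submodule.mem_span_singleton.1 hx
      have hval : (LinearPMap.mkSpanSingleton e (1 : ℝ) he0 : V →ₗ.[ℝ] ℝ) ⟨c • e, hx⟩ = c := by
        refine (LinearPMap.mkSpanSingleton'_apply e (1 : ℝ) _ c hx).trans ?_
        simp
      rw [hval]
      obtain ⟨t, ht, hct⟩ := hxs
      by_contra! hc
      rcases ht.eq_or_lt with rfl | ht
      · apply hneg
        have := smul_mem (inv_nonneg.2 (neg_nonneg.2 hc.le)) hct
        convert this using 1
        have : (-c)⁻¹ * c = -1 := by rw [inv_neg, neg_mul, inv_mul_cancel₀ hc.ne]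
        simp only [zero_smul, add_zero, smul_smul, this, neg_one_smul]
      · apply hF
        have h1 := smul_mem (inv_nonneg.2 ht.le) hct
        have h2 := smul_mem (mul_nonneg (inv_nonneg.2 ht.le) (neg_nonneg.2 hc.le)) he
        convert M.add_mem h1 h2 using 1
        have : t⁻¹ * t = 1 := by field_simp
        simp only [smul_add, smul_smul, this]
        module)
    (by
      intro y
      obtain ⟨k, hk⟩ := hunit y
      exact ⟨⟨k • e, Submodule.mem_span_singleton.2 ⟨k, rfl⟩⟩, hMs _ hk⟩)
  refine ⟨φ, fun v hv => hφs v (hMs v hv), ?_, ?_⟩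
  · have := hφ ⟨e, Submodule.mem_span_singleton_self e⟩
    rw [this]
    exact LinearPMap.mkSpanSingleton_apply ℝ ℝ he0 (1 : ℝ)
  · have : 0 ≤ φ (-F) := hφs _ ⟨1, zero_le_one, by simp⟩
    rw [map_neg] at this
    linarith

/-- Among the states of a cone with order unit, every linear evaluation is minimised at
an extreme state. -/
theorem exists_extreme_state_nonpos {V : Type*} [AddCommGroup V] [Module ℝ V]
    (M : PointedCone ℝ V) {e F : V}
    (hunit : ∀ v, ∃ k : ℝ, k • e + v ∈ M)
    (hφ : ∃ φ : V →ₗ[ℝ] ℝ, (∀ v ∈ M, 0 ≤ φ v) ∧ φ e = 1 ∧ φ F ≤ 0) :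
    ∃ φ : V →ₗ[ℝ] ℝ, (∀ v ∈ M, 0 ≤ φ v) ∧ φ e = 1 ∧ φ F ≤ 0 ∧
      ∀ φ₁ φ₂ : V →ₗ[ℝ] ℝ, (∀ v ∈ M, 0 ≤ φ₁ v) → φ₁ e = 1 → (∀ v ∈ M, 0 ≤ φ₂ v) → φ₂ e = 1 →
        ∀ a b : ℝ, 0 < a → 0 < b → a + b = 1 → a • φ₁ + b • φ₂ = φ → φ₁ = φ := by
  choose k hk using hunit
  let S : Set (V → ℝ) := {φ | (∀ v w, φ (v + w) = φ v + φ w) ∧ (∀ (c : ℝ) v, φ (c • v) = c * φ v) ∧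
    (∀ v ∈ M, 0 ≤ φ v) ∧ φ e = 1}
  have toS : ∀ φ : V →ₗ[ℝ] ℝ, (∀ v ∈ M, 0 ≤ φ v) → φ e = 1 → (φ : V → ℝ) ∈ S :=
    fun φ h1 h2 => ⟨fun v w => map_add φ v w, fun c v => by simp, h1, h2⟩
  have hSclosed : IsClosed S := by
    have : S = (⋂ v, ⋂ w, {φ : V → ℝ | φ (v + w) = φ v + φ w}) ∩
        ((⋂ c : ℝ, ⋂ v, {φ : V → ℝ | φ (c • v) = c * φ v}) ∩
        ((⋂ v ∈ M, {φ : V → ℝ | 0 ≤ φ v}) ∩ {φ | φ e = 1})) := by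
      ext φ; simp [S]
    rw [this]
    refine IsClosed.inter ?_ (IsClosed.inter ?_ (IsClosed.inter ?_ ?_))
    · exact isClosed_iInter fun v => isClosed_iInter fun w =>
        isClosed_eq (by fun_prop) (by fun_prop)
    · exact isClosed_iInter fun v => isClosed_iInter fun w =>
        isClosed_eq (by fun_prop) (by fun_prop)
    · exact isClosed_iInter fun v => isClosed_iInter fun w =>
        isClosed_le (by fun_prop) (by fun_prop)
    · exact isClosed_eq (by fun_prop) (by fun_prop)
  have hScompact : IsCompact S := by
    refine (isCompact_univ_pi (X := fun _ : V => ℝ)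
      (s := fun v => Set.Icc (-k v) (k (-v))) (fun v => isCompact_Icc)).of_isClosed_subset
      hSclosed ?_
    rintro φ ⟨hadd, hsmul, hpos, hone⟩ v -
    have h1 := hpos _ (hk v)
    have h2 := hpos _ (hk (-v))
    have h3 : φ (-v) = - φ v := by
      have := hsmul (-1) v
      simpa using this
    rw [hadd, hsmul, hone] at h1 h2
    constructor <;> linarith
  obtain ⟨φ₀, h₀M, h₀e, h₀F⟩ := hφ
  obtain ⟨φm, hφmS, hφmin⟩ := hScompact.exists_isMinOn ⟨φ₀, toS φ₀ h₀M h₀e⟩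
    (f := fun φ : V → ℝ => φ F) (by fun_prop)
  let T : Set (V → ℝ) := S ∩ {φ | φ F = φm F}
  have hTcompact : IsCompact T :=
    hScompact.inter_right (isClosed_eq (by fun_prop) (by fun_prop))
  obtain ⟨φ, ⟨hφS, hφF⟩, hφext⟩ := hTcompact.extremePoints_nonempty ⟨φm, hφmS, rfl⟩
  let Φ : V →ₗ[ℝ] ℝ :=
    { toFun := φ, map_add' := hφS.1, map_smul' := fun c v => hφS.2.1 c v }
  have hmin0 : φm F ≤ 0 := (hφmin (toS φ₀ h₀M h₀e)).trans h₀F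
  refine ⟨Φ, hφS.2.2.1, hφS.2.2.2, ?_, ?_⟩
  · change φ F ≤ 0
    rw [hφF]; exact hmin0
  · intro φ₁ φ₂ h1 h1e h2 h2e a b ha hb hab hsum
    have hS1 := toS φ₁ h1 h1e
    have hS2 := toS φ₂ h2 h2e
    have m1 : φm F ≤ φ₁ F := hφmin hS1
    have m2 : φm F ≤ φ₂ F := hφmin hS2
    have hF : a * φ₁ F + b * φ₂ F = φm F := by
      rw [← hφF]
      exact congrArg (fun l : V →ₗ[ℝ] ℝ => l F) hsum
    have e1 : φ₁ F = φm F := by nlinarith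
    have e2 : φ₂ F = φm F := by nlinarith
    have := hφext (x₁ := φ₁) ⟨hS1, e1⟩ (x₂ := φ₂) ⟨hS2, e2⟩
      ⟨a, b, ha, hb, hab, by rw [← show (Φ : V → ℝ) = φ from rfl, ← hsum]; rfl⟩
    ext v
    exact congrFun this v

/-- A log-convex nonnegative sequence of growth rate at most `N` grows by a factor at most `N`
in its first step. -/
theorem le_mul_of_sq_le_of_le_pow {c : ℕ → ℝ} {k N : ℝ} (hN : 0 < N) (hc : ∀ j, 0 ≤ c j)
    (hsq : ∀ j, c j ^ 2 ≤ c 0 * c (2 * j)) (hle : ∀ j, c j ≤ k * N ^ j) : c 1 ≤ N * c 0 := by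
  rcases (hc 0).eq_or_lt with h0 | h0
  · have := hsq 1
    rw [← h0] at this ⊢
    nlinarith
  · by_contra! hlt
    have key : ∀ m : ℕ, c 0 * (c 1 / c 0) ^ (2 ^ m) ≤ c (2 ^ m) := by
      intro m
      induction m with
      | zero => simp [mul_div_cancel₀ _ h0.ne']
      | succ m ih =>
        have h1 := hsq (2 ^ m)
        have h2 : 0 ≤ c 0 * (c 1 / c 0) ^ (2 ^ m) := mul_nonneg h0.le
          (pow_nonneg (div_nonneg (hc 1) h0.le) _)
        have h3 := pow_le_pow_left₀ h2 ih 2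
        have h4 : c 0 * (c 0 * (c 1 / c 0) ^ (2 ^ (m + 1))) ≤ c 0 * c (2 ^ (m + 1)) := by
          rw [pow_succ 2 m, pow_mul, mul_comm (2 ^ m) 2]
          calc _ = (c 0 * (c 1 / c 0) ^ (2 ^ m)) ^ 2 := by ring
            _ ≤ _ := h3.trans h1
        exact le_of_mul_le_mul_left h4 h0
    set r := c 1 / c 0 / N with hr
    have hr1 : 1 < r := by
      rw [hr, div_div, one_lt_div (by positivity)]
      linarith
    have hbound : ∀ m : ℕ, r ^ (2 ^ m) ≤ k / c 0 := by
      intro m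
      rw [hr, div_pow, div_le_div_iff₀ (by positivity) h0]
      have := (key m).trans (hle _)
      linarith
    obtain ⟨m, hm⟩ := pow_unbounded_of_one_lt (k / c 0) hr1
    have := pow_le_pow_right₀ hr1.le (Nat.lt_two_pow_self (n := m)).le
    linarith [hbound m]

theorem state_smul_sq_le (M : PointedCone ℝ V) (hsq : ∀ (a : A), ∀ v ∈ M, (a ^ 2) • v ∈ M)
    {e : V} (hunit : ∀ v, ∃ k : ℝ, k • e + v ∈ M) {s : A} {N : ℝ} (hN : 0 < N)
    (hbd : ∀ a : A, (a ^ 2 * (algebraMap ℝ A N - s ^ 2)) • e ∈ M)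
    {φ : V →ₗ[ℝ] ℝ} (hφ : ∀ v ∈ M, 0 ≤ φ v) (hφe : φ e = 1) {v : V} (hv : v ∈ M) :
    φ (s ^ 2 • v) ≤ N * φ v := by
  have hpow : ∀ j : ℕ, φ ((s ^ j) ^ 2 • e) ≤ N ^ j := by
    intro j
    induction j with
    | zero => simp [hφe]
    | succ j ih =>
      have h1 := hφ _ (hbd (s ^ j))
      have h2 : ((s ^ j) ^ 2 * (algebraMap ℝ A N - s ^ 2)) • e
          = N • ((s ^ j) ^ 2 • e) - (s ^ (j + 1)) ^ 2 • e := by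
        rw [← algebraMap_smul A N, smul_smul, ← sub_smul]
        congr 1
        ring
      rw [h2, map_sub, map_smul, smul_eq_mul] at h1
      rw [pow_succ N]
      nlinarith
  obtain ⟨k, hk⟩ := hunit (-v)
  have hk0 : 0 ≤ k := by
    have h1 := hφ _ hk
    have h2 := hφ _ hv
    simp only [map_add, map_smul, map_neg, hφe, smul_eq_mul] at h1
    linarith
  have := le_mul_of_sq_le_of_le_pow (c := fun j => φ ((s ^ j) ^ 2 • v)) (k := k) hN
    (fun j => hφ _ (hsq _ _ hv)) ?_ ?_
  · simpa using this
  · intro j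
    have hquad : ∀ t : ℝ, 0 ≤ φ v * (t * t) + (2 * φ ((s ^ j) ^ 2 • v)) * t
        + φ ((s ^ (2 * j)) ^ 2 • v) := by
      intro t
      have h1 := hφ _ (hsq (algebraMap ℝ A t + s ^ (2 * j)) _ hv)
      have h2 : (algebraMap ℝ A t + s ^ (2 * j)) ^ 2 • v
          = (t * t) • v + (2 * t) • ((s ^ j) ^ 2 • v) + (s ^ (2 * j)) ^ 2 • v := by
        rw [← algebraMap_smul A (t * t), ← algebraMap_smul A (2 * t), smul_smul, ← add_smul,
          ← add_smul]
        congr 1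
        simp only [map_mul, map_ofNat]
        ring
      rw [h2] at h1
      simp only [map_add, map_smul, smul_eq_mul] at h1
      linarith
    have := discrim_le_zero hquad
    rw [discrim] at this
    simp only [pow_zero, one_pow, one_smul]
    linarith
  · intro j
    have h1 := hφ _ (hsq (s ^ j) _ hk)
    have h2 : (s ^ j) ^ 2 • (k • e + -v) = k • ((s ^ j) ^ 2 • e) - (s ^ j) ^ 2 • v := by
      rw [smul_add, smul_neg, sub_eq_add_neg, smul_algebra_smul_comm]
    rw [h2, map_sub, map_smul, smul_eq_mul] at h1
    have := mul_le_mul_of_nonneg_left (hpow j) hk0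
    change φ ((s ^ j) ^ 2 • v) ≤ _
    linarith

/-- Extreme states are multiplicative with respect to the action of the algebra. -/
theorem extreme_state_smul (M : PointedCone ℝ V) (hsq : ∀ (a : A), ∀ v ∈ M, (a ^ 2) • v ∈ M)
    {e : V} (he : e ∈ M) (hunit : ∀ v, ∃ k : ℝ, k • e + v ∈ M)
    (hbd : ∀ s : A, ∃ N : ℝ, 0 < N ∧
      ∀ a : A, (a ^ 2 * (algebraMap ℝ A N - s ^ 2)) • e ∈ M)
    {φ : V →ₗ[ℝ] ℝ} (hφ : ∀ v ∈ M, 0 ≤ φ v) (hφe : φ e = 1)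
    (hext : ∀ φ₁ φ₂ : V →ₗ[ℝ] ℝ, (∀ v ∈ M, 0 ≤ φ₁ v) → φ₁ e = 1 →
      (∀ v ∈ M, 0 ≤ φ₂ v) → φ₂ e = 1 →
        ∀ a b : ℝ, 0 < a → 0 < b → a + b = 1 → a • φ₁ + b • φ₂ = φ → φ₁ = φ)
    (p : A) (v : V) : φ (p • v) = φ (p • e) * φ v := by
  have hsquare : ∀ (s : A) (v : V), φ (s ^ 2 • v) = φ (s ^ 2 • e) * φ v := by
    intro s v
    obtain ⟨N, hN, hNs⟩ := hbd s
    have hle : ∀ w ∈ M, φ (s ^ 2 • w) ≤ N * φ w := fun w hw =>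
      state_smul_sq_le M hsq hunit hN hNs hφ hφe hw
    let ψ : V →ₗ[ℝ] ℝ := φ ∘ₗ (LinearMap.lsmul A V (s ^ 2)).restrictScalars ℝ
    have hψ : ∀ w, ψ w = φ (s ^ 2 • w) := fun w => rfl
    have hψ0 : ∀ w ∈ M, 0 ≤ ψ w := fun w hw => hφ _ (hsq _ _ hw)
    rw [← hψ, ← hψ]
    have hlN : ψ e ≤ N := by simpa [hψ, hφe] using hle e he
    rcases (hψ0 e he).eq_or_lt with h0 | h0
    · obtain ⟨k, hk⟩ := hunit v
      obtain ⟨l, hl⟩ := hunit (-v)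
      have h1 := hψ0 _ hk
      have h2 := hψ0 _ hl
      simp only [map_add, map_smul, map_neg, smul_eq_mul, ← h0] at h1 h2
      rw [← h0]
      linarith
    · have hd : 0 < N + 1 - ψ e := by linarith
      have := hext ((ψ e)⁻¹ • ψ) ((N + 1 - ψ e)⁻¹ • ((N + 1) • φ - ψ))
        (fun w hw => by
          have := hψ0 w hw
          simp only [LinearMap.smul_apply, smul_eq_mul]
          positivity)
        (by simp [h0.ne'])
        (fun w hw => by
          have h1 := hle w hw
          have h2 := hφ w hw
          simp only [LinearMap.smul_apply, LinearMap.sub_apply, smul_eq_mul]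
          refine mul_nonneg (inv_nonneg.2 hd.le) ?_
          rw [hψ]
          linarith)
        (by simp [hφe, hd.ne'])
        (ψ e / (N + 1)) ((N + 1 - ψ e) / (N + 1)) (by positivity) (by positivity)
        (by field_simp; ring)
        (by
          ext w
          simp only [LinearMap.add_apply, LinearMap.smul_apply, LinearMap.sub_apply, smul_eq_mul]
          have := h0.ne'
          have := hd.ne'
          field_simp
          ring)
      have := congrArg (fun l : V →ₗ[ℝ] ℝ => l v) this
      simp only [LinearMap.smul_apply, smul_eq_mul] at this
      field_simp at this
      linarith
  have hp : ∀ w : V, p • w = (1 / 4 : ℝ) • ((p + 1) ^ 2 • w) - (1 / 4 : ℝ) • ((p - 1) ^ 2 • w) := by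
    intro w
    rw [← smul_sub, ← sub_smul, ← algebraMap_smul A (1 / 4 : ℝ), smul_smul]
    congr 1
    have h4 : algebraMap ℝ A (1 / 4) * 4 = 1 := by
      rw [← map_ofNat (algebraMap ℝ A) 4, ← map_mul]
      norm_num
    linear_combination -p * h4
  rw [hp v, hp e]
  simp only [map_sub, map_smul, smul_eq_mul, hsquare (p + 1) v, hsquare (p - 1) v]
  ring

/-- A vector on which every multiplicative state is positive lies in the cone. -/
theorem mem_of_forall_multiplicative_state_pos (M : PointedCone ℝ V)
    (hsq : ∀ (a : A), ∀ v ∈ M, (a ^ 2) • v ∈ M)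
    {e F : V} (he : e ∈ M) (hunit : ∀ v, ∃ k : ℝ, k • e + v ∈ M)
    (hbd : ∀ s : A, ∃ N : ℝ, 0 < N ∧
      ∀ a : A, (a ^ 2 * (algebraMap ℝ A N - s ^ 2)) • e ∈ M)
    (hpos : ∀ (φ : V →ₗ[ℝ] ℝ) (Φ : A →ₐ[ℝ] ℝ), (∀ v ∈ M, 0 ≤ φ v) → φ e = 1 →
      (∀ p v, φ (p • v) = Φ p * φ v) → 0 < φ F) : F ∈ M := by
  by_contra hF
  obtain ⟨φ, hφ, hφe, hφF, hext⟩ := exists_extreme_state_nonpos M hunit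
    (exists_state_nonpos_of_notMem M he hunit hF)
  have hmul := extreme_state_smul M hsq he hunit hbd hφ hφe hext
  let Φ : A →ₐ[ℝ] ℝ := AlgHom.ofLinearMap
    (φ ∘ₗ (LinearMap.toSpanSingleton A V e).restrictScalars ℝ) (by simp [hφe])
    (fun p q => by
      simp only [LinearMap.comp_apply, LinearMap.coe_restrictScalars,
        LinearMap.toSpanSingleton_apply]
      rw [mul_smul, hmul p (q • e)])
  exact absurd (hpos φ Φ hφ hφe (fun p v => hmul p v)) (not_lt.2 hφF)

end PureStates

section QuadraticModule

variable {n m1 m2 : ℕ} {h : Fin m1 → MvPolynomial (Fin n) ℝ} {g : Fin m2 → MvPolynomial (Fin n) ℝ}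

theorem IsSOS.sq (p : MvPolynomial (Fin n) ℝ) : IsSOS (p ^ 2) :=
  ⟨1, fun _ => p, by simp⟩

theorem IsSOS.zero : IsSOS (0 : MvPolynomial (Fin n) ℝ) :=
  ⟨0, fun _ => 0, by simp⟩

theorem IsSOS.add {p q : MvPolynomial (Fin n) ℝ} (hp : IsSOS p) (hq : IsSOS q) :
    IsSOS (p + q) := by
  obtain ⟨k, a, rfl⟩ := hp
  obtain ⟨l, b, rfl⟩ := hq
  exact ⟨k + l, Fin.append a b, by simp [Fin.sum_univ_add]⟩

theorem IsSOS.sq_mul {p : MvPolynomial (Fin n) ℝ} (hp : IsSOS p) (a : MvPolynomial (Fin n) ℝ) :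
    IsSOS (a ^ 2 * p) := by
  obtain ⟨k, q, rfl⟩ := hp
  exact ⟨k, fun i => a * q i, by simp [Finset.mul_sum, mul_pow]⟩

theorem IsSOS.C {c : ℝ} (hc : 0 ≤ c) : IsSOS (C c : MvPolynomial (Fin n) ℝ) := by
  have := IsSOS.sq (MvPolynomial.C (Real.sqrt c) : MvPolynomial (Fin n) ℝ)
  rwa [← map_pow, Real.sq_sqrt hc] at this

theorem QM.add_mem {p q : MvPolynomial (Fin n) ℝ} (hp : p ∈ QM g) (hq : q ∈ QM g) :
    p + q ∈ QM g := by
  obtain ⟨s, σ, hs, hσ, rfl⟩ := hp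
  obtain ⟨t, τ, ht, hτ, rfl⟩ := hq
  refine ⟨s + t, fun j => σ j + τ j, hs.add ht, fun j => (hσ j).add (hτ j), ?_⟩
  simp only [add_mul, Finset.sum_add_distrib]
  ring

theorem QM.sq_mul_mem {p : MvPolynomial (Fin n) ℝ} (hp : p ∈ QM g)
    (a : MvPolynomial (Fin n) ℝ) : a ^ 2 * p ∈ QM g := by
  obtain ⟨s, σ, hs, hσ, rfl⟩ := hp
  refine ⟨a ^ 2 * s, fun j => a ^ 2 * σ j, hs.sq_mul a, fun j => (hσ j).sq_mul a, ?_⟩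
  simp only [mul_add, Finset.mul_sum, mul_assoc]

theorem QM.of_isSOS {p : MvPolynomial (Fin n) ℝ} (hp : IsSOS p) : p ∈ QM g :=
  ⟨p, fun _ => 0, hp, fun _ => IsSOS.zero, by simp⟩

theorem QM.generator_mem (j : Fin m2) : g j ∈ QM g := by
  classical
  refine ⟨0, Pi.single j 1, IsSOS.zero, fun i => ?_, ?_⟩
  · by_cases hij : i = j
    · subst hij
      simpa using IsSOS.sq (1 : MvPolynomial (Fin n) ℝ)
    · rw [Pi.single_eq_of_ne hij]
      exact IsSOS.zero
  · simp [Pi.single_apply]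

namespace idealPlusQM

theorem add_mem {p q : MvPolynomial (Fin n) ℝ} (hp : p ∈ idealPlusQM h g)
    (hq : q ∈ idealPlusQM h g) : p + q ∈ idealPlusQM h g := by
  obtain ⟨a, ha, b, hb, rfl⟩ := hp
  obtain ⟨c, hc, d, hd, rfl⟩ := hq
  exact ⟨a + c, Ideal.add_mem _ ha hc, b + d, QM.add_mem hb hd, by ring⟩

theorem sq_mul_mem {p : MvPolynomial (Fin n) ℝ} (hp : p ∈ idealPlusQM h g)
    (a : MvPolynomial (Fin n) ℝ) : a ^ 2 * p ∈ idealPlusQM h g := by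
  obtain ⟨b, hb, c, hc, rfl⟩ := hp
  exact ⟨a ^ 2 * b, Ideal.mul_mem_left _ _ hb, a ^ 2 * c, QM.sq_mul_mem hc a, by ring⟩

theorem of_mem_QM {p : MvPolynomial (Fin n) ℝ} (hp : p ∈ QM g) : p ∈ idealPlusQM h g :=
  ⟨0, Ideal.zero_mem _, p, hp, by simp⟩

theorem of_mem_span {p : MvPolynomial (Fin n) ℝ} (hp : p ∈ Ideal.span (Set.range h)) :
    p ∈ idealPlusQM h g :=
  ⟨p, hp, 0, QM.of_isSOS IsSOS.zero, by simp⟩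

theorem sq_mem (p : MvPolynomial (Fin n) ℝ) : p ^ 2 ∈ idealPlusQM h g :=
  of_mem_QM (QM.of_isSOS (IsSOS.sq p))

theorem zero_mem : (0 : MvPolynomial (Fin n) ℝ) ∈ idealPlusQM h g :=
  of_mem_span (Ideal.zero_mem _)

theorem C_mem {c : ℝ} (hc : 0 ≤ c) : C c ∈ idealPlusQM h g :=
  of_mem_QM (QM.of_isSOS (IsSOS.C hc))

theorem C_mul_mem {c : ℝ} (hc : 0 ≤ c) {p : MvPolynomial (Fin n) ℝ}
    (hp : p ∈ idealPlusQM h g) : C c * p ∈ idealPlusQM h g := by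
  have := sq_mul_mem hp (C (Real.sqrt c))
  rwa [← map_pow, Real.sq_sqrt hc] at this

theorem sum_mem {ι : Type*} (s : Finset ι) {p : ι → MvPolynomial (Fin n) ℝ}
    (hp : ∀ i ∈ s, p i ∈ idealPlusQM h g) : ∑ i ∈ s, p i ∈ idealPlusQM h g := by
  classical
  induction s using Finset.induction_on with
  | empty => simpa using zero_mem
  | insert a s ha ih =>
    rw [Finset.sum_insert ha]
    exact add_mem (hp a (by simp)) (ih fun i hi => hp i (by simp [hi]))

end idealPlusQM

open idealPlusQM

/-- The set `⟨h⟩ + Q(g)` as a convex cone. -/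
def idealPlusQMCone (h : Fin m1 → MvPolynomial (Fin n) ℝ) (g : Fin m2 → MvPolynomial (Fin n) ℝ) :
    PointedCone ℝ (MvPolynomial (Fin n) ℝ) where
  carrier := idealPlusQM h g
  add_mem' := add_mem
  zero_mem' := zero_mem
  smul_mem' c p hp := by
    change (c : ℝ) • p ∈ idealPlusQM h g
    rw [MvPolynomial.smul_eq_C_mul]
    exact C_mul_mem c.2 hp

theorem eval_nonneg_of_mem_idealPlusQM {p : MvPolynomial (Fin n) ℝ} (hp : p ∈ idealPlusQM h g)
    {x : Fin n → ℝ} (hh : ∀ i, eval x (h i) = 0) (hg : ∀ j, 0 ≤ eval x (g j)) :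
    0 ≤ eval x p := by
  obtain ⟨a, ha, b, ⟨s, σ, hs, hσ, rfl⟩, rfl⟩ := hp
  have hsos : ∀ q : MvPolynomial (Fin n) ℝ, IsSOS q → 0 ≤ eval x q := by
    rintro q ⟨k, r, rfl⟩
    rw [map_sum]
    exact Finset.sum_nonneg fun i _ => by rw [map_pow]; positivity
  have ha0 : eval x a = 0 := by
    have : Ideal.span (Set.range h) ≤ RingHom.ker (eval x) := by
      rw [Ideal.span_le]
      rintro _ ⟨i, rfl⟩
      exact hh i
    exact this ha
  simp only [map_add, map_sum, map_mul, ha0, zero_add]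
  exact add_nonneg (hsos _ hs) (Finset.sum_nonneg fun j _ => mul_nonneg (hsos _ (hσ j)) (hg j))

/-- In an archimedean quadratic module every polynomial is bounded. -/
theorem ArchimedeanCond.exists_bound (harch : ArchimedeanCond h g) (p : MvPolynomial (Fin n) ℝ) :
    ∃ N : ℝ, 0 < N ∧ C N - p ∈ idealPlusQM h g ∧ C N + p ∈ idealPlusQM h g := by
  have hadd : ∀ p q : MvPolynomial (Fin n) ℝ,
      (∃ N : ℝ, 0 < N ∧ C N - p ∈ idealPlusQM h g ∧ C N + p ∈ idealPlusQM h g) →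
      (∃ N : ℝ, 0 < N ∧ C N - q ∈ idealPlusQM h g ∧ C N + q ∈ idealPlusQM h g) →
      ∃ N : ℝ, 0 < N ∧ C N - (p + q) ∈ idealPlusQM h g ∧ C N + (p + q) ∈ idealPlusQM h g := by
    rintro p q ⟨N, hN, h1, h2⟩ ⟨L, hL, h3, h4⟩
    refine ⟨N + L, add_pos hN hL, ?_, ?_⟩
    · convert add_mem h1 h3 using 1
      rw [map_add]; ring
    · convert add_mem h2 h4 using 1
      rw [map_add]; ring
  have hneg : ∀ p : MvPolynomial (Fin n) ℝ,
      (∃ N : ℝ, 0 < N ∧ C N - p ∈ idealPlusQM h g ∧ C N + p ∈ idealPlusQM h g) →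
      (∃ N : ℝ, 0 < N ∧ C N - -p ∈ idealPlusQM h g ∧ C N + -p ∈ idealPlusQM h g) := by
    rintro p ⟨N, hN, h1, h2⟩
    exact ⟨N, hN, by rwa [sub_neg_eq_add], by rwa [← sub_eq_add_neg]⟩
  have hscale : ∀ (c : ℝ) (p : MvPolynomial (Fin n) ℝ), 0 < c →
      (∃ N : ℝ, 0 < N ∧ C N - p ∈ idealPlusQM h g ∧ C N + p ∈ idealPlusQM h g) →
      (∃ N : ℝ, 0 < N ∧ C N - C c * p ∈ idealPlusQM h g ∧ C N + C c * p ∈ idealPlusQM h g) := by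
    rintro c p hc ⟨N, hN, h1, h2⟩
    refine ⟨c * N, mul_pos hc hN, ?_, ?_⟩
    · convert C_mul_mem hc.le h1 using 1
      rw [map_mul]; ring
    · convert C_mul_mem hc.le h2 using 1
      rw [map_mul]; ring
  have hsq : ∀ p : MvPolynomial (Fin n) ℝ,
      (∃ N : ℝ, 0 < N ∧ C N - p ∈ idealPlusQM h g ∧ C N + p ∈ idealPlusQM h g) →
      (∃ N : ℝ, 0 < N ∧ C N - p ^ 2 ∈ idealPlusQM h g ∧ C N + p ^ 2 ∈ idealPlusQM h g) := by
    rintro p ⟨N, hN, h1, h2⟩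
    refine ⟨N ^ 2, by positivity, ?_, add_mem (C_mem (by positivity)) (sq_mem _)⟩
    have h3 := C_mul_mem (c := (2 * N)⁻¹) (by positivity)
      (add_mem (sq_mul_mem h1 (C N + p)) (sq_mul_mem h2 (C N - p)))
    convert h3 using 1
    have h4 : (C (2 * N)⁻¹ : MvPolynomial (Fin n) ℝ) * (2 * C N) = 1 := by
      rw [← map_ofNat C 2, ← map_mul, ← map_mul, inv_mul_cancel₀ (by positivity), map_one]
    rw [map_pow]
    linear_combination (-(C N ^ 2 - p ^ 2)) * h4
  obtain ⟨R, hR, hRM⟩ := harch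
  induction p using MvPolynomial.induction_on with
  | C a =>
    refine ⟨|a| + 1, by positivity, ?_, ?_⟩
    · rw [← map_sub]
      exact C_mem (by linarith [le_abs_self a])
    · rw [← map_add]
      exact C_mem (by linarith [neg_abs_le a])
  | add p q hp hq => exact hadd p q hp hq
  | mul_X p i hp =>
    have hX : ∃ N : ℝ, 0 < N ∧ C N - X i ∈ idealPlusQM h g ∧ C N + X i ∈ idealPlusQM h g := by
      have hXsq : C R - X i ^ 2 ∈ idealPlusQM h g := by
        have h2 : ∑ j ∈ Finset.univ.erase i, (X j : MvPolynomial (Fin n) ℝ) ^ 2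
            ∈ idealPlusQM h g := sum_mem _ fun j _ => sq_mem _
        convert add_mem hRM h2 using 1
        rw [← Finset.add_sum_erase _ _ (Finset.mem_univ i)]
        ring
      have h4 : (C (1 / 2) : MvPolynomial (Fin n) ℝ) * 2 = 1 := by
        rw [← map_ofNat C 2, ← map_mul]
        norm_num
      have h5 : (C (R + 1 / 4) : MvPolynomial (Fin n) ℝ) = C R + C (1 / 2) ^ 2 := by
        rw [← map_pow, ← map_add]
        norm_num
      refine ⟨R + 1 / 4, by positivity, ?_, ?_⟩
      · convert add_mem hXsq (sq_mem (X i - C (1 / 2))) using 1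
        rw [h5]
        linear_combination X i * h4
      · convert add_mem hXsq (sq_mem (X i + C (1 / 2))) using 1
        rw [h5]
        linear_combination -X i * h4
    have key : p * X i = C (1 / 4) * (p + X i) ^ 2 + -(C (1 / 4) * (p + -X i) ^ 2) := by
      have h4 : (C (1 / 4) : MvPolynomial (Fin n) ℝ) * 4 = 1 := by
        rw [← map_ofNat C 4, ← map_mul]
        norm_num
      linear_combination -p * X i * h4
    rw [key]
    exact hadd _ _ (hscale _ _ (by norm_num) (hsq _ (hadd _ _ hp hX)))
      (hneg _ (hscale _ _ (by norm_num) (hsq _ (hadd _ _ hp (hneg _ hX)))))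

theorem exists_trunc_decomposition {p : MvPolynomial (Fin n) ℝ} (hp : p ∈ idealPlusQM h g) :
    ∃ k0 : ℕ, ∀ ε : ℝ, 0 < ε →
      ∃ a ∈ truncIdeal h k0, ∃ b ∈ truncQM g k0, p + C ε = a + b := by
  obtain ⟨a, ha, b, ⟨s, σ, hs, hσ, rfl⟩, rfl⟩ := hp
  obtain ⟨φ, rfl⟩ := Ideal.mem_span_range_iff_exists_fun.1 ha
  set k0 := s.totalDegree + ∑ i, (φ i * h i).totalDegree + ∑ j, (σ j * g j).totalDegree with hk0
  have h1 : ∀ i, (φ i * h i).totalDegree ≤ 2 * k0 := fun i => by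
    have := Finset.single_le_sum (f := fun i => (φ i * h i).totalDegree)
      (fun _ _ => Nat.zero_le _) (Finset.mem_univ i)
    omega
  have h2 : ∀ j, (σ j * g j).totalDegree ≤ 2 * k0 := fun j => by
    have := Finset.single_le_sum (f := fun j => (σ j * g j).totalDegree)
      (fun _ _ => Nat.zero_le _) (Finset.mem_univ j)
    omega
  refine ⟨k0, fun ε hε => ⟨_, ⟨φ, h1, rfl⟩, _,
    ⟨s + C ε, σ, hs.add (IsSOS.C hε.le), hσ, ?_, h2, rfl⟩, by ring⟩⟩
  refine (totalDegree_add _ _).trans ?_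
  rw [totalDegree_C]
  omega

end QuadraticModule

section LocalAnalysis

variable {n : ℕ}

/-- The maximal ideal of polynomials vanishing at a point. -/
def pointIdeal (u : Fin n → ℝ) : Ideal (MvPolynomial (Fin n) ℝ) :=
  RingHom.ker (eval u)

/-- The `k`-th coordinate function centred at `u`. -/
def centred (u : Fin n → ℝ) (k : Fin n) : MvPolynomial (Fin n) ℝ :=
  X k - C (u k)

theorem mem_pointIdeal {u : Fin n → ℝ} {p : MvPolynomial (Fin n) ℝ} :
    p ∈ pointIdeal u ↔ eval u p = 0 := Iff.rfl

@[simp]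
theorem eval_centred (u x : Fin n → ℝ) (k : Fin n) : eval x (centred u k) = x k - u k := by
  simp [centred]

@[simp]
theorem pderiv_centred (u : Fin n → ℝ) (i k : Fin n) :
    pderiv i (centred u k) = if i = k then 1 else 0 := by
  classical
  rw [centred, map_sub, pderiv_C, sub_zero, pderiv_X, Pi.single_apply]
  simp only [eq_comm]

theorem pointIdeal_eq_span (u : Fin n → ℝ) :
    pointIdeal u = Ideal.span (Set.range (centred u)) := by
  apply le_antisymm
  · intro p hp
    have key : ∀ q : MvPolynomial (Fin n) ℝ,
        q - C (eval u q) ∈ Ideal.span (Set.range (centred u)) := by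
      intro q
      induction q using MvPolynomial.induction_on with
      | C a => simp
      | add p q hp hq =>
        convert Ideal.add_mem _ hp hq using 1
        simp only [map_add]; ring
      | mul_X p i hp =>
        have h1 : centred u i ∈ Ideal.span (Set.range (centred u)) :=
          Ideal.subset_span ⟨i, rfl⟩
        convert Ideal.add_mem _ (Ideal.mul_mem_right (X i) _ hp)
          (Ideal.mul_mem_left _ (C (eval u p)) h1) using 1
        simp only [map_mul, eval_X, centred]; ring
    have := key p
    rwa [mem_pointIdeal.1 hp, map_zero, sub_zero] at this
  · rw [Ideal.span_le]
    rintro _ ⟨k, rfl⟩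
    simp [mem_pointIdeal]

theorem exists_linear_expansion {u : Fin n → ℝ} {p : MvPolynomial (Fin n) ℝ}
    (hp : eval u p = 0) :
    ∃ q : Fin n → MvPolynomial (Fin n) ℝ, p = ∑ k, q k * centred u k ∧
      ∀ k, eval u (q k) = eval u (pderiv k p) := by
  have h1 : p ∈ Ideal.span (Set.range (centred u)) := by
    rw [← pointIdeal_eq_span]; exact hp
  obtain ⟨q, rfl⟩ := Ideal.mem_span_range_iff_exists_fun.1 h1
  refine ⟨q, rfl, fun k => ?_⟩
  simp [Derivation.leibniz, pderiv_centred, apply_ite (eval u)]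

/-- The quadratic expression with polynomial coefficients `G` in coordinates centred at `u`. -/
def quadExpr (u : Fin n → ℝ) (G : Fin n → Fin n → MvPolynomial (Fin n) ℝ) :
    MvPolynomial (Fin n) ℝ :=
  ∑ k, ∑ l, G k l * (centred u k * centred u l)

/-- The quadratic form with coefficient matrix `G(x)`. -/
def quadVal (x : Fin n → ℝ) (G : Fin n → Fin n → MvPolynomial (Fin n) ℝ) (v : Fin n → ℝ) : ℝ :=
  ∑ k, ∑ l, eval x (G k l) * (v k * v l)

theorem quadExpr_add (u : Fin n → ℝ) (G H : Fin n → Fin n → MvPolynomial (Fin n) ℝ) :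
    quadExpr u (G + H) = quadExpr u G + quadExpr u H := by
  simp only [quadExpr, Pi.add_apply, add_mul, Finset.sum_add_distrib]

theorem quadVal_add (x : Fin n → ℝ) (G H : Fin n → Fin n → MvPolynomial (Fin n) ℝ)
    (v : Fin n → ℝ) : quadVal x (G + H) v = quadVal x G v + quadVal x H v := by
  simp only [quadVal, Pi.add_apply, map_add, add_mul, Finset.sum_add_distrib]

theorem quadExpr_sum {ι : Type*} (s : Finset ι) (u : Fin n → ℝ)
    (G : ι → Fin n → Fin n → MvPolynomial (Fin n) ℝ) :
    quadExpr u (∑ i ∈ s, G i) = ∑ i ∈ s, quadExpr u (G i) := by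
  classical
  induction s using Finset.induction_on with
  | empty => simp [quadExpr]
  | insert a s ha ih => rw [Finset.sum_insert ha, Finset.sum_insert ha, quadExpr_add, ih]

theorem quadVal_sum {ι : Type*} (s : Finset ι) (x : Fin n → ℝ)
    (G : ι → Fin n → Fin n → MvPolynomial (Fin n) ℝ) (v : Fin n → ℝ) :
    quadVal x (∑ i ∈ s, G i) v = ∑ i ∈ s, quadVal x (G i) v := by
  classical
  induction s using Finset.induction_on with
  | empty => simp [quadVal]
  | insert a s ha ih => rw [Finset.sum_insert ha, Finset.sum_insert ha, quadVal_add, ih]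

theorem quadExpr_mul (u : Fin n → ℝ) (a b : Fin n → MvPolynomial (Fin n) ℝ) :
    quadExpr u (fun k l => a k * b l) = (∑ k, a k * centred u k) * ∑ l, b l * centred u l := by
  rw [Finset.sum_mul_sum]
  exact Finset.sum_congr rfl fun k _ => Finset.sum_congr rfl fun l _ => by ring

theorem quadVal_mul (x : Fin n → ℝ) (a b : Fin n → MvPolynomial (Fin n) ℝ) (v : Fin n → ℝ) :
    quadVal x (fun k l => a k * b l) v = (∑ k, eval x (a k) * v k) * ∑ l, eval x (b l) * v l := by
  rw [Finset.sum_mul_sum]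
  exact Finset.sum_congr rfl fun k _ => Finset.sum_congr rfl fun l _ => by
    rw [map_mul]; ring

theorem eval_quadExpr (u x : Fin n → ℝ) (G : Fin n → Fin n → MvPolynomial (Fin n) ℝ) :
    eval x (quadExpr u G) = quadVal x G (x - u) := by
  simp [quadExpr, quadVal]

theorem exists_quadExpr_of_mem_sq {u : Fin n → ℝ} {p : MvPolynomial (Fin n) ℝ}
    (hp : p ∈ pointIdeal u ^ 2) : ∃ G, p = quadExpr u G := by
  rw [pow_two] at hp
  induction hp using Submodule.mul_induction_on' with
  | mem_mul_mem a ha b hb =>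
    obtain ⟨a, rfl, -⟩ := exists_linear_expansion (mem_pointIdeal.1 ha)
    obtain ⟨b, rfl, -⟩ := exists_linear_expansion (mem_pointIdeal.1 hb)
    exact ⟨_, (quadExpr_mul u a b).symm⟩
  | add p _ q _ hp hq =>
    obtain ⟨G, rfl⟩ := hp
    obtain ⟨H, rfl⟩ := hq
    exact ⟨G + H, (quadExpr_add u G H).symm⟩

theorem exists_quadExpr_of_mem_cube {u : Fin n → ℝ} {p : MvPolynomial (Fin n) ℝ}
    (hp : p ∈ pointIdeal u ^ 3) : ∃ G, p = quadExpr u G ∧ ∀ k l, eval u (G k l) = 0 := by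
  rw [pow_succ' _ 2] at hp
  induction hp using Submodule.mul_induction_on' with
  | mem_mul_mem a ha b hb =>
    obtain ⟨G, rfl⟩ := exists_quadExpr_of_mem_sq hb
    refine ⟨fun k l => a * G k l, ?_, fun k l => ?_⟩
    · simp only [quadExpr, Finset.mul_sum, mul_assoc]
    · rw [map_mul, mem_pointIdeal.1 ha, zero_mul]
  | add p _ q _ hp hq =>
    obtain ⟨G, rfl, hG⟩ := hp
    obtain ⟨H, rfl, hH⟩ := hq
    exact ⟨G + H, (quadExpr_add u G H).symm, fun k l => by simp [hG, hH]⟩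

theorem quadExpr_mem_sq (u : Fin n → ℝ) (G : Fin n → Fin n → MvPolynomial (Fin n) ℝ) :
    quadExpr u G ∈ pointIdeal u ^ 2 := by
  refine Ideal.sum_mem _ fun k _ => Ideal.sum_mem _ fun l _ => Ideal.mul_mem_left _ _ ?_
  rw [pow_two]
  exact Ideal.mul_mem_mul (by simp [mem_pointIdeal]) (by simp [mem_pointIdeal])

theorem exists_quadExpr_of_critical {u : Fin n → ℝ} {p : MvPolynomial (Fin n) ℝ}
    (hp : eval u p = 0) (hgrad : ∀ k, eval u (pderiv k p) = 0) :
    ∃ G, p = quadExpr u G ∧ ∀ v, v ⬝ᵥ (hessAt p u).mulVec v = 2 * quadVal u G v := by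
  obtain ⟨q, hpq, hq⟩ := exists_linear_expansion hp
  choose G hG hG' using fun k => exists_linear_expansion ((hq k).trans (hgrad k))
  have hpG : p = quadExpr u G := by
    rw [hpq]
    refine Finset.sum_congr rfl fun k _ => ?_
    conv_lhs => rw [hG k]
    rw [Finset.sum_mul]
    exact Finset.sum_congr rfl fun l _ => by ring
  refine ⟨G, hpG, fun v => ?_⟩
  have hess : ∀ i j, eval u (pderiv i (pderiv j p)) = eval u (G i j) + eval u (G j i) := by
    intro i j
    have h1 : pderiv j p = (∑ k, pderiv j (q k) * centred u k) + q j := by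
      conv_lhs => rw [hpq]
      simp [Derivation.leibniz, pderiv_centred, Finset.sum_add_distrib, mul_comm, add_comm]
    rw [h1, hG' i j, hG' j i]
    simp [Derivation.leibniz, pderiv_centred, Finset.sum_add_distrib]
  have h2 : v ⬝ᵥ (hessAt p u).mulVec v
      = (∑ k, ∑ l, eval u (G k l) * (v k * v l)) + ∑ k, ∑ l, eval u (G l k) * (v k * v l) := by
    simp only [dotProduct, mulVec, hessAt, of_apply, hess, Finset.mul_sum,
      ← Finset.sum_add_distrib]
    exact Finset.sum_congr rfl fun k _ => Finset.sum_congr rfl fun l _ => by ring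
  rw [h2, Finset.sum_comm (f := fun k l => eval u (G l k) * (v k * v l)), quadVal, two_mul]
  congr 1
  exact Finset.sum_congr rfl fun k _ => Finset.sum_congr rfl fun l _ => by ring

/-- `F` vanishes to second order at `u`, with positive definite quadratic part. -/
def PosDefAt (u : Fin n → ℝ) (F : MvPolynomial (Fin n) ℝ) : Prop :=
  ∃ c : ℝ, 0 < c ∧ ∃ G, F = quadExpr u G ∧ ∀ v, c * ∑ k, v k ^ 2 ≤ quadVal u G v

theorem PosDefAt.add_mem_cube {u : Fin n → ℝ} {F r : MvPolynomial (Fin n) ℝ}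
    (hF : PosDefAt u F) (hr : r ∈ pointIdeal u ^ 3) : PosDefAt u (F + r) := by
  obtain ⟨c, hc, G, rfl, hG⟩ := hF
  obtain ⟨H, rfl, hH⟩ := exists_quadExpr_of_mem_cube hr
  refine ⟨c, hc, G + H, (quadExpr_add u G H).symm, fun v => ?_⟩
  have : quadVal u H v = 0 := by simp [quadVal, hH]
  rw [quadVal_add, this, add_zero]
  exact hG v

theorem PosDefAt.mem_sq {u : Fin n → ℝ} {F : MvPolynomial (Fin n) ℝ} (hF : PosDefAt u F) :
    F ∈ pointIdeal u ^ 2 := by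
  obtain ⟨c, -, G, rfl, -⟩ := hF
  exact quadExpr_mem_sq u G

theorem sum_sq_pos {v : Fin n → ℝ} (hv : v ≠ 0) : 0 < ∑ k, v k ^ 2 := by
  obtain ⟨k, hk⟩ := Function.ne_iff.1 hv
  exact Finset.sum_pos' (fun _ _ => sq_nonneg _) ⟨k, Finset.mem_univ k, by
    have : v k ≠ 0 := hk
    positivity⟩

theorem PosDefAt.eventually_pos {u : Fin n → ℝ} {F : MvPolynomial (Fin n) ℝ}
    (hF : PosDefAt u F) : ∀ᶠ x in nhds u, x ≠ u → 0 < eval x F := by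
  obtain ⟨c, hc, G, rfl, hG⟩ := hF
  set δ : ℝ := c / (2 * (n ^ 2 + 1)) with hδ
  have hδ0 : 0 < δ := by positivity
  have hcont : ∀ k l, ∀ᶠ x in nhds u, |eval x (G k l) - eval u (G k l)| < δ := by
    intro k l
    have h1 : Filter.Tendsto (fun x => eval x (G k l)) (nhds u) (nhds (eval u (G k l))) :=
      (MvPolynomial.continuous_eval (G k l)).tendsto u
    exact h1.eventually (Metric.ball_mem_nhds _ hδ0)
  have hall : ∀ᶠ x in nhds u, ∀ k l, |eval x (G k l) - eval u (G k l)| < δ :=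
    Filter.eventually_all.2 fun k => Filter.eventually_all.2 fun l => hcont k l
  filter_upwards [hall] with x hx hxu
  rw [eval_quadExpr]
  set v := x - u with hv
  have hv0 : 0 < ∑ k, v k ^ 2 := sum_sq_pos (sub_ne_zero.2 hxu)
  have hterm : ∀ k l, eval u (G k l) * (v k * v l) - δ * ∑ i, v i ^ 2
      ≤ eval x (G k l) * (v k * v l) := by
    intro k l
    have hk := Finset.single_le_sum (f := fun i => v i ^ 2) (fun _ _ => sq_nonneg _)
      (Finset.mem_univ k)
    have hl := Finset.single_le_sum (f := fun i => v i ^ 2) (fun _ _ => sq_nonneg _)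
      (Finset.mem_univ l)
    have h1 : |v k * v l| ≤ ∑ i, v i ^ 2 := by
      rw [abs_le]
      constructor <;> nlinarith [sq_nonneg (v k + v l), sq_nonneg (v k - v l)]
    have h2 : |(eval x (G k l) - eval u (G k l)) * (v k * v l)| ≤ δ * ∑ i, v i ^ 2 := by
      rw [abs_mul]
      exact mul_le_mul (hx k l).le h1 (abs_nonneg _) hδ0.le
    have := neg_abs_le ((eval x (G k l) - eval u (G k l)) * (v k * v l))
    linarith
  have hsum : quadVal u G v - n ^ 2 * δ * ∑ i, v i ^ 2 ≤ quadVal x G v := by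
    calc quadVal u G v - n ^ 2 * δ * ∑ i, v i ^ 2
        = ∑ k, ∑ l, (eval u (G k l) * (v k * v l) - δ * ∑ i, v i ^ 2) := by
          simp only [Finset.sum_sub_distrib, Finset.sum_const, Finset.card_univ,
            Fintype.card_fin, nsmul_eq_mul, quadVal]
          ring
      _ ≤ _ := Finset.sum_le_sum fun k _ => Finset.sum_le_sum fun l _ => hterm k l
  have hsmall : n ^ 2 * δ < c := by
    rw [hδ, mul_div_assoc', div_lt_iff₀ (by positivity)]
    nlinarith [sq_nonneg (n : ℝ)]
  have := hG v
  nlinarith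

end LocalAnalysis

section Positivstellensatz

variable {n m1 m2 : ℕ} {h : Fin m1 → MvPolynomial (Fin n) ℝ} {g : Fin m2 → MvPolynomial (Fin n) ℝ}

open idealPlusQM

/-- A positive multiple of a sum of squares of generators dominates every element of the square of
an ideal, modulo an archimedean `⟨h⟩ + Q(g)`. -/
theorem exists_C_mul_sum_sq_add_mem (harch : ArchimedeanCond h g)
    (S : Finset (MvPolynomial (Fin n) ℝ)) {v : MvPolynomial (Fin n) ℝ}
    (hv : v ∈ Ideal.span (S : Set (MvPolynomial (Fin n) ℝ)) ^ 2) :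
    ∃ k : ℝ, C k * ∑ a ∈ S, a ^ 2 + v ∈ idealPlusQM h g := by
  classical
  suffices H : ∀ r, ∃ k : ℝ, C k * ∑ a ∈ S, a ^ 2 + r * v ∈ idealPlusQM h g by
    simpa using H 1
  rw [pow_two, Ideal.span_mul_span'] at hv
  induction hv using Submodule.span_induction with
  | mem x hx =>
    intro r
    obtain ⟨a, ha, b, hb, rfl⟩ := Set.mem_mul.1 hx
    obtain ⟨N, hN, h1, h2⟩ := harch.exists_bound r
    refine ⟨N, ?_⟩
    have hsq : ∀ c ∈ S, ∑ x ∈ S, x ^ 2 - c ^ 2 ∈ idealPlusQM h g := fun c hc => by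
      rw [← Finset.add_sum_erase S _ hc, add_sub_cancel_left]
      exact sum_mem _ fun i _ => sq_mem i
    have h3 := sq_mul_mem h2 (a + b)
    have h4 := sq_mul_mem h1 (a - b)
    have h5 := C_mul_mem (c := 1 / 4) (by norm_num) (add_mem h3 h4)
    have h6 := C_mul_mem (c := N / 2) (by positivity) (add_mem (hsq a ha) (hsq b hb))
    convert add_mem h5 h6 using 1
    have e1 : (C (N / 2) : MvPolynomial (Fin n) ℝ) = C N * C (1 / 2) := by
      rw [← C_mul]; congr 1; ring
    have e2 : (C (1 / 2) : MvPolynomial (Fin n) ℝ) = 2 * C (1 / 4) := by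
      rw [show (2 : MvPolynomial (Fin n) ℝ) = C 2 from (map_ofNat C 2).symm, ← C_mul]
      congr 1; norm_num
    have e3 : (4 : MvPolynomial (Fin n) ℝ) * C (1 / 4) = 1 := by
      rw [show (4 : MvPolynomial (Fin n) ℝ) = C 4 from (map_ofNat C 4).symm, ← C_mul, ← C_1]
      congr 1; norm_num
    rw [e1, e2]
    linear_combination (-(C N * ∑ x ∈ S, x ^ 2) - r * (a * b)) * e3
  | zero => intro r; exact ⟨0, by simpa using zero_mem⟩
  | add x y _ _ hx hy =>
    intro r
    obtain ⟨k, hk⟩ := hx r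
    obtain ⟨l, hl⟩ := hy r
    refine ⟨k + l, ?_⟩
    convert add_mem hk hl using 1
    rw [map_add]; ring
  | smul a x _ hx =>
    intro r
    obtain ⟨k, hk⟩ := hx (r * a)
    exact ⟨k, by rwa [smul_eq_mul, ← mul_assoc]⟩

/-- Membership in an archimedean `⟨h⟩ + Q(g)` for an element of the square of an ideal `I`,
tested on the multiplicative states of `I ^ 2`. -/
theorem mem_idealPlusQM_of_states_pos (harch : ArchimedeanCond h g)
    (I : Ideal (MvPolynomial (Fin n) ℝ)) (F : ↥(I ^ 2))
    (hpos : ∀ (z : Fin n → ℝ) (φ : ↥(I ^ 2) →ₗ[ℝ] ℝ), (∀ i, eval z (h i) = 0) →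
      (∀ j, 0 ≤ eval z (g j)) → (∀ p (v : ↥(I ^ 2)), φ (p • v) = eval z p * φ v) →
      (∀ v : ↥(I ^ 2), (v : MvPolynomial (Fin n) ℝ) ∈ idealPlusQM h g → 0 ≤ φ v) → φ ≠ 0 → 0 < φ F) :
    (F : MvPolynomial (Fin n) ℝ) ∈ idealPlusQM h g := by
  classical
  obtain ⟨S, hS⟩ : I.FG := IsNoetherian.noetherian I
  set ψ : MvPolynomial (Fin n) ℝ := ∑ a ∈ S, a ^ 2 with hψ
  have hψI : ψ ∈ I ^ 2 := Ideal.sum_mem _ fun a ha =>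
    Ideal.pow_mem_pow (hS ▸ Ideal.subset_span ha) 2
  have hψmul : ∀ p, p ∈ idealPlusQM h g → p * ψ ∈ idealPlusQM h g := fun p hp => by
    rw [hψ, Finset.mul_sum]
    exact sum_mem _ fun a _ => by rw [mul_comm]; exact sq_mul_mem hp a
  have key := mem_of_forall_multiplicative_state_pos (A := MvPolynomial (Fin n) ℝ)
    ((idealPlusQMCone h g).comap ((I ^ 2).subtype.restrictScalars ℝ)) (e := ⟨ψ, hψI⟩) (F := F)
    ?_ ?_ ?_ ?_ ?_
  · exact key
  · intro a v hv
    exact sq_mul_mem hv a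
  · exact sum_mem _ fun a _ => sq_mem a
  · intro v
    obtain ⟨k, hk⟩ := exists_C_mul_sum_sq_add_mem harch S (v := v) (by
      rw [show Ideal.span (S : Set (MvPolynomial (Fin n) ℝ)) = I from hS]
      exact v.2)
    refine ⟨k, ?_⟩
    change k • ψ + (v : MvPolynomial (Fin n) ℝ) ∈ idealPlusQM h g
    rwa [MvPolynomial.smul_eq_C_mul]
  · intro s
    obtain ⟨N, hN, h1, -⟩ := harch.exists_bound (s ^ 2)
    exact ⟨N, hN, fun a => hψmul _ (sq_mul_mem h1 a)⟩
  · intro φ Φ hφ hφe hmul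
    set z : Fin n → ℝ := fun i => Φ (X i) with hz
    have hΦ : ∀ p, Φ p = eval z p := fun p => by
      have : Φ = aeval z := MvPolynomial.algHom_ext fun i => by simp [hz]
      rw [this, MvPolynomial.aeval_eq_eval]
    have hmul' : ∀ p v, φ (p • v) = eval z p * φ v := fun p v => by rw [hmul, hΦ]
    have hval : ∀ p, p ∈ idealPlusQM h g → 0 ≤ eval z p := fun p hp => by
      have := hφ (p • ⟨ψ, hψI⟩) (hψmul p hp)
      rwa [hmul', hφe, mul_one] at this
    refine hpos z φ (fun i => ?_) (fun j => hval _ (of_mem_QM (QM.generator_mem j))) hmul' hφ ?_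
    · have hi : h i ∈ Ideal.span (Set.range h) := Ideal.subset_span ⟨i, rfl⟩
      have h1 := hval _ (of_mem_span hi)
      have h2 := hval _ (of_mem_span (neg_mem hi))
      rw [map_neg] at h2
      linarith
    · rintro rfl
      simp at hφe

theorem isCoprime_pointIdeal {u v : Fin n → ℝ} (huv : u ≠ v) :
    IsCoprime (pointIdeal u) (pointIdeal v) := by
  obtain ⟨k, hk⟩ := Function.ne_iff.1 huv
  have hk' : v k - u k ≠ 0 := sub_ne_zero.2 hk.symm
  refine Ideal.isCoprime_iff_exists.2 ⟨C (v k - u k)⁻¹ * centred u k, ?_,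
    C (-(v k - u k)⁻¹) * centred v k, ?_, ?_⟩
  · simp [mem_pointIdeal]
  · simp [mem_pointIdeal]
  · have : (C (v k - u k)⁻¹ : MvPolynomial (Fin n) ℝ) * (C (v k) - C (u k)) = 1 := by
      rw [← map_sub, ← map_mul, inv_mul_cancel₀ hk', map_one]
    rw [centred, centred, map_neg]
    linear_combination this

theorem mem_prod_pointIdeal_pow {U : Finset (Fin n → ℝ)} {m : ℕ} {p : MvPolynomial (Fin n) ℝ} :
    p ∈ (∏ u ∈ U, pointIdeal u) ^ m ↔ ∀ u ∈ U, p ∈ pointIdeal u ^ m := by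
  rw [← Finset.prod_pow, Ideal.prod_eq_iInf_of_pairwise_isCoprime]
  · simp
  · intro u _ v _ huv
    exact (isCoprime_pointIdeal huv).pow

theorem PosDefAt.state_pos {U : Finset (Fin n → ℝ)} {u : Fin n → ℝ} (hu : u ∈ U)
    {I : Ideal (MvPolynomial (Fin n) ℝ)} (hI : I = ∏ v ∈ U, pointIdeal v)
    (φ : ↥(I ^ 2) →ₗ[ℝ] ℝ) (hφ : ∀ p (v : ↥(I ^ 2)), φ (p • v) = eval u p * φ v)
    (hsq : ∀ p, ∀ hp : p ^ 2 ∈ I ^ 2, 0 ≤ φ ⟨p ^ 2, hp⟩) (hne : φ ≠ 0)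
    (F : ↥(I ^ 2)) (hF : PosDefAt u (F : MvPolynomial (Fin n) ℝ)) : 0 < φ F := by
  classical
  obtain ⟨q, hq1, hqI⟩ : ∃ q, eval u q = 1 ∧ ∀ k, q * centred u k ∈ I := by
    have : IsCoprime (pointIdeal u) (∏ v ∈ U.erase u, pointIdeal v) :=
      IsCoprime.prod_right fun v hv => isCoprime_pointIdeal (Finset.ne_of_mem_erase hv).symm
    obtain ⟨a, ha, q, hq, haq⟩ := Ideal.isCoprime_iff_exists.1 this
    refine ⟨q, ?_, fun k => ?_⟩
    · have := congrArg (eval u) haq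
      rwa [map_add, mem_pointIdeal.1 ha, zero_add, map_one] at this
    · rw [hI, ← Finset.mul_prod_erase U _ hu, mul_comm q]
      exact Ideal.mul_mem_mul (by simp [mem_pointIdeal]) hq
  have hmem : ∀ k l, q * centred u k * (q * centred u l) ∈ I ^ 2 := fun k l => by
    rw [pow_two]; exact Ideal.mul_mem_mul (hqI k) (hqI l)
  set B : Matrix (Fin n) (Fin n) ℝ := Matrix.of fun k l => φ ⟨_, hmem k l⟩ with hB
  have hquad : ∀ (w : ↥(I ^ 2)) (G : Fin n → Fin n → MvPolynomial (Fin n) ℝ),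
      (w : MvPolynomial (Fin n) ℝ) = quadExpr u G → φ w = ∑ k, ∑ l, eval u (G k l) * B k l := by
    intro w G hw
    have h1 : q ^ 2 • w = ∑ k, ∑ l, G k l • (⟨_, hmem k l⟩ : ↥(I ^ 2)) := by
      apply Subtype.ext
      simp only [Submodule.coe_smul, Submodule.coe_sum, smul_eq_mul, hw, quadExpr, Finset.mul_sum]
      exact Finset.sum_congr rfl fun k _ => Finset.sum_congr rfl fun l _ => by ring
    have h2 := hφ (q ^ 2) w
    rw [map_pow, hq1, one_pow, one_mul, h1] at h2
    rw [← h2, map_sum]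
    refine Finset.sum_congr rfl fun k _ => ?_
    rw [map_sum]
    exact Finset.sum_congr rfl fun l _ => hφ _ _
  have hBpsd : B.PosSemidef := by
    refine Matrix.PosSemidef.of_dotProduct_mulVec_nonneg ?_ fun x => ?_
    · ext k l
      simp only [Matrix.conjTranspose_apply, hB, Matrix.of_apply, star_trivial]
      congr 2; ring
    · have hp : (∑ k, C (x k) * (q * centred u k)) ^ 2 ∈ I ^ 2 :=
        Ideal.pow_mem_pow (Ideal.sum_mem _ fun k _ => Ideal.mul_mem_left _ _ (hqI k)) 2
      have h1 := hsq _ hp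
      have h2 : (⟨_, hp⟩ : ↥(I ^ 2)) = ∑ k, ∑ l, (x k * x l) • (⟨_, hmem k l⟩ : ↥(I ^ 2)) := by
        apply Subtype.ext
        simp only [Submodule.coe_smul_of_tower, Submodule.coe_sum, pow_two, Finset.sum_mul_sum,
          MvPolynomial.smul_eq_C_mul, C_mul]
        exact Finset.sum_congr rfl fun k _ => Finset.sum_congr rfl fun l _ => by ring
      rw [h2] at h1
      refine h1.trans_eq ?_
      simp only [dotProduct, Matrix.mulVec, Finset.mul_sum, map_sum, map_smul, smul_eq_mul,
        star_trivial, hB, Matrix.of_apply]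
      exact Finset.sum_congr rfl fun k _ => Finset.sum_congr rfl fun l _ => by ring
  obtain ⟨m, w, hw⟩ := Matrix.posSemidef_iff_eq_sum_vecMulVec.1 hBpsd
  have hBkl : ∀ k l, B k l = ∑ i, w i k * w i l := fun k l => by
    rw [hw]; simp [Matrix.sum_apply, Matrix.vecMulVec_apply]
  obtain ⟨c, hc, G, hFG, hG⟩ := hF
  have hφF : φ F = ∑ i, quadVal u G (w i) := by
    rw [hquad F G hFG]
    simp only [hBkl, quadVal, Finset.mul_sum]
    symm
    rw [Finset.sum_comm]
    exact Finset.sum_congr rfl fun k _ => Finset.sum_comm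
  rw [hφF]
  have hnn : ∀ i, 0 ≤ quadVal u G (w i) := fun i =>
    (mul_nonneg hc.le (Finset.sum_nonneg fun _ _ => sq_nonneg _)).trans (hG _)
  refine (Finset.sum_nonneg fun i _ => hnn i).lt_of_ne' fun h0 => hne ?_
  have hw0 : ∀ i, w i = 0 := fun i => by
    by_contra hi
    have h1 := (Finset.sum_eq_zero_iff_of_nonneg fun i _ => hnn i).1 h0 i (Finset.mem_univ i)
    have h2 := hG (w i)
    rw [h1] at h2
    exact absurd (mul_pos hc (sum_sq_pos hi)) (not_lt.2 h2)
  ext v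
  obtain ⟨H, hH⟩ := exists_quadExpr_of_mem_sq (mem_prod_pointIdeal_pow.1 (by rw [← hI]; exact v.2) u hu)
  rw [hquad v H hH]
  simp [hBkl, hw0]

/-- A polynomial that is positive on the feasible set, except for finitely many points where it
vanishes with a positive definite quadratic part, belongs to an archimedean `⟨h⟩ + Q(g)`. -/
theorem mem_idealPlusQM_of_posDefAt (harch : ArchimedeanCond h g) (U : Finset (Fin n → ℝ))
    {F : MvPolynomial (Fin n) ℝ}
    (hpos : ∀ z, (∀ i, eval z (h i) = 0) → (∀ j, 0 ≤ eval z (g j)) → z ∉ U → 0 < eval z F)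
    (hU : ∀ u ∈ U, PosDefAt u F) : F ∈ idealPlusQM h g := by
  classical
  refine mem_idealPlusQM_of_states_pos harch (∏ u ∈ U, pointIdeal u)
    ⟨F, mem_prod_pointIdeal_pow.2 fun u hu => (hU u hu).mem_sq⟩ fun z φ hh hg hφ hφM hne => ?_
  by_cases hz : z ∈ U
  · exact (hU z hz).state_pos hz rfl φ hφ (fun p hp => hφM _ (sq_mem p)) hne
  · obtain ⟨θ, hθ, hθz⟩ : ∃ θ ∈ ∏ u ∈ U, pointIdeal u, eval z θ ≠ 0 := by
      refine ⟨∏ u ∈ U, ∑ k, centred u k ^ 2, Ideal.prod_mem_prod fun u _ => ?_, ?_⟩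
      · simp [mem_pointIdeal]
      · rw [map_prod]
        refine Finset.prod_ne_zero_iff.2 fun u hu => ?_
        have hzu : z - u ≠ 0 := sub_ne_zero.2 fun h => hz (h ▸ hu)
        have := sum_sq_pos hzu
        simpa using this.ne'
    have hθ2 := Ideal.pow_mem_pow hθ 2
    have hcomm : ∀ a b : ↥((∏ u ∈ U, pointIdeal u) ^ 2),
        eval z (a : MvPolynomial (Fin n) ℝ) * φ b = eval z (b : MvPolynomial (Fin n) ℝ) * φ a := by
      intro a b
      rw [← hφ, ← hφ]
      congr 1
      apply Subtype.ext
      simp [mul_comm]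
    obtain ⟨v, hv⟩ : ∃ v, φ v ≠ 0 := by
      by_contra! hv
      exact hne (LinearMap.ext hv)
    have hsq : 0 < eval z (θ ^ 2) := by
      rw [map_pow]; positivity
    have h1 : 0 < φ ⟨θ ^ 2, hθ2⟩ := by
      refine (hφM _ (sq_mem θ)).lt_of_ne' fun h0 => ?_
      have := hcomm ⟨θ ^ 2, hθ2⟩ v
      rw [h0, mul_zero] at this
      exact (mul_ne_zero hsq.ne' hv) this
    have h2 := hcomm ⟨θ ^ 2, hθ2⟩ ⟨F, mem_prod_pointIdeal_pow.2 fun u hu => (hU u hu).mem_sq⟩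
    have h3 := mul_pos (hpos z hh hg hz) h1
    rw [← h2] at h3
    exact pos_of_mul_pos_right h3 hsq.le

end Positivstellensatz

section LocalCertificate

variable {n m1 m2 : ℕ}

/-- Finsler's lemma for homogeneous functions of degree two. -/
theorem exists_add_mul_ge_sum_sq {q r : (Fin n → ℝ) → ℝ} (hq : Continuous q) (hr : Continuous r)
    (hq2 : ∀ (t : ℝ) v, q (t • v) = t ^ 2 * q v) (hr2 : ∀ (t : ℝ) v, r (t • v) = t ^ 2 * r v)
    (hr0 : ∀ v, 0 ≤ r v) (hqr : ∀ v, v ≠ 0 → r v = 0 → 0 < q v) :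
    ∃ N : ℝ, ∃ c : ℝ, 0 < c ∧ ∀ v, c * ∑ k, v k ^ 2 ≤ q v + N * r v := by
  have hcpt : IsCompact (Metric.sphere (0 : Fin n → ℝ) 1) := isCompact_sphere _ _
  have hcont : ∀ N : ℝ, Continuous fun v => q v + N * r v := fun N => by fun_prop
  obtain ⟨N, hN⟩ := hcpt.elim_directed_cover (fun N : ℕ => {v | 0 < q v + N * r v})
    (fun N => isOpen_lt continuous_const (hcont N)) (fun v hv => by
      have hv0 : v ≠ 0 := by
        rintro rfl
        simp at hv
      rw [Set.mem_iUnion]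
      rcases (hr0 v).eq_or_lt with h0 | h0
      · exact ⟨0, by simpa using hqr v hv0 h0.symm⟩
      · obtain ⟨N, hN⟩ := exists_nat_gt (-q v / r v)
        refine ⟨N, ?_⟩
        rw [div_lt_iff₀ h0] at hN
        change 0 < q v + N * r v
        linarith)
    (directed_of_isDirected_le fun M N hMN v (hv : 0 < q v + M * r v) => by
      change 0 < q v + N * r v
      have : (M : ℝ) * r v ≤ N * r v := mul_le_mul_of_nonneg_right (by exact_mod_cast hMN) (hr0 v)
      linarith)
  obtain ⟨δ, hδ, hδN⟩ := hcpt.exists_forall_le' (hcont N).continuousOn (a := 0) fun v hv => hN hv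
  refine ⟨N, δ / (n + 1), by positivity, fun v => ?_⟩
  rcases eq_or_ne v 0 with rfl | hv
  · have h1 := hq2 0 0
    have h2 := hr2 0 0
    simp at h1 h2
    simp [h1, h2]
  · have hv' : 0 < ‖v‖ := norm_pos_iff.2 hv
    have h1 := hδN (‖v‖⁻¹ • v) (by simp [norm_smul, hv'.ne'])
    simp only [hq2, hr2] at h1
    have h2 : δ * ‖v‖ ^ 2 ≤ q v + N * r v := by
      have := mul_le_mul_of_nonneg_right h1 (sq_nonneg ‖v‖)
      refine this.trans_eq ?_
      field_simp
    have h3 : ∑ k, v k ^ 2 ≤ (n + 1) * ‖v‖ ^ 2 := by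
      calc ∑ k, v k ^ 2 ≤ ∑ _k : Fin n, ‖v‖ ^ 2 := Finset.sum_le_sum fun k _ => by
            have := norm_le_pi_norm v k
            rw [Real.norm_eq_abs] at this
            rw [← sq_abs]
            gcongr
        _ ≤ (n + 1) * ‖v‖ ^ 2 := by
            rw [Finset.sum_const, Finset.card_univ, Fintype.card_fin, nsmul_eq_mul]
            nlinarith [sq_nonneg ‖v‖]
    calc δ / (n + 1) * ∑ k, v k ^ 2 ≤ δ / (n + 1) * ((n + 1) * ‖v‖ ^ 2) := by gcongr
      _ = δ * ‖v‖ ^ 2 := by field_simp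
      _ ≤ _ := h2

theorem continuous_quadVal (x : Fin n → ℝ) (G : Fin n → Fin n → MvPolynomial (Fin n) ℝ) :
    Continuous (quadVal x G) := by
  unfold quadVal
  fun_prop

theorem quadVal_smul_right (x : Fin n → ℝ) (G : Fin n → Fin n → MvPolynomial (Fin n) ℝ) (t : ℝ)
    (v : Fin n → ℝ) : quadVal x G (t • v) = t ^ 2 * quadVal x G v := by
  simp only [quadVal, Finset.mul_sum, Pi.smul_apply, smul_eq_mul]
  exact Finset.sum_congr rfl fun k _ => Finset.sum_congr rfl fun l _ => by ring

theorem quadExpr_smul (u : Fin n → ℝ) (p : MvPolynomial (Fin n) ℝ)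
    (G : Fin n → Fin n → MvPolynomial (Fin n) ℝ) :
    quadExpr u (p • G) = p * quadExpr u G := by
  simp only [quadExpr, Finset.mul_sum, Pi.smul_apply, smul_eq_mul, mul_assoc]

theorem quadVal_smul_left (x : Fin n → ℝ) (p : MvPolynomial (Fin n) ℝ)
    (G : Fin n → Fin n → MvPolynomial (Fin n) ℝ) (v : Fin n → ℝ) :
    quadVal x (p • G) v = eval x p * quadVal x G v := by
  simp only [quadVal, Finset.mul_sum, Pi.smul_apply, smul_eq_mul, map_mul, mul_assoc]

/-- The linear part of the Taylor expansion of `p` at `u`. -/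
def linearPart (u : Fin n → ℝ) (p : MvPolynomial (Fin n) ℝ) : MvPolynomial (Fin n) ℝ :=
  ∑ k, C (gradAt p u k) * centred u k

/-- The coefficients of the square of the linear part of `p` at `u`. -/
def gradSq (u : Fin n → ℝ) (p : MvPolynomial (Fin n) ℝ) :
    Fin n → Fin n → MvPolynomial (Fin n) ℝ :=
  fun k l => C (gradAt p u k) * C (gradAt p u l)

theorem quadExpr_gradSq (u : Fin n → ℝ) (p : MvPolynomial (Fin n) ℝ) :
    quadExpr u (gradSq u p) = linearPart u p ^ 2 := by
  rw [pow_two]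
  exact quadExpr_mul u _ _

theorem quadVal_gradSq (u x : Fin n → ℝ) (p : MvPolynomial (Fin n) ℝ) (v : Fin n → ℝ) :
    quadVal x (gradSq u p) v = (gradAt p u ⬝ᵥ v) ^ 2 := by
  rw [pow_two]
  refine (quadVal_mul x _ _ v).trans ?_
  simp [dotProduct]

theorem linearPart_mem (u : Fin n → ℝ) (p : MvPolynomial (Fin n) ℝ) :
    linearPart u p ∈ pointIdeal u := by
  simp [mem_pointIdeal, linearPart]

theorem sub_linearPart_mem {u : Fin n → ℝ} {p : MvPolynomial (Fin n) ℝ} (hp : eval u p = 0) :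
    p - linearPart u p ∈ pointIdeal u ^ 2 := by
  obtain ⟨q, hpq, hq⟩ := exists_linear_expansion hp
  have : p - linearPart u p = ∑ k, (q k - C (gradAt p u k)) * centred u k := by
    simp only [sub_mul, Finset.sum_sub_distrib]
    rw [← hpq, linearPart]
  rw [this, pow_two]
  refine Ideal.sum_mem _ fun k _ => Ideal.mul_mem_mul ?_ ?_
  · simp [mem_pointIdeal, hq, gradAt]
  · simp [mem_pointIdeal]

theorem linearPart_mul_sub_sq_mem {u : Fin n → ℝ} {p : MvPolynomial (Fin n) ℝ}
    (hp : eval u p = 0) : linearPart u p * p - linearPart u p ^ 2 ∈ pointIdeal u ^ 3 := by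
  rw [show linearPart u p * p - linearPart u p ^ 2 = linearPart u p * (p - linearPart u p) by ring,
    pow_succ' _ 2]
  exact Ideal.mul_mem_mul (linearPart_mem u p) (sub_linearPart_mem hp)

theorem exists_multiplier_of_eq (N lam : ℝ) {u : Fin n → ℝ} {p : MvPolynomial (Fin n) ℝ}
    (hp : eval u p = 0) :
    ∃ φ, (C lam - φ) * p - C N * linearPart u p ^ 2 ∈ pointIdeal u ^ 3 := by
  refine ⟨C lam - C N * linearPart u p, ?_⟩
  convert Ideal.mul_mem_left _ (C N) (linearPart_mul_sub_sq_mem hp) using 1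
  ring

theorem exists_sq_multiplier_of_pos (N : ℝ) {mu : ℝ} (hmu : 0 < mu) {u : Fin n → ℝ}
    {p : MvPolynomial (Fin n) ℝ} (hp : eval u p = 0) :
    ∃ a, (C mu - a ^ 2) * p - C N * linearPart u p ^ 2 ∈ pointIdeal u ^ 3 := by
  set s := Real.sqrt mu
  have hs : 0 < s := Real.sqrt_pos.2 hmu
  set d := N / (2 * s) with hd
  refine ⟨C s - C d * linearPart u p, ?_⟩
  have e1 : (C mu : MvPolynomial (Fin n) ℝ) = C s ^ 2 := by
    rw [← map_pow, Real.sq_sqrt hmu.le]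
  have e2 : (C N : MvPolynomial (Fin n) ℝ) = 2 * C s * C d := by
    rw [show (2 : MvPolynomial (Fin n) ℝ) = C 2 from (map_ofNat C 2).symm, ← C_mul, ← C_mul, hd]
    congr 1
    field_simp
  have h1 := Ideal.mul_mem_left (pointIdeal u ^ 3) (C N) (linearPart_mul_sub_sq_mem hp)
  have h2 : linearPart u p ^ 2 * p ∈ pointIdeal u ^ 3 := by
    rw [pow_succ _ 2]
    exact Ideal.mul_mem_mul (Ideal.pow_mem_pow (linearPart_mem u p) 2) hp
  convert Ideal.sub_mem _ h1 (Ideal.mul_mem_left _ (C d ^ 2) h2) using 1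
  rw [e1, e2]
  ring

/-- At a point satisfying the KKT conditions, strict complementarity and the second order
sufficiency condition, `f - fmin` can be corrected by an element of `⟨h⟩ + Q(g)` so that it becomes
positive definite at that point. -/
theorem exists_posDefAt_sub {f : MvPolynomial (Fin n) ℝ} {h : Fin m1 → MvPolynomial (Fin n) ℝ}
    {g : Fin m2 → MvPolynomial (Fin n) ℝ} {u : Fin n → ℝ} {lam : Fin m1 → ℝ} {mu : Fin m2 → ℝ}
    (hh : ∀ i, eval u (h i) = 0)
    (hgrad : ∀ k : Fin n, eval u (pderiv k f)
      = (∑ i, lam i * eval u (pderiv k (h i))) + ∑ j, mu j * eval u (pderiv k (g j)))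
    (hcompl : ∀ j, mu j * eval u (g j) = 0) (hstrict : ∀ j, 0 < mu j + eval u (g j))
    (hsosc : SOSC f h g u lam mu) :
    ∃ (φ : Fin m1 → MvPolynomial (Fin n) ℝ) (p : Fin m2 → MvPolynomial (Fin n) ℝ),
      (∀ j, eval u (p j * g j) = 0) ∧
      PosDefAt u (f - C (eval u f) - ∑ i, φ i * h i - ∑ j, p j ^ 2 * g j) := by
  classical
  set L := f - C (eval u f) - ∑ i, C (lam i) * h i - ∑ j, C (mu j) * g j with hL
  have hL0 : eval u L = 0 := by simp [hL, hh, hcompl]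
  have hL1 : ∀ k, eval u (pderiv k L) = 0 := fun k => by
    simp [hL, hgrad]
  have hL2 : hessAt L u = hessAt (f - (∑ i, C (lam i) * h i) - ∑ j, C (mu j) * g j) u := by
    ext k l
    simp [hL, hessAt]
  obtain ⟨G, hLG, hG⟩ := exists_quadExpr_of_critical hL0 hL1
  set A : Finset (Fin m2) := Finset.univ.filter fun j => eval u (g j) = 0 with hA
  set R := ∑ i, gradSq u (h i) + ∑ j ∈ A, gradSq u (g j) with hR
  have hRval : ∀ v, quadVal u R v =
      ∑ i, (gradAt (h i) u ⬝ᵥ v) ^ 2 + ∑ j ∈ A, (gradAt (g j) u ⬝ᵥ v) ^ 2 := fun v => by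
    simp only [hR, quadVal_add, quadVal_sum, quadVal_gradSq]
  have hS1 : ∀ v, 0 ≤ ∑ i, (gradAt (h i) u ⬝ᵥ v) ^ 2 := fun v =>
    Finset.sum_nonneg fun _ _ => sq_nonneg _
  have hS2 : ∀ v, 0 ≤ ∑ j ∈ A, (gradAt (g j) u ⬝ᵥ v) ^ 2 := fun v =>
    Finset.sum_nonneg fun _ _ => sq_nonneg _
  obtain ⟨N, c, hc, hN⟩ := exists_add_mul_ge_sum_sq (continuous_quadVal u G)
    (continuous_quadVal u R) (quadVal_smul_right u G) (quadVal_smul_right u R)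
    (fun v => by rw [hRval]; exact add_nonneg (hS1 v) (hS2 v)) (fun v hv hRv => by
      rw [hRval] at hRv
      obtain ⟨h1, h2⟩ := (add_eq_zero_iff_of_nonneg (hS1 v) (hS2 v)).1 hRv
      rw [Finset.sum_eq_zero_iff_of_nonneg fun _ _ => sq_nonneg _] at h1 h2
      have := hsosc v hv (fun i => pow_eq_zero_iff two_ne_zero |>.1 (h1 i (Finset.mem_univ i)))
        (fun j hj => pow_eq_zero_iff two_ne_zero |>.1 (h2 j (by simp [hA, hj])))
      rw [← hL2, hG] at this
      linarith)
  choose φ hφ using fun i => exists_multiplier_of_eq N (lam i) (hh i)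
  have hp : ∀ j, ∃ a, eval u (a * g j) = 0 ∧ (C (mu j) - a ^ 2) * g j -
      C N * (if eval u (g j) = 0 then linearPart u (g j) ^ 2 else 0) ∈ pointIdeal u ^ 3 := by
    intro j
    by_cases hj : eval u (g j) = 0
    · obtain ⟨a, ha⟩ := exists_sq_multiplier_of_pos N (by simpa [hj] using hstrict j) hj
      exact ⟨a, by simp [hj], by simpa [hj] using ha⟩
    · have hmu : mu j = 0 := (mul_eq_zero.1 (hcompl j)).resolve_right hj
      exact ⟨0, by simp, by simp [hmu, hj]⟩
  choose p hp0 hp using hp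
  refine ⟨φ, p, hp0, ?_⟩
  have hpd : PosDefAt u (L + C N * quadExpr u R) := by
    refine ⟨c, hc, G + C N • R, by rw [quadExpr_add u G, quadExpr_smul, hLG], fun v => ?_⟩
    rw [quadVal_add, quadVal_smul_left, eval_C]
    exact hN v
  have hr := hpd.add_mem_cube (Ideal.add_mem _ (Ideal.sum_mem _ fun i (_ : i ∈ Finset.univ) => hφ i)
    (Ideal.sum_mem _ fun j (_ : j ∈ Finset.univ) => hp j))
  convert hr using 1
  have hRexpr : quadExpr u R = ∑ i, linearPart u (h i) ^ 2 +
      ∑ j, (if eval u (g j) = 0 then linearPart u (g j) ^ 2 else 0) := by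
    rw [hR, quadExpr_add, quadExpr_sum, quadExpr_sum, hA, Finset.sum_filter]
    simp only [quadExpr_gradSq]
  rw [hRexpr, hL]
  simp only [sub_mul, Finset.sum_sub_distrib, ← Finset.mul_sum]
  ring

end LocalCertificate

section GlobalCertificate

variable {n m1 m2 : ℕ}

theorem posDefAt_of_sub_mem_sq {f : MvPolynomial (Fin n) ℝ} {u : Fin n → ℝ}
    {h φ φ' : Fin m1 → MvPolynomial (Fin n) ℝ} {g p p' : Fin m2 → MvPolynomial (Fin n) ℝ}
    {w : MvPolynomial (Fin n) ℝ} (hh : ∀ i, eval u (h i) = 0) (hpg : ∀ j, eval u (p j * g j) = 0)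
    (hφ : ∀ i, φ' i - φ i ∈ pointIdeal u ^ 2) (hp : ∀ j, p' j - p j ∈ pointIdeal u ^ 2)
    (hw : 1 - w ∈ pointIdeal u ^ 2)
    (hF : PosDefAt u (f - ∑ i, φ i * h i - ∑ j, p j ^ 2 * g j)) :
    PosDefAt u (f - ∑ i, φ' i * h i - w * ∑ j, p' j ^ 2 * g j) := by
  have h1 : ∀ i, (φ' i - φ i) * h i ∈ pointIdeal u ^ 3 := fun i => by
    rw [pow_succ _ 2]; exact Ideal.mul_mem_mul (hφ i) (hh i)
  have h2 : ∀ j, p j ^ 2 * g j - w * (p' j ^ 2 * g j) ∈ pointIdeal u ^ 3 := fun j => by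
    have e1 : (1 - w) * (p j * g j) ∈ pointIdeal u ^ 3 := by
      rw [pow_succ _ 2]; exact Ideal.mul_mem_mul hw (hpg j)
    have e2 : (p' j - p j) * (p j * g j) ∈ pointIdeal u ^ 3 := by
      rw [pow_succ _ 2]; exact Ideal.mul_mem_mul (hp j) (hpg j)
    have e3 : (p' j - p j) * (p' j - p j) ∈ pointIdeal u ^ 3 :=
      Ideal.pow_le_pow_right (by norm_num : 3 ≤ 2 + 2)
        (by rw [pow_add]; exact Ideal.mul_mem_mul (hp j) (hp j))
    convert Ideal.sub_mem _ (Ideal.sub_mem _ (Ideal.mul_mem_left _ (p j) e1)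
      (Ideal.mul_mem_left _ (2 * w) e2)) (Ideal.mul_mem_left _ (w * g j) e3) using 1
    ring
  convert hF.add_mem_cube (Ideal.sub_mem _
    (Ideal.sum_mem _ fun j (_ : j ∈ Finset.univ) => h2 j)
    (Ideal.sum_mem _ fun i (_ : i ∈ Finset.univ) => h1 i)) using 1
  simp only [sub_mul, Finset.sum_sub_distrib, ← Finset.mul_sum]
  ring

theorem exists_forall_sub_mem_pointIdeal_sq (U : Finset (Fin n → ℝ))
    (a : ∀ u ∈ U, MvPolynomial (Fin n) ℝ) :
    ∃ q, ∀ u (hu : u ∈ U), q - a u hu ∈ pointIdeal u ^ 2 := by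
  obtain ⟨q, hq⟩ := Ideal.exists_forall_sub_mem_ideal (I := fun u : U => pointIdeal u.1 ^ 2)
    (fun u v huv => (isCoprime_pointIdeal (Subtype.coe_ne_coe.2 huv)).pow)
    (fun u => a u.1 u.2)
  exact ⟨q, fun u hu => hq ⟨u, hu⟩⟩

/-- Damping a nonnegative term by a high power of `1 - θ` makes it smaller than a given function
away from finitely many points. -/
theorem exists_pow_mul_lt {X : Type*} [TopologicalSpace X] {K : Set X} (hK : IsCompact K)
    (U : Finset X) {A S θ : X → ℝ} (hA : Continuous A) (hS : Continuous S) (hθ : Continuous θ)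
    (hS0 : ∀ x ∈ K, 0 ≤ S x) (hθ0 : ∀ x ∈ K, 0 ≤ θ x) (hθ1 : ∀ x ∈ K, θ x ≤ 1)
    (hAU : ∀ x ∈ K, x ∉ U → 0 < A x) (hθU : ∀ x ∈ K, x ∉ U → 0 < θ x)
    (hloc : ∀ u ∈ U, ∀ᶠ x in nhds u, x ≠ u → 0 < A x - S x) :
    ∃ N : ℕ, ∀ x ∈ K, x ∉ U → ((1 - θ x) ^ N) ^ 2 * S x < A x := by
  set O : Set X := ⋃ u ∈ U, interior {x | x ≠ u → 0 < A x - S x} with hO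
  have hOopen : IsOpen O := isOpen_biUnion fun u _ => isOpen_interior
  have hUO : ∀ u ∈ U, u ∈ O := fun u hu =>
    Set.mem_biUnion (show u ∈ (U : Set X) from hu) (mem_interior_iff_mem_nhds.2 (hloc u hu))
  have hK' : IsCompact (K \ O) := hK.diff hOopen
  have hKU : ∀ x ∈ K \ O, x ∉ U := fun x hx hu => hx.2 (hUO x hu)
  obtain ⟨δ, hδ, hδA⟩ := hK'.exists_forall_le' hA.continuousOn (a := 0)
    fun x hx => hAU x hx.1 (hKU x hx)
  obtain ⟨τ, hτ, hτθ⟩ := hK'.exists_forall_le' hθ.continuousOn (a := 0)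
    fun x hx => hθU x hx.1 (hKU x hx)
  obtain ⟨B, hB⟩ := hK'.exists_bound_of_continuousOn hS.continuousOn
  obtain ⟨N, hN⟩ := exists_pow_lt_of_lt_one (show 0 < δ / (|B| + 1) by positivity)
    (show max (1 - τ) 0 < 1 from max_lt (by linarith) one_pos)
  refine ⟨N, fun x hxK hxU => ?_⟩
  have h0 : 0 ≤ (1 - θ x) ^ N := pow_nonneg (by linarith [hθ1 x hxK]) N
  have h1 : (1 - θ x) ^ N ≤ 1 :=
    pow_le_one₀ (by linarith [hθ1 x hxK]) (by linarith [hθ0 x hxK])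
  by_cases hxO : x ∈ O
  · obtain ⟨u, hu, hxu⟩ := Set.mem_iUnion₂.1 hxO
    have hpos := interior_subset hxu (fun h => hxU (h ▸ hu))
    have := mul_le_mul_of_nonneg_right (pow_le_one₀ (n := 2) h0 h1) (hS0 x hxK)
    linarith
  · have hx : x ∈ K \ O := ⟨hxK, hxO⟩
    have h2 : (1 - θ x) ^ N ≤ max (1 - τ) 0 ^ N :=
      pow_le_pow_left₀ (by linarith [hθ1 x hxK])
        (le_max_of_le_left (by linarith [hτθ x hx])) N
    have h3 : S x ≤ |B| := (le_abs_self _).trans ((hB x hx).trans (le_abs_self _))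
    have h4 : ((1 - θ x) ^ N) ^ 2 ≤ δ / (|B| + 1) := by nlinarith
    calc ((1 - θ x) ^ N) ^ 2 * S x ≤ δ / (|B| + 1) * |B| :=
          mul_le_mul h4 h3 (hS0 x hxK) (by positivity)
      _ < δ / (|B| + 1) * (|B| + 1) := by gcongr; linarith
      _ = δ := by field_simp
      _ ≤ A x := hδA x hx

variable {h : Fin m1 → MvPolynomial (Fin n) ℝ} {g : Fin m2 → MvPolynomial (Fin n) ℝ}

theorem ArchimedeanCond.isCompact (harch : ArchimedeanCond h g) :
    IsCompact {x | (∀ i, eval x (h i) = 0) ∧ (∀ j, 0 ≤ eval x (g j))} := by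
  obtain ⟨R, hR, hmem⟩ := harch
  refine (isCompact_closedBall (0 : Fin n → ℝ) (Real.sqrt R)).of_isClosed_subset ?_ ?_
  · simp only [Set.ofPred_and, Set.ofPred_forall]
    exact (isClosed_iInter fun i => isClosed_eq (MvPolynomial.continuous_eval _) continuous_const).inter
      (isClosed_iInter fun j => isClosed_le continuous_const (MvPolynomial.continuous_eval _))
  · rintro x ⟨hxh, hxg⟩
    have hx := eval_nonneg_of_mem_idealPlusQM hmem hxh hxg
    simp only [map_sub, eval_C, map_sum, map_pow, eval_X, sub_nonneg] at hx
    rw [mem_closedBall_zero_iff, pi_norm_le_iff_of_nonneg (Real.sqrt_nonneg R)]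
    intro k
    rw [Real.norm_eq_abs]
    refine Real.abs_le_sqrt (le_trans ?_ hx)
    exact Finset.single_le_sum (f := fun k => x k ^ 2) (fun _ _ => sq_nonneg _) (Finset.mem_univ k)

/-- If near every zero of `f` on the feasible set, `f` can be corrected by an element of
`⟨h⟩ + Q(g)` to become positive definite, then `f` has finitely many zeros there. -/
theorem finite_zeros_of_local_certificates (harch : ArchimedeanCond h g)
    {f : MvPolynomial (Fin n) ℝ}
    (hloc : ∀ u, (∀ i, eval u (h i) = 0) → (∀ j, 0 ≤ eval u (g j)) → eval u f = 0 →
      ∃ (φ : Fin m1 → MvPolynomial (Fin n) ℝ) (p : Fin m2 → MvPolynomial (Fin n) ℝ),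
        (∀ j, eval u (p j * g j) = 0) ∧
        PosDefAt u (f - ∑ i, φ i * h i - ∑ j, p j ^ 2 * g j)) :
    {x | ((∀ i, eval x (h i) = 0) ∧ (∀ j, 0 ≤ eval x (g j))) ∧ eval x f = 0}.Finite := by
  have hcpt : IsCompact
      {x | ((∀ i, eval x (h i) = 0) ∧ (∀ j, 0 ≤ eval x (g j))) ∧ eval x f = 0} :=
    harch.isCompact.inter_right (isClosed_eq (MvPolynomial.continuous_eval f) continuous_const)
  by_contra hinf
  obtain ⟨u, ⟨⟨huh, hug⟩, huf⟩, hacc⟩ :=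
    Set.Infinite.exists_accPt_of_subset_isCompact hinf hcpt subset_rfl
  obtain ⟨φ, p, -, hF⟩ := hloc u huh hug huf
  rw [accPt_iff_frequently] at hacc
  obtain ⟨y, ⟨hyu, ⟨hyh, hyg⟩, hyf⟩, hy⟩ := (hacc.and_eventually hF.eventually_pos).exists
  have h1 := hy hyu
  simp only [map_sub, map_sum, map_mul, map_pow, hyf, hyh, mul_zero, Finset.sum_const_zero] at h1
  have h2 : 0 ≤ ∑ j, eval y (p j) ^ 2 * eval y (g j) :=
    Finset.sum_nonneg fun j _ => mul_nonneg (sq_nonneg _) (hyg j)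
  linarith

open idealPlusQM

/-- A nonnegative polynomial on the feasible set with local certificates at all of its zeros belongs
to an archimedean `⟨h⟩ + Q(g)`. -/
theorem mem_idealPlusQM_of_local_certificates (harch : ArchimedeanCond h g)
    {f : MvPolynomial (Fin n) ℝ}
    (hf : ∀ x, (∀ i, eval x (h i) = 0) → (∀ j, 0 ≤ eval x (g j)) → 0 ≤ eval x f)
    (hloc : ∀ u, (∀ i, eval u (h i) = 0) → (∀ j, 0 ≤ eval u (g j)) → eval u f = 0 →
      ∃ (φ : Fin m1 → MvPolynomial (Fin n) ℝ) (p : Fin m2 → MvPolynomial (Fin n) ℝ),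
        (∀ j, eval u (p j * g j) = 0) ∧
        PosDefAt u (f - ∑ i, φ i * h i - ∑ j, p j ^ 2 * g j)) :
    f ∈ idealPlusQM h g := by
  classical
  have hfin := finite_zeros_of_local_certificates harch hloc
  set U := hfin.toFinset with hU
  have hmemU : ∀ {x}, x ∈ U ↔
      ((∀ i, eval x (h i) = 0) ∧ (∀ j, 0 ≤ eval x (g j))) ∧ eval x f = 0 := by
    intro x
    rw [hU, Set.Finite.mem_toFinset, Set.mem_ofPred_eq]
  have hlocU := fun u (hu : u ∈ U) =>
    hloc u (hmemU.1 hu).1.1 (hmemU.1 hu).1.2 (hmemU.1 hu).2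
  choose φl pl hpg hpd using hlocU
  choose φ hφ using fun i => exists_forall_sub_mem_pointIdeal_sq U fun u hu => φl u hu i
  choose p hp using fun j => exists_forall_sub_mem_pointIdeal_sq U fun u hu => pl u hu j
  set S := ∑ j, p j ^ 2 * g j with hS
  have hglue : ∀ w : MvPolynomial (Fin n) ℝ, ∀ u ∈ U, 1 - w ∈ pointIdeal u ^ 2 →
      PosDefAt u (f - ∑ i, φ i * h i - w * S) := fun w u hu hw =>
    posDefAt_of_sub_mem_sq (hmemU.1 hu).1.1 (hpg u hu) (fun i => hφ i u hu)
      (fun j => hp j u hu) hw (hpd u hu)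
  set Θ : MvPolynomial (Fin n) ℝ := ∏ u ∈ U, ∑ k, centred u k ^ 2 with hΘ
  have hΘmem : ∀ u ∈ U, Θ ∈ pointIdeal u ^ 2 := fun u hu => by
    rw [hΘ, ← Finset.mul_prod_erase U _ hu]
    exact Ideal.mul_mem_right _ _ (Ideal.sum_mem _ fun k _ =>
      Ideal.pow_mem_pow (by simp [mem_pointIdeal]) 2)
  have hΘeval : ∀ x, eval x Θ = ∏ u ∈ U, ∑ k, (x - u) k ^ 2 := fun x => by simp [hΘ]
  have hΘ0 : ∀ x, 0 ≤ eval x Θ := fun x => by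
    rw [hΘeval]
    exact Finset.prod_nonneg fun u _ => Finset.sum_nonneg fun k _ => sq_nonneg _
  have hΘpos : ∀ x, x ∉ U → 0 < eval x Θ := fun x hx => by
    rw [hΘeval]
    exact Finset.prod_pos fun u hu => sum_sq_pos (sub_ne_zero.2 fun h => hx (h ▸ hu))
  have hcpt := harch.isCompact
  obtain ⟨B, hB⟩ := hcpt.exists_bound_of_continuousOn (MvPolynomial.continuous_eval Θ).continuousOn
  set t : MvPolynomial (Fin n) ℝ := C (|B| + 1)⁻¹ * Θ with ht
  have htmem : ∀ u ∈ U, t ∈ pointIdeal u ^ 2 := fun u hu => Ideal.mul_mem_left _ _ (hΘmem u hu)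
  have hteval : ∀ x, eval x t = (|B| + 1)⁻¹ * eval x Θ := fun x => by simp [ht]
  have hcorr : ∀ x, (∀ i, eval x (h i) = 0) → ∀ w : MvPolynomial (Fin n) ℝ,
      eval x (f - ∑ i, φ i * h i - w * S) = eval x f - eval x w * eval x S := fun x hx w => by
    simp [hx]
  have hS0 : ∀ x, (∀ j, 0 ≤ eval x (g j)) → 0 ≤ eval x S := fun x hx => by
    rw [hS, map_sum]
    exact Finset.sum_nonneg fun j _ => by
      rw [map_mul, map_pow]
      exact mul_nonneg (sq_nonneg _) (hx j)
  obtain ⟨N, hN⟩ := exists_pow_mul_lt hcpt U (A := fun x => eval x (f - ∑ i, φ i * h i))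
    (S := fun x => eval x S) (θ := fun x => eval x t) (MvPolynomial.continuous_eval _)
    (MvPolynomial.continuous_eval _) (MvPolynomial.continuous_eval _) (fun x hx => hS0 x hx.2)
    (fun x _ => by rw [hteval]; exact mul_nonneg (by positivity) (hΘ0 x))
    (fun x hx => by
      rw [hteval, inv_mul_le_one₀ (by positivity)]
      linarith [le_abs_self (eval x Θ), le_abs_self B, hB x hx, Real.norm_eq_abs (eval x Θ)])
    (fun x hx hxU => by
      have hne : eval x f ≠ 0 := fun h0 => hxU (hmemU.2 ⟨hx, h0⟩)
      have := (hf x hx.1 hx.2).lt_of_ne' hne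
      simpa [hx.1] using this)
    (fun x _ hxU => by rw [hteval]; exact mul_pos (by positivity) (hΘpos x hxU))
    (fun u hu => by
      filter_upwards [(hglue 1 u hu (by simp)).eventually_pos] with x hx hxu
      simpa using hx hxu)
  set e : MvPolynomial (Fin n) ℝ := (1 - t) ^ N with he
  have hmem : f - ∑ i, φ i * h i - e ^ 2 * S ∈ idealPlusQM h g := by
    refine mem_idealPlusQM_of_posDefAt harch U (fun x hxh hxg hxU => ?_) fun u hu =>
      hglue _ u hu ?_
    · have := hN x ⟨hxh, hxg⟩ hxU
      rw [map_sub, map_mul, sub_pos]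
      simpa [he] using this
    · have hdvd : t ∣ 1 - e ^ 2 := by
        have := sub_dvd_pow_sub_pow 1 (1 - t) (N * 2)
        rwa [sub_sub_cancel, one_pow, pow_mul] at this
      exact Ideal.mem_of_dvd _ hdvd (htmem u hu)
  have hspan : ∑ i, φ i * h i ∈ idealPlusQM h g := of_mem_span
    (Ideal.sum_mem _ fun i _ => Ideal.mul_mem_left _ _ (Ideal.subset_span ⟨i, rfl⟩))
  have hSmem : e ^ 2 * S ∈ idealPlusQM h g := sq_mul_mem (sum_mem _ fun j _ =>
    sq_mul_mem (of_mem_QM (QM.generator_mem j)) (p j)) e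
  convert add_mem (add_mem hmem hspan) hSmem using 1
  ring

end GlobalCertificate

/-- **Theorem 1.1** (finite convergence of Lasserre's hierarchy).
Under the archimedean condition, if the constraint qualification, strict
complementarity and second order sufficiency conditions hold at every global
minimizer, then Lasserre's hierarchy has finite convergence: there is `k₀` with
`f − f_min + ε ∈ ⟨h⟩_{2k₀} + Q_{k₀}(g)` for every `ε > 0`. -/
theorem lasserre_finite_convergence {n m1 m2 : ℕ}
    (f : MvPolynomial (Fin n) ℝ)
    (h : Fin m1 → MvPolynomial (Fin n) ℝ) (g : Fin m2 → MvPolynomial (Fin n) ℝ)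
    (K : Set (Fin n → ℝ))
    (hK : K = {x | (∀ i, eval x (h i) = 0) ∧ (∀ j, 0 ≤ eval x (g j))})
    (harch : ArchimedeanCond h g)
    (fmin : ℝ)
    (hlb : ∀ x ∈ K, fmin ≤ eval x f)
    (hatt : ∃ u ∈ K, eval u f = fmin)
    (hopt : ∀ u ∈ K, eval u f = fmin →
      CQC h g u ∧
      ∃ (lam : Fin m1 → ℝ) (mu : Fin m2 → ℝ),
        (∀ k : Fin n, eval u (pderiv k f)
            = (∑ i, lam i * eval u (pderiv k (h i)))
              + ∑ j, mu j * eval u (pderiv k (g j))) ∧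
        (∀ j, mu j * eval u (g j) = 0) ∧ (∀ j, 0 ≤ mu j) ∧
        (∀ j, 0 < mu j + eval u (g j)) ∧
        SOSC f h g u lam mu) :
    ∃ k0 : ℕ, ∀ ε : ℝ, 0 < ε →
      ∃ a ∈ truncIdeal h k0, ∃ b ∈ truncQM g k0, f - C fmin + C ε = a + b := by
  subst hK
  refine exists_trunc_decomposition (mem_idealPlusQM_of_local_certificates harch
    (fun x hxh hxg => by simpa using hlb x ⟨hxh, hxg⟩) fun u huh hug hu => ?_)
  have hfu : eval u f = fmin := by simpa [sub_eq_zero] using hu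
  obtain ⟨-, lam, mu, hgrad, hcompl, -, hstrict, hsosc⟩ := hopt u ⟨huh, hug⟩ hfu
  have := exists_posDefAt_sub huh hgrad hcompl hstrict hsosc
  rwa [hfu] at this
end
end

section
/- Fix n, m1 ≤ n, m2, and positive integers d_0, d_1,…,d_{m1}, d_1′,…,d_{m2}′. There exists a real polynomial Φ in the coefficients of tuples (f, h_1,…,h_{m1}, g_1,…,g_{m2}) with f ∈ ℝ[x]_{d_0}, h_i ∈ ℝ[x]_{d_i}, g_j ∈ ℝ[x]_{d_j′}, where Φ is not the identically zero polynomial, such that for every such tuple with Φ(f, h, g) ≠ 0 the following holds: at every local minimizer u of f over K = {x ∈ ℝⁿ : h_i(x) = 0 (i ≤ m1), g_j(x) ≥ 0 (j ≤ m2)}, the constraint qualification condition holds, and the resulting Lagrange multipliers satisfy the strict complementarity condition and the second order sufficiency condition. -/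
open MvPolynomial Matrix
open scoped Matrix

noncomputable section

/-- Evaluation of a polynomial `Φ` in the coefficients of the tuple `(f, h, g)`. -/
def evalCoeffs {n m1 m2 : ℕ}
    (Φ : MvPolynomial ((Unit ⊕ Fin m1 ⊕ Fin m2) × (Fin n →₀ ℕ)) ℝ)
    (f : MvPolynomial (Fin n) ℝ)
    (h : Fin m1 → MvPolynomial (Fin n) ℝ) (g : Fin m2 → MvPolynomial (Fin n) ℝ) : ℝ :=
  eval (fun v => coeff v.2 (Sum.elim (fun _ : Unit => f) (Sum.elim h g) v.1)) Φ

/-! ### Sets of tuples of polynomials contained in a hypersurface -/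

section Thin

variable {ι : Type} {n : ℕ}

/-- The positions of the coefficients of tuples of polynomials of degrees at most `D`. -/
abbrev CoeffIndex (n : ℕ) (D : ι → ℕ) : Type := {p : ι × (Fin n →₀ ℕ) // p.2.degree ≤ D p.1}

instance finite_coeffIndex [Finite ι] (D : ι → ℕ) : Finite (CoeffIndex n D) := by
  have hfin : ∀ a, Finite {m : Fin n →₀ ℕ // m.degree ≤ D a} := fun a =>
    (Finsupp.finite_of_degree_le (D a)).to_subtype
  let F : CoeffIndex n D → Σ a, {m : Fin n →₀ ℕ // m.degree ≤ D a} :=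
    fun p => ⟨p.1.1, p.1.2, p.2⟩
  refine Finite.of_injective F ?_
  rintro ⟨⟨a, m⟩, h⟩ ⟨⟨a', m'⟩, h'⟩ heq
  simp only [F, Sigma.mk.injEq] at heq
  obtain ⟨rfl, h2⟩ := heq
  simpa using h2

/-- A set of tuples of polynomials is thin with respect to degree bounds `D` if some nonzero
polynomial in the coefficients vanishes on all its members satisfying the degree bounds. -/
def Thin (D : ι → ℕ) (B : Set (ι → MvPolynomial (Fin n) ℝ)) : Prop :=
  ∃ Φ : MvPolynomial (CoeffIndex n D) ℝ, Φ ≠ 0 ∧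
    ∀ q ∈ B, (∀ a, (q a).totalDegree ≤ D a) → eval (fun s => coeff s.1.2 (q s.1.1)) Φ = 0

theorem Thin.mono {D : ι → ℕ} {B B' : Set (ι → MvPolynomial (Fin n) ℝ)} (h : Thin D B)
    (hB : B' ⊆ B) : Thin D B' := by
  obtain ⟨Φ, h0, hΦ⟩ := h
  exact ⟨Φ, h0, fun q hq => hΦ q (hB hq)⟩

theorem Thin.iUnion {D : ι → ℕ} {κ : Type*} [Finite κ]
    {B : κ → Set (ι → MvPolynomial (Fin n) ℝ)} (h : ∀ k, Thin D (B k)) :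
    Thin D (⋃ k, B k) := by
  have := Fintype.ofFinite κ
  choose Φ h0 hΦ using h
  refine ⟨∏ k, Φ k, Finset.prod_ne_zero_iff.2 fun k _ => h0 k, fun q hq hdeg => ?_⟩
  obtain ⟨k, hk⟩ := Set.mem_iUnion.1 hq
  rw [map_prod]
  exact Finset.prod_eq_zero (Finset.mem_univ k) (hΦ k q hk hdeg)

theorem Thin.empty (D : ι → ℕ) : Thin D (∅ : Set (ι → MvPolynomial (Fin n) ℝ)) :=
  ⟨1, one_ne_zero, fun _ h => h.elim⟩

/-- A thin set avoids some tuple, detected by a polynomial in all coefficients. -/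
theorem Thin.exists_polynomial {D : ι → ℕ} {B : Set (ι → MvPolynomial (Fin n) ℝ)}
    [Finite ι] (h : Thin D B) :
    ∃ Φ : MvPolynomial (ι × (Fin n →₀ ℕ)) ℝ,
      (∃ q : ι → MvPolynomial (Fin n) ℝ, (∀ a, (q a).totalDegree ≤ D a) ∧
        eval (fun s => coeff s.2 (q s.1)) Φ ≠ 0) ∧
      ∀ q ∈ B, (∀ a, (q a).totalDegree ≤ D a) → eval (fun s => coeff s.2 (q s.1)) Φ = 0 := by
  classical
  obtain ⟨Φ, h0, hΦ⟩ := h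
  refine ⟨rename Subtype.val Φ, ?_, fun q hq hdeg => ?_⟩
  · obtain ⟨y, hy⟩ : ∃ y, eval y Φ ≠ 0 := by
      by_contra! H
      exact h0 (MvPolynomial.funext fun y => by simpa using H y)
    have hfin : ∀ a, {m : Fin n →₀ ℕ | m.degree ≤ D a}.Finite := fun a =>
      Finsupp.finite_of_degree_le (D a)
    let q : ι → MvPolynomial (Fin n) ℝ := fun a => ∑ m ∈ (hfin a).toFinset,
      monomial m (if h : m.degree ≤ D a then y ⟨(a, m), h⟩ else 0)
    refine ⟨q, fun a => ?_, ?_⟩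
    · refine totalDegree_finsetSum_le fun m hm => (totalDegree_monomial_le _ _).trans ?_
      simp only [Set.Finite.mem_toFinset, Set.mem_ofPred_eq] at hm
      exact hm
    · rw [eval_rename]
      convert hy using 3
      funext s
      obtain ⟨⟨a, m⟩, hs⟩ := s
      simp only [q, Function.comp, coeff_sum, coeff_monomial]
      rw [Finset.sum_eq_single m]
      · simp only [if_true]
        exact dif_pos hs
      · intro b _ hb
        simp [hb]
      · intro hm
        simp only [Set.Finite.mem_toFinset, Set.mem_ofPred_eq] at hm
        exact absurd hs hm
  · rw [eval_rename]
    exact hΦ q hq hdeg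

/-- If more functions than generators lie in a finitely generated algebra of real functions, they
satisfy a nontrivial polynomial relation. -/
theorem exists_relation_of_mem_adjoin {X σ τ : Type} [Fintype σ] [Fintype τ]
    (t : τ → X → ℝ) (y : σ → X → ℝ) (hcard : Fintype.card τ < Fintype.card σ)
    (hy : ∀ s, y s ∈ Algebra.adjoin ℝ (Set.range t)) :
    ∃ Φ : MvPolynomial σ ℝ, Φ ≠ 0 ∧ ∀ x, eval (fun s => y s x) Φ = 0 := by
  have hP : ∀ s, ∃ P : MvPolynomial τ ℝ, aeval t P = y s := fun s => by
    have := hy s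
    rwa [Algebra.adjoin_range_eq_range_aeval] at this
  choose P hP using hP
  have hdep : ¬ AlgebraicIndependent ℝ P := fun hind => by
    have := hind.cardinalMk_le_trdeg
    rw [MvPolynomial.trdeg_of_isDomain] at this
    simp only [Cardinal.mk_fintype, Cardinal.lift_natCast, Nat.cast_le] at this
    omega
  rw [algebraicIndependent_iff] at hdep
  push Not at hdep
  obtain ⟨Φ, hΦ, h0⟩ := hdep
  refine ⟨Φ, h0, fun x => ?_⟩
  have hx : ∀ s, y s x = eval (fun i => t i x) (P s) := fun s => by
    rw [← hP s]
    have : (Pi.evalAlgHom ℝ (fun _ : X => ℝ) x).comp (aeval t)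
        = aeval (fun i => t i x) := by
      ext i; simp
    have h2 := DFunLike.congr_fun this (P s)
    simpa [coe_aeval_eq_eval] using h2
  have : eval (fun i => t i x) (aeval P Φ) = 0 := by rw [hΦ, map_zero]
  have h3 : (aeval (fun i => t i x)).comp (aeval P)
      = (aeval (fun s => y s x) : MvPolynomial σ ℝ →ₐ[ℝ] ℝ) := by
    ext s; simp [hx]
  have h4 := DFunLike.congr_fun h3 Φ
  simp only [AlgHom.comp_apply] at h4
  rw [hΦ, map_zero] at h4
  exact h4.symm

/-- The Taylor shift `p (x + u)` of the polynomial `p`. -/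
def taylorShift (u : Fin n → ℝ) : MvPolynomial (Fin n) ℝ →ₐ[ℝ] MvPolynomial (Fin n) ℝ :=
  aeval fun i => X i + C (u i)

theorem taylorShift_neg_taylorShift (u : Fin n → ℝ) (p : MvPolynomial (Fin n) ℝ) :
    taylorShift (-u) (taylorShift u p) = p := by
  have : (taylorShift (-u)).comp (taylorShift u) = AlgHom.id ℝ (MvPolynomial (Fin n) ℝ) := by
    ext i : 1
    simp [taylorShift, algHom_C]
  exact DFunLike.congr_fun this p

theorem eval_zero_taylorShift (u : Fin n → ℝ) (p : MvPolynomial (Fin n) ℝ) :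
    eval 0 (taylorShift u p) = eval u p := by
  have : (aeval (0 : Fin n → ℝ)).comp (taylorShift u)
      = (aeval u : MvPolynomial (Fin n) ℝ →ₐ[ℝ] ℝ) := by
    ext i : 1
    simp [taylorShift]
  simpa [coe_aeval_eq_eval] using DFunLike.congr_fun this p

theorem pderiv_taylorShift (u : Fin n → ℝ) (i : Fin n) (p : MvPolynomial (Fin n) ℝ) :
    pderiv i (taylorShift u p) = taylorShift u (pderiv i p) := by
  induction p using MvPolynomial.induction_on with
  | C a => simp [taylorShift, algHom_C]
  | add p q hp hq => simp only [map_add, hp, hq]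
  | mul_X p j hp =>
    have hX : pderiv i (taylorShift u (X j)) = taylorShift u (pderiv i (X j)) := by
      rcases eq_or_ne j i with rfl | hji
      · simp [taylorShift]
      · simp [taylorShift, pderiv_X_of_ne hji]
    simp only [map_mul, Derivation.leibniz, hp, hX, smul_eq_mul, map_add]

theorem totalDegree_taylorShift_le (u : Fin n → ℝ) (p : MvPolynomial (Fin n) ℝ) :
    (taylorShift u p).totalDegree ≤ p.totalDegree := by
  rw [taylorShift, aeval_def, eval₂_eq]
  refine totalDegree_finsetSum_le fun m hm => ?_
  rw [algebraMap_eq]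
  refine (totalDegree_mul _ _).trans ?_
  rw [totalDegree_C, zero_add]
  refine (totalDegree_finsetProd _ _).trans ?_
  refine le_trans ?_ (le_totalDegree hm)
  rw [Finsupp.sum]
  refine Finset.sum_le_sum fun i _ => (totalDegree_pow _ _).trans ?_
  have : (X i + C (u i) : MvPolynomial (Fin n) ℝ).totalDegree ≤ 1 :=
    (totalDegree_add _ _).trans (by simp)
  nlinarith

/-- Families of polynomials all of whose coefficient functions lie in a given algebra. -/
def coeffSubalgebra {X : Type} (n : ℕ) (S : Subalgebra ℝ (X → ℝ)) :
    Subalgebra ℝ (X → MvPolynomial (Fin n) ℝ) where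
  carrier := {p | ∀ m, (fun x => coeff m (p x)) ∈ S}
  mul_mem' := by
    classical
    intro p q hp hq m
    have : (fun x => coeff m ((p * q) x))
        = ∑ a ∈ Finset.HasAntidiagonal.antidiagonal m,
            (fun x => coeff a.1 (p x)) * (fun x => coeff a.2 (q x)) := by
      ext x; simp [coeff_mul]
    rw [this]
    exact S.sum_mem fun a _ => S.mul_mem (hp _) (hq _)
  add_mem' := by
    intro p q hp hq m
    have : (fun x => coeff m ((p + q) x))
        = (fun x => coeff m (p x)) + (fun x => coeff m (q x)) := by
      ext x; simp
    rw [this]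
    exact S.add_mem (hp _) (hq _)
  algebraMap_mem' := by
    classical
    intro r m
    have : (fun x : X => coeff m ((algebraMap ℝ (X → MvPolynomial (Fin n) ℝ) r) x))
        = algebraMap ℝ (X → ℝ) (if 0 = m then r else 0) := by
      ext x; simp [algebraMap_eq, coeff_C]
    rw [this]
    exact S.algebraMap_mem _

theorem C_mem_coeffSubalgebra {X : Type} {S : Subalgebra ℝ (X → ℝ)} {c : X → ℝ} (hc : c ∈ S) :
    (fun x => C (c x)) ∈ coeffSubalgebra n S := by
  classical
  intro m
  by_cases h : 0 = m
  · simpa [coeff_C, h] using hc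
  · simp only [coeff_C, h, if_false]
    exact S.zero_mem

theorem const_mem_coeffSubalgebra {X : Type} {S : Subalgebra ℝ (X → ℝ)}
    (p : MvPolynomial (Fin n) ℝ) : (fun _ => p) ∈ coeffSubalgebra n S := fun m =>
  S.algebraMap_mem (coeff m p)

theorem taylorShift_mem_coeffSubalgebra {X : Type} {S : Subalgebra ℝ (X → ℝ)}
    {u : X → Fin n → ℝ} (hu : ∀ i, (fun x => u x i) ∈ S) {p : X → MvPolynomial (Fin n) ℝ}
    {d : ℕ} (hd : ∀ x, (p x).totalDegree ≤ d) (hp : p ∈ coeffSubalgebra n S) :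
    (fun x => taylorShift (u x) (p x)) ∈ coeffSubalgebra n S := by
  have hfin : {m : Fin n →₀ ℕ | m.degree ≤ d}.Finite := Finsupp.finite_of_degree_le d
  have key : (fun x => taylorShift (u x) (p x)) = ∑ m ∈ hfin.toFinset,
      (fun x => C (coeff m (p x))) *
        ∏ i, (((fun _ => MvPolynomial.X i) + (fun x => C (u x i))) ^ m i :
          X → MvPolynomial (Fin n) ℝ) := by
    ext x : 1
    rw [taylorShift, aeval_def, eval₂_eq']
    simp only [Finset.sum_apply, Pi.mul_apply, Finset.prod_apply, Pi.pow_apply, Pi.add_apply,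
      algebraMap_eq]
    refine Finset.sum_subset (fun m hm => ?_) (fun m _ hm => ?_)
    · have h := (le_totalDegree hm).trans (hd x)
      rw [hfin.mem_toFinset]
      exact h
    · rw [notMem_support_iff.1 hm, C_0, zero_mul]
  rw [key]
  refine Subalgebra.sum_mem _ fun m _ => Subalgebra.mul_mem _ (C_mem_coeffSubalgebra (hp m)) ?_
  exact Subalgebra.prod_mem _ fun i _ => Subalgebra.pow_mem _
    (Subalgebra.add_mem _ (const_mem_coeffSubalgebra _) (C_mem_coeffSubalgebra (hu i))) _

/-- Dimension count: let `X` be a type of configurations, each giving a tuple `q x` and a base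
point `u x`. Suppose that the coefficients of the tuple taylorShiftd to the base point, at the
positions `e s`, depend polynomially on the other coefficients and on the parameters `t`, and
that there are fewer parameters than positions. Then the tuples `q x` form a thin set. -/
theorem thin_of_card_lt [Finite ι] {D : ι → ℕ} {X τ ε : Type} [Fintype τ] [Fintype ε]
    (q : X → ι → MvPolynomial (Fin n) ℝ) (hq : ∀ x a, (q x a).totalDegree ≤ D a)
    (u : X → Fin n → ℝ) (t : τ → X → ℝ)
    (e : ε → ι × (Fin n →₀ ℕ)) (he : Function.Injective e)
    (heD : ∀ s, (e s).2.degree ≤ D (e s).1) (hcard : Fintype.card τ < Fintype.card ε)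
    {B : Set (ι → MvPolynomial (Fin n) ℝ)}
    (hB : ∀ p ∈ B, (∀ a, (p a).totalDegree ≤ D a) → ∃ x, q x = p)
    (H : ∀ S : Subalgebra ℝ (X → ℝ), (∀ i, t i ∈ S) →
      (∀ a m, (a, m) ∉ Set.range e → (fun x => coeff m (taylorShift (u x) (q x a))) ∈ S) →
      (∀ i, (fun x => u x i) ∈ S) ∧
        ∀ s, (fun x => coeff (e s).2 (taylorShift (u x) (q x (e s).1))) ∈ S) :
    Thin D B := by
  classical
  have := Fintype.ofFinite (CoeffIndex n D)
  let E : ε → CoeffIndex n D := fun s => ⟨e s, heD s⟩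
  have hE : Function.Injective E := fun s s' h => he (congrArg Subtype.val h)
  let y : CoeffIndex n D → X → ℝ := fun s x => coeff s.1.2 (taylorShift (u x) (q x s.1.1))
  let gen : τ ⊕ {s : CoeffIndex n D // s ∉ Set.range E} → X → ℝ :=
    Sum.elim t fun s => y s.1
  let S := Algebra.adjoin ℝ (Set.range gen)
  have ht : ∀ i, t i ∈ S := fun i => Algebra.subset_adjoin ⟨Sum.inl i, rfl⟩
  have hfree : ∀ a m, (a, m) ∉ Set.range e →
      (fun x => coeff m (taylorShift (u x) (q x a))) ∈ S := by
    intro a m ham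
    by_cases hm : m.degree ≤ D a
    · refine Algebra.subset_adjoin ⟨Sum.inr ⟨⟨(a, m), hm⟩, ?_⟩, rfl⟩
      rintro ⟨s, hs⟩
      exact ham ⟨s, congrArg Subtype.val hs⟩
    · convert S.zero_mem using 1
      ext x
      refine coeff_eq_zero_of_totalDegree_lt ?_
      have := (totalDegree_taylorShift_le (u x) (q x a)).trans (hq x a)
      exact lt_of_le_of_lt this (not_le.1 hm)
  obtain ⟨hu, hsol⟩ := H S ht hfree
  have hall : ∀ a, (fun x => taylorShift (u x) (q x a)) ∈ coeffSubalgebra n S := by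
    intro a m
    by_cases ham : (a, m) ∈ Set.range e
    · obtain ⟨s, hs⟩ := ham
      simpa [hs] using hsol s
    · exact hfree a m ham
  have hback : ∀ s : CoeffIndex n D, (fun x => coeff s.1.2 (q x s.1.1)) ∈ S := by
    intro s
    have h := taylorShift_mem_coeffSubalgebra (u := fun x => -u x) (d := D s.1.1)
      (fun i => S.neg_mem (hu i))
      (fun x => (totalDegree_taylorShift_le (u x) (q x s.1.1)).trans (hq x s.1.1))
      (hall s.1.1) s.1.2
    simpa only [taylorShift_neg_taylorShift] using h
  have hcard' : Fintype.card (τ ⊕ {s : CoeffIndex n D // s ∉ Set.range E})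
      < Fintype.card (CoeffIndex n D) := by
    have h1 := Fintype.card_subtype_compl fun s : CoeffIndex n D => s ∈ Set.range E
    have h2 : Fintype.card {s : CoeffIndex n D // s ∈ Set.range E} = Fintype.card ε :=
      Set.card_range_of_injective hE
    have h3 : Fintype.card ε ≤ Fintype.card (CoeffIndex n D) :=
      Fintype.card_le_of_injective E hE
    rw [Fintype.card_sum]
    omega
  obtain ⟨Φ, h0, hΦ⟩ := exists_relation_of_mem_adjoin gen
    (fun s x => coeff s.1.2 (q x s.1.1)) hcard' hback
  refine ⟨Φ, h0, ?_⟩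
  intro p hp hdeg
  obtain ⟨x, rfl⟩ := hB p hp hdeg
  exact hΦ x

end Thin

/-! ### The degenerate situations are thin -/

section Degenerate

open Finsupp (single)

variable {ι : Type} {n : ℕ}

theorem coeff_zero_taylorShift (u : Fin n → ℝ) (p : MvPolynomial (Fin n) ℝ) :
    coeff 0 (taylorShift u p) = eval u p := by
  rw [← eval_zero_taylorShift, ← constantCoeff_eq, constantCoeff_eq, eval_zero,
    constantCoeff_eq]

theorem coeff_single_taylorShift (u : Fin n → ℝ) (p : MvPolynomial (Fin n) ℝ) (j : Fin n) :
    coeff (single j 1) (taylorShift u p) = eval u (pderiv j p) := by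
  rw [← coeff_zero_taylorShift, ← pderiv_taylorShift, coeff_pderiv]
  simp

theorem coeff_add_single_taylorShift (u : Fin n → ℝ) (p : MvPolynomial (Fin n) ℝ)
    (i j : Fin n) :
    eval u (pderiv j (pderiv i p)) =
      (if i = j then 2 else 1) * coeff (single i 1 + single j 1) (taylorShift u p) := by
  rw [← coeff_single_taylorShift, ← pderiv_taylorShift, coeff_pderiv, mul_comm,
    add_comm (single j 1)]
  congr 1
  by_cases h : i = j
  · subst h; norm_num
  · simp [h]

/-- Tuples for which the constraints in `J` share a zero at which the gradients of the members
in `A` satisfy a linear relation involving the member `k`. -/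
def dependentGradients (n : ℕ) (J A : Finset ι) (k : ι) :
    Set (ι → MvPolynomial (Fin n) ℝ) :=
  {q | ∃ (u : Fin n → ℝ) (c : ι → ℝ), c k = 1 ∧ (∀ l ∈ J, eval u (q l) = 0) ∧
    ∀ j, ∑ l ∈ A, c l * eval u (pderiv j (q l)) = 0}

/-- Tuples for which the linear parts of the members in `A` satisfy a linear relation involving
the member `k`. -/
def dependentLinearParts (n : ℕ) (A : Finset ι) (k : ι) : Set (ι → MvPolynomial (Fin n) ℝ) :=
  {q | ∃ c : ι → ℝ, c k = 1 ∧ ∀ j, ∑ l ∈ A, c l * coeff (single j 1) (q l) = 0}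

/-- Tuples with a point that is critical for a combination of the members in `A` involving the
member `k`, at which the constraints in `J` vanish, and at which the Hessian of this combination
is degenerate, relative to the gradients of the members in `J`, in a direction `v`, `v i = 1`,
tangent to the members in `A`. -/
def degenerateHessian (n : ℕ) (J A : Finset ι) (k : ι) (i : Fin n) :
    Set (ι → MvPolynomial (Fin n) ℝ) :=
  {q | ∃ (u v : Fin n → ℝ) (c w : ι → ℝ), c k = 1 ∧ v i = 1 ∧
    (∀ l ∈ J, eval u (q l) = 0) ∧
    (∀ l ∈ A, ∑ j, eval u (pderiv j (q l)) * v j = 0) ∧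
    (∀ j, ∑ l ∈ A, c l * eval u (pderiv j (q l)) = 0) ∧
    ∀ j, ∑ l ∈ A, c l * ∑ m, eval u (pderiv j (pderiv m (q l))) * v m =
      ∑ l ∈ J, w l * eval u (pderiv j (q l))}

theorem eq_neg_sum_erase [DecidableEq ι] {A : Finset ι} {k : ι} (hk : k ∈ A) {c y : ι → ℝ}
    (hc : c k = 1) {b : ℝ} (h : ∑ l ∈ A, c l * y l = b) :
    y k = b - ∑ l ∈ A.erase k, c l * y l := by
  rw [← Finset.add_sum_erase A _ hk, hc] at h
  linarith

theorem thin_dependentGradients [Finite ι] {D : ι → ℕ} (hD : ∀ a, 0 < D a)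
    {J A : Finset ι} {k : ι} (hk : k ∈ A) (hAJ : A.card ≤ J.card) :
    Thin D (dependentGradients n J A k) := by
  classical
  let X := {x : (ι → MvPolynomial (Fin n) ℝ) × (Fin n → ℝ) × (ι → ℝ) //
    (∀ a, (x.1 a).totalDegree ≤ D a) ∧ x.2.2 k = 1 ∧ (∀ l ∈ J, eval x.2.1 (x.1 l) = 0) ∧
    ∀ j, ∑ l ∈ A, x.2.2 l * eval x.2.1 (pderiv j (x.1 l)) = 0}
  let t : Fin n ⊕ A.erase k → X → ℝ :=
    Sum.elim (fun j x => x.1.2.1 j) (fun l x => x.1.2.2 l)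
  let e : J ⊕ Fin n → ι × (Fin n →₀ ℕ) :=
    Sum.elim (fun l => (l.1, 0)) (fun j => (k, single j 1))
  have he : Function.Injective e := by
    rintro (⟨l, hl⟩ | j) (⟨l', hl'⟩ | j') h <;> simp [e] at h ⊢
    · exact h
    · have := DFunLike.congr_fun h.2 j'
      simp at this
    · exact (Finsupp.single_left_inj one_ne_zero).1 h
  refine thin_of_card_lt (fun x : X => x.1.1) (fun x => x.2.1) (fun x => x.1.2.1) t e he ?_ ?_
    ?_ ?_
  · rintro (⟨l, hl⟩ | j)
    · simp [e]
    · simpa [e] using Nat.succ_le_of_lt (hD k)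
  · have := Finset.card_pos.2 ⟨k, hk⟩
    simp only [Fintype.card_sum, Fintype.card_fin, Fintype.card_coe, Finset.card_erase_of_mem hk]
    omega
  · rintro p ⟨u, c, hc, hJ, hA⟩ hdeg
    exact ⟨⟨(p, u, c), hdeg, hc, hJ, hA⟩, rfl⟩
  · intro S ht hfree
    refine ⟨fun j => ht (Sum.inl j), ?_⟩
    rintro (⟨l, hl⟩ | j)
    · convert S.zero_mem using 1
      ext x
      simpa [e, coeff_zero_taylorShift] using x.2.2.2.1 l hl
    · have : (fun x : X => coeff (single j 1) (taylorShift x.1.2.1 (x.1.1 k))) =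
          -∑ l : A.erase k, t (Sum.inr l) *
            fun x : X => coeff (single j 1) (taylorShift x.1.2.1 (x.1.1 l)) := by
        ext x
        have h := eq_neg_sum_erase hk x.2.2.1 (x.2.2.2.2 j)
        simp only [Pi.neg_apply, Finset.sum_apply, Pi.mul_apply, coeff_single_taylorShift]
        rw [h, zero_sub, ← Finset.sum_coe_sort]
        rfl
      simp only [e, Sum.elim_inr]
      rw [this]
      refine S.neg_mem (S.sum_mem fun l _ => S.mul_mem (ht _) (hfree _ _ ?_))
      rintro ⟨(⟨l', hl'⟩ | j'), h⟩ <;> simp [e] at h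
      · have := DFunLike.congr_fun h.2 j
        simp at this
      · exact (Finset.ne_of_mem_erase l.2) h.1.symm

theorem thin_dependentLinearParts [Finite ι] {D : ι → ℕ} (hD : ∀ a, 0 < D a)
    {A : Finset ι} {k : ι} (hk : k ∈ A) (hA : A.card ≤ n) :
    Thin D (dependentLinearParts n A k) := by
  classical
  let X := {x : (ι → MvPolynomial (Fin n) ℝ) × (ι → ℝ) //
    (∀ a, (x.1 a).totalDegree ≤ D a) ∧ x.2 k = 1 ∧
    ∀ j, ∑ l ∈ A, x.2 l * coeff (single j 1) (x.1 l) = 0}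
  let t : A.erase k → X → ℝ := fun l x => x.1.2 l
  let e : Fin n → ι × (Fin n →₀ ℕ) := fun j => (k, single j 1)
  have he : Function.Injective e := by
    intro j j' h
    simp only [e, Prod.mk.injEq, true_and] at h
    exact (Finsupp.single_left_inj one_ne_zero).1 h
  have hshift : ∀ p : MvPolynomial (Fin n) ℝ, taylorShift 0 p = p := fun p => by
    simp [taylorShift]
  refine thin_of_card_lt (fun x : X => x.1.1) (fun x => x.2.1) (fun _ => 0) t e he ?_ ?_ ?_ ?_
  · intro j
    simpa [e] using Nat.succ_le_of_lt (hD k)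
  · have := Finset.card_pos.2 ⟨k, hk⟩
    simp only [Fintype.card_fin, Fintype.card_coe, Finset.card_erase_of_mem hk]
    omega
  · rintro p ⟨c, hc, hA⟩ hdeg
    exact ⟨⟨(p, c), hdeg, hc, hA⟩, rfl⟩
  · intro S ht hfree
    refine ⟨fun j => S.zero_mem, fun j => ?_⟩
    simp only [hshift] at hfree ⊢
    have : (fun x : X => coeff (single j 1) (x.1.1 k)) =
        -∑ l : A.erase k, t l * fun x : X => coeff (single j 1) (x.1.1 l) := by
      ext x
      have h := eq_neg_sum_erase hk x.2.2.1 (x.2.2.2 j)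
      simp only [Pi.neg_apply, Finset.sum_apply, Pi.mul_apply]
      rw [h, zero_sub, ← Finset.sum_coe_sort]
    simp only [e]
    rw [this]
    refine S.neg_mem (S.sum_mem fun l _ => S.mul_mem (ht _) (hfree _ _ ?_))
    rintro ⟨j', h⟩
    exact (Finset.ne_of_mem_erase l.2) (congrArg Prod.fst h).symm

theorem sum_fun_mem {X κ : Type} {S : Subalgebra ℝ (X → ℝ)} {s : Finset κ} {f : κ → X → ℝ}
    (h : ∀ l ∈ s, f l ∈ S) : (fun x => ∑ l ∈ s, f l x) ∈ S := by
  convert S.sum_mem h using 1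
  ext x
  simp

theorem thin_degenerateHessian [Finite ι] {D : ι → ℕ} (hD : ∀ a, 0 < D a)
    {J A : Finset ι} {k : ι} (hk : k ∈ A) (hDk : 2 ≤ D k) (i : Fin n) :
    Thin D (degenerateHessian n J A k i) := by
  classical
  let X := {x : (ι → MvPolynomial (Fin n) ℝ) × (Fin n → ℝ) × (Fin n → ℝ) × (ι → ℝ) × (ι → ℝ) //
    (∀ a, (x.1 a).totalDegree ≤ D a) ∧ x.2.2.2.1 k = 1 ∧ x.2.2.1 i = 1 ∧
    (∀ l ∈ J, eval x.2.1 (x.1 l) = 0) ∧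
    (∀ l ∈ A, ∑ j, eval x.2.1 (pderiv j (x.1 l)) * x.2.2.1 j = 0) ∧
    (∀ j, ∑ l ∈ A, x.2.2.2.1 l * eval x.2.1 (pderiv j (x.1 l)) = 0) ∧
    ∀ j, ∑ l ∈ A, x.2.2.2.1 l * ∑ m, eval x.2.1 (pderiv j (pderiv m (x.1 l))) * x.2.2.1 m =
      ∑ l ∈ J, x.2.2.2.2 l * eval x.2.1 (pderiv j (x.1 l))}
  let q : X → ι → MvPolynomial (Fin n) ℝ := fun x => x.1.1
  let u : X → Fin n → ℝ := fun x => x.1.2.1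
  let v : X → Fin n → ℝ := fun x => x.1.2.2.1
  let c : X → ι → ℝ := fun x => x.1.2.2.2.1
  let w : X → ι → ℝ := fun x => x.1.2.2.2.2
  let t : (Fin n ⊕ Finset.univ.erase i) ⊕ (A.erase k ⊕ J) → X → ℝ :=
    Sum.elim (Sum.elim (fun j x => u x j) (fun j x => v x j))
      (Sum.elim (fun l x => c x l) (fun l x => w x l))
  let e : (J ⊕ A.erase k) ⊕ (Fin n ⊕ Fin n) → ι × (Fin n →₀ ℕ) :=
    Sum.elim (Sum.elim (fun l => (l.1, 0)) (fun l => (l.1, single i 1)))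
      (Sum.elim (fun j => (k, single j 1)) (fun j => (k, single i 1 + single j 1)))
  have hdeg : ∀ {m m' : Fin n →₀ ℕ}, m = m' → m.degree = m'.degree := fun h => by rw [h]
  have he : Function.Injective e := by
    rintro ((⟨l, hl⟩ | ⟨l, hl⟩) | (j | j)) ((⟨l', hl'⟩ | ⟨l', hl'⟩) | (j' | j')) h <;>
      have h1 := congrArg Prod.fst h <;> have h2 := congrArg Prod.snd h <;>
      have h3 := hdeg h2 <;> simp [e] at h3 <;> simp only [e, Sum.elim_inl, Sum.elim_inr] at h1
    · subst h1; rfl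
    · subst h1; rfl
    · exact absurd h1 (Finset.ne_of_mem_erase hl)
    · exact absurd h1.symm (Finset.ne_of_mem_erase hl')
    · rw [(Finsupp.single_left_inj one_ne_zero).1 h2]
    · rw [(Finsupp.single_left_inj one_ne_zero).1 (add_left_cancel h2)]
  refine thin_of_card_lt q (fun x => x.2.1) u t e he ?_ ?_ ?_ ?_
  · rintro ((⟨l, hl⟩ | ⟨l, hl⟩) | (j | j))
    · simp [e]
    · simpa [e] using Nat.succ_le_of_lt (hD l)
    · simpa [e] using Nat.succ_le_of_lt (hD k)
    · simpa [e] using hDk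
  · have := i.pos
    simp only [Fintype.card_sum, Fintype.card_fin, Fintype.card_coe,
      Finset.card_erase_of_mem (Finset.mem_univ i), Finset.card_univ]
    omega
  · rintro p ⟨u, v, c, w, hc, hv, hJ, hA, hg, hH⟩ hdeg
    exact ⟨⟨(p, u, v, c, w), hdeg, hc, hv, hJ, hA, hg, hH⟩, rfl⟩
  intro S ht hfree
  have hu : ∀ j, (fun x => u x j) ∈ S := fun j => ht (Sum.inl (Sum.inl j))
  have hvi : ∀ x, v x i = 1 := fun x => x.2.2.2.1
  have hv : ∀ j, j ≠ i → (fun x => v x j) ∈ S := fun j hj =>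
    ht (Sum.inl (Sum.inr ⟨j, by simpa using hj⟩))
  have hc : ∀ l ∈ A.erase k, (fun x => c x l) ∈ S := fun l hl => ht (Sum.inr (Sum.inl ⟨l, hl⟩))
  have hw : ∀ l ∈ J, (fun x => w x l) ∈ S := fun l hl => ht (Sum.inr (Sum.inr ⟨l, hl⟩))
  have hv' : ∀ j, (fun x => v x j) ∈ S := fun j => by
    by_cases hj : j = i
    · subst hj
      simp only [hvi]
      exact S.one_mem
    · exact hv j hj
  have hlin : ∀ l j, l ≠ k → (l ∈ A → j ≠ i) →
      (fun x => eval (u x) (pderiv j (q x l))) ∈ S := by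
    intro l j hl hj
    simp only [← coeff_single_taylorShift]
    refine hfree _ _ ?_
    rintro ⟨((⟨l', hl'⟩ | ⟨l', hl'⟩) | (j' | j')), h⟩ <;>
      simp only [e, Sum.elim_inl, Sum.elim_inr, Prod.mk.injEq] at h <;>
      obtain ⟨h1, h2⟩ := h <;> have h3 := hdeg h2 <;> simp at h3
    · subst h1
      exact hj (Finset.mem_of_mem_erase hl') ((Finsupp.single_left_inj one_ne_zero).1 h2).symm
    · exact hl h1.symm
  have htan : ∀ l ∈ A.erase k, (fun x => eval (u x) (pderiv i (q x l))) ∈ S := by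
    intro l hl
    have hlk := Finset.ne_of_mem_erase hl
    have : (fun x => eval (u x) (pderiv i (q x l))) = -fun x => ∑ j ∈ Finset.univ.erase i,
        ((fun x => eval (u x) (pderiv j (q x l))) * fun x => v x j) x := by
      ext x
      have h : ∑ j, eval (u x) (pderiv j (q x l)) * v x j = 0 :=
        x.2.2.2.2.2.1 l (Finset.mem_of_mem_erase hl)
      rw [← Finset.add_sum_erase _ _ (Finset.mem_univ i), hvi] at h
      simp only [Pi.neg_apply, Pi.mul_apply]
      linarith
    rw [this]
    exact S.neg_mem (sum_fun_mem fun j hj => S.mul_mem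
      (hlin l j hlk fun _ => Finset.ne_of_mem_erase hj) (hv' j))
  have hlin' : ∀ l j, l ≠ k → (fun x => eval (u x) (pderiv j (q x l))) ∈ S := by
    intro l j hl
    by_cases h : l ∈ A ∧ j = i
    · obtain ⟨hA, rfl⟩ := h
      exact htan l (Finset.mem_erase.2 ⟨hl, hA⟩)
    · exact hlin l j hl fun hA hj => h ⟨hA, hj⟩
  have hlin_k : ∀ j, (fun x => eval (u x) (pderiv j (q x k))) ∈ S := by
    intro j
    have : (fun x => eval (u x) (pderiv j (q x k))) = -fun x => ∑ l ∈ A.erase k,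
        ((fun x => c x l) * fun x => eval (u x) (pderiv j (q x l))) x := by
      ext x
      have h := eq_neg_sum_erase hk x.2.2.1 (x.2.2.2.2.2.2.1 j)
      simp only [Pi.neg_apply, Pi.mul_apply]
      rw [← zero_sub]
      exact h
    rw [this]
    exact S.neg_mem (sum_fun_mem fun l hl => S.mul_mem (hc l hl)
      (hlin' l j (Finset.ne_of_mem_erase hl)))
  have hgrad : ∀ l j, (fun x => eval (u x) (pderiv j (q x l))) ∈ S := by
    intro l j
    by_cases hl : l = k
    · subst hl; exact hlin_k j
    · exact hlin' l j hl
  have hhess_free : ∀ l j m, (l = k → j ≠ i ∧ m ≠ i) →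
      (fun x => eval (u x) (pderiv j (pderiv m (q x l)))) ∈ S := by
    intro l j m hl
    simp only [coeff_add_single_taylorShift]
    refine S.mul_mem (S.algebraMap_mem (if m = j then 2 else 1 : ℝ)) (hfree _ _ ?_)
    rintro ⟨((⟨l', hl'⟩ | ⟨l', hl'⟩) | (j' | j')), h⟩ <;>
      simp only [e, Sum.elim_inl, Sum.elim_inr, Prod.mk.injEq] at h <;>
      obtain ⟨h1, h2⟩ := h <;> have h3 := hdeg h2 <;> simp at h3
    obtain ⟨hj, hm⟩ := hl h1.symm
    have := DFunLike.congr_fun h2 i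
    simp [hj, hm] at this
  have hsum : ∀ j, (fun x => ∑ m, eval (u x) (pderiv j (pderiv m (q x k))) * v x m) ∈ S := by
    intro j
    have : (fun x => ∑ m, eval (u x) (pderiv j (pderiv m (q x k))) * v x m) =
        (fun x => ∑ l ∈ J, ((fun x => w x l) * fun x => eval (u x) (pderiv j (q x l))) x) -
        fun x => ∑ l ∈ A.erase k, ((fun x => c x l) * fun x => ∑ m,
          ((fun x => eval (u x) (pderiv j (pderiv m (q x l)))) * fun x => v x m) x) x := by
      ext x
      exact eq_neg_sum_erase hk x.2.2.1 (x.2.2.2.2.2.2.2 j)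
    rw [this]
    exact S.sub_mem (sum_fun_mem fun l hl => S.mul_mem (hw l hl) (hgrad l j))
      (sum_fun_mem fun l hl => S.mul_mem (hc l hl) (sum_fun_mem fun m _ =>
        S.mul_mem (hhess_free l j m fun h => absurd h (Finset.ne_of_mem_erase hl)) (hv' m)))
  have hrow : ∀ j, (∀ m, m ≠ i → (fun x => eval (u x) (pderiv j (pderiv m (q x k)))) ∈ S) →
      (fun x => eval (u x) (pderiv j (pderiv i (q x k)))) ∈ S := by
    intro j hj
    have : (fun x => eval (u x) (pderiv j (pderiv i (q x k)))) =
        (fun x => ∑ m, eval (u x) (pderiv j (pderiv m (q x k))) * v x m) -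
        fun x => ∑ m ∈ Finset.univ.erase i,
          ((fun x => eval (u x) (pderiv j (pderiv m (q x k)))) * fun x => v x m) x := by
      ext x
      simp only [Pi.sub_apply, Pi.mul_apply]
      rw [← Finset.add_sum_erase _ _ (Finset.mem_univ i), hvi]
      ring
    rw [this]
    exact S.sub_mem (hsum j) (sum_fun_mem fun m hm =>
      S.mul_mem (hj m (Finset.ne_of_mem_erase hm)) (hv' m))
  have hhess_ne : ∀ j, j ≠ i → (fun x => eval (u x) (pderiv j (pderiv i (q x k)))) ∈ S :=
    fun j hj => hrow j fun m hm => hhess_free k j m fun _ => ⟨hj, hm⟩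
  have hhess : ∀ j, (fun x => eval (u x) (pderiv j (pderiv i (q x k)))) ∈ S := by
    intro j
    by_cases hj : j = i
    · subst hj
      refine hrow j fun m hm => ?_
      have : ∀ x, eval (u x) (pderiv j (pderiv m (q x k)))
          = eval (u x) (pderiv m (pderiv j (q x k))) := fun x => by
        rw [coeff_add_single_taylorShift, coeff_add_single_taylorShift, add_comm]
        simp only [eq_comm]
      simpa only [this] using hhess_ne m hm
    · exact hhess_ne j hj
  refine ⟨hu, ?_⟩
  rintro ((⟨l, hl⟩ | ⟨l, hl⟩) | (j | j))
  · convert S.zero_mem using 1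
    ext x
    simpa [e, coeff_zero_taylorShift] using x.2.2.2.2.1 l hl
  · simp only [e, Sum.elim_inl, Sum.elim_inr, coeff_single_taylorShift]
    exact hgrad l i
  · simp only [e, Sum.elim_inl, Sum.elim_inr, coeff_single_taylorShift]
    exact hgrad k j
  · have : (fun x => coeff (Finsupp.single i 1 + Finsupp.single j 1) (taylorShift (u x) (q x k))) =
        algebraMap ℝ (X → ℝ) ((if i = j then 2 else 1 : ℝ)⁻¹) *
          fun x => eval (u x) (pderiv j (pderiv i (q x k))) := by
      ext x
      simp only [coeff_add_single_taylorShift, Pi.mul_apply, Pi.algebraMap_apply,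
        Algebra.algebraMap_self, RingHom.id_apply]
      rw [← mul_assoc, inv_mul_cancel₀ (by split_ifs <;> norm_num), one_mul]
    simp only [e, Sum.elim_inr]
    rw [this]
    exact S.mul_mem (S.algebraMap_mem _) (hhess j)

end Degenerate

/-! ### Necessary optimality conditions -/

section Optimality

open Filter Topology

variable {n : ℕ}

theorem hasStrictFDerivAt_eval (p : MvPolynomial (Fin n) ℝ) (u : Fin n → ℝ) :
    HasStrictFDerivAt (fun x : Fin n → ℝ => eval x p)
      (∑ j, gradAt p u j • (ContinuousLinearMap.proj j : (Fin n → ℝ) →L[ℝ] ℝ)) u := by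
  induction p using MvPolynomial.induction_on with
  | C a => simpa [gradAt] using hasStrictFDerivAt_const a u
  | add p q hp hq =>
    simp only [map_add]
    convert! hp.add hq using 1
    simp [gradAt, add_smul, Finset.sum_add_distrib]
  | mul_X p i hp =>
    simp only [map_mul, eval_X]
    convert! hp.mul (hasStrictFDerivAt_apply i u) using 1
    ext v
    simp [gradAt, Derivation.leibniz, pderiv_X, Pi.single_apply, add_mul,
      Finset.sum_add_distrib, Finset.mul_sum, apply_ite (eval u), mul_assoc]

theorem hasDerivAt_eval_comp (p : MvPolynomial (Fin n) ℝ) {x : ℝ → Fin n → ℝ}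
    {u v : Fin n → ℝ} (hx0 : x 0 = u) (hx : HasDerivAt x v 0) :
    HasDerivAt (fun s => eval (x s) p) (gradAt p u ⬝ᵥ v) 0 := by
  subst hx0
  have := (hasStrictFDerivAt_eval p (x 0)).hasFDerivAt.comp_hasDerivAt (0 : ℝ) hx
  simpa [dotProduct] using! this

theorem tendsto_slope_eval_comp (p : MvPolynomial (Fin n) ℝ) {x : ℝ → Fin n → ℝ}
    {u v : Fin n → ℝ} (hx0 : x 0 = u) (hx : HasDerivAt x v 0) :
    Tendsto (fun s => (eval (x s) p - eval u p) / s) (𝓝[≠] 0) (𝓝 (gradAt p u ⬝ᵥ v)) := by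
  have h := (hasDerivAt_eval_comp p hx0 hx).tendsto_slope
  simpa [slope_fun_def_field, hx0] using h

/-- The derivative of polynomials in the direction `v`. -/
def dirDeriv (v : Fin n → ℝ) :
    Derivation ℝ (MvPolynomial (Fin n) ℝ) (MvPolynomial (Fin n) ℝ) :=
  mkDerivation ℝ fun j => C (v j)

theorem eval_dirDeriv (v : Fin n → ℝ) (p : MvPolynomial (Fin n) ℝ) (u : Fin n → ℝ) :
    eval u (dirDeriv v p) = gradAt p u ⬝ᵥ v := by
  induction p using MvPolynomial.induction_on with
  | C a => simp [gradAt, dotProduct, dirDeriv, derivation_C]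
  | add p q hp hq =>
    simp only [map_add, hp, hq]
    simp [gradAt, dotProduct, add_mul, Finset.sum_add_distrib]
  | mul_X p i hp =>
    simp only [Derivation.leibniz, map_add, smul_eq_mul, map_mul, hp, eval_X]
    simp [gradAt, dotProduct, Derivation.leibniz, pderiv_X, Pi.single_apply, add_mul,
      Finset.sum_add_distrib, Finset.mul_sum, apply_ite (eval u), mul_assoc, dirDeriv]

theorem hessAt_dirDeriv (v : Fin n → ℝ) (p : MvPolynomial (Fin n) ℝ) (u : Fin n → ℝ) :
    v ⬝ᵥ (hessAt p u) *ᵥ v = eval u (dirDeriv v (dirDeriv v p)) := by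
  have h : ∀ q : MvPolynomial (Fin n) ℝ, dirDeriv v q = ∑ j, C (v j) * pderiv j q := by
    intro q
    refine MvPolynomial.funext fun y => ?_
    rw [eval_dirDeriv]
    simp [dotProduct, gradAt, mul_comm]
  rw [eval_dirDeriv, h]
  simp only [dotProduct, Matrix.mulVec, hessAt, gradAt, Matrix.of_apply, map_sum, pderiv_C_mul,
    map_mul, eval_C]
  refine Finset.sum_congr rfl fun i _ => ?_
  rw [mul_comm]
  congr 1
  exact Finset.sum_congr rfl fun j _ => mul_comm _ _

/-- Second order expansion of a polynomial along a curve differentiable at the base point. -/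
theorem tendsto_second_order (p : MvPolynomial (Fin n) ℝ) {x : ℝ → Fin n → ℝ}
    {u v : Fin n → ℝ} (hx0 : x 0 = u) (hx : HasDerivAt x v 0) :
    Tendsto (fun s => (eval (x s) p - eval u p - gradAt p u ⬝ᵥ (x s - u)) / s ^ 2) (𝓝[≠] 0)
      (𝓝 (2⁻¹ * v ⬝ᵥ (hessAt p u) *ᵥ v)) := by
  rw [hessAt_dirDeriv]
  induction p using MvPolynomial.induction_on with
  | C a => simp [gradAt, dotProduct, dirDeriv, derivation_C]
  | add p q hp hq =>
    convert hp.add hq using 2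
    · rw [← add_div]
      congr 1
      simp only [← eval_dirDeriv, map_add]
      ring
    · simp only [map_add]
      ring
  | mul_X p i hp =>
    have h1 := tendsto_slope_eval_comp p hx0 hx
    have h2 := tendsto_slope_eval_comp (X i) hx0 hx
    simp only [← eval_dirDeriv] at h1 h2 hp ⊢
    have hX : ∀ w : Fin n → ℝ, dirDeriv w (X i) = C (w i) := fun w => by simp [dirDeriv]
    have hC : ∀ (w : Fin n → ℝ) (a : ℝ), dirDeriv w (C a) = 0 := fun w a => by
      simp [dirDeriv, derivation_C]
    convert (h1.mul h2).add (hp.const_mul (u i)) using 2 with s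
    · simp only [Derivation.leibniz, smul_eq_mul, map_mul, map_add, eval_X, hX, eval_C,
        Pi.sub_apply]
      rw [div_mul_div_comm, mul_div_assoc', ← sq, ← add_div]
      congr 1
      ring
    · simp only [Derivation.leibniz, smul_eq_mul, map_mul, map_add, eval_X, hX, eval_C, hC,
        map_zero]
      ring

/-- Along a direction tangent to a regular system of equations there is a curve of solutions. -/
theorem exists_curve {κ : Type} [Fintype κ] (p : κ → MvPolynomial (Fin n) ℝ) {u v : Fin n → ℝ}
    (hp : LinearIndependent ℝ fun k => gradAt (p k) u) (hv : ∀ k, gradAt (p k) u ⬝ᵥ v = 0) :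
    ∃ x : ℝ → Fin n → ℝ, x 0 = u ∧ HasDerivAt x v 0 ∧
      ∀ᶠ s in 𝓝 0, ∀ k, eval (x s) (p k) = eval u (p k) := by
  classical
  let F : (Fin n → ℝ) → κ → ℝ := fun x k => eval x (p k)
  let F' : (Fin n → ℝ) →L[ℝ] κ → ℝ := ContinuousLinearMap.pi fun k =>
    ∑ j, gradAt (p k) u j • (ContinuousLinearMap.proj j : (Fin n → ℝ) →L[ℝ] ℝ)
  have hF : HasStrictFDerivAt F F' u :=
    hasStrictFDerivAt_pi.2 fun k => hasStrictFDerivAt_eval (p k) u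
  let M : Matrix κ (Fin n) ℝ := Matrix.of fun k => gradAt (p k) u
  have hF'M : ∀ y, F' y = M *ᵥ y := fun y => by
    ext k
    simp [F', M, Matrix.mulVec, dotProduct]
  have hsurj : F'.range = ⊤ := by
    have hM : M.rank = Fintype.card κ := LinearIndependent.rank_matrix hp
    have hr : LinearMap.range M.mulVecLin = ⊤ := by
      refine Submodule.eq_top_of_finrank_eq ?_
      rw [Module.finrank_fintype_fun_eq_card]
      exact hM
    rw [← hr]
    congr 1
    refine LinearMap.ext fun y => ?_
    exact hF'M _
  have hker : v ∈ F'.ker := by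
    rw [LinearMap.mem_ker]
    ext k
    exact (congrFun (hF'M v) k).trans (hv k)
  let φ := hF.implicitFunction F F' hsurj
  let γ : ℝ → F'.ker := fun s => s • ⟨v, hker⟩
  have hγ : HasDerivAt γ ⟨v, hker⟩ 0 := by
    simpa using! (hasDerivAt_id (0 : ℝ)).smul_const (⟨v, hker⟩ : F'.ker)
  have hγ0 : γ 0 = 0 := zero_smul _ _
  refine ⟨fun s => φ (F u) (γ s), ?_, ?_, ?_⟩
  · simp only [hγ0]
    exact hF.implicitFunction_apply_image hsurj
  · have h := hF.to_implicitFunction hsurj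
    rw [← hγ0] at h
    exact h.hasFDerivAt.comp_hasDerivAt (0 : ℝ) hγ
  · have h := hF.map_implicitFunction_eq hsurj
    have ht : Tendsto (fun s => (F u, γ s)) (𝓝 0) (𝓝 (F u, 0)) := by
      have := (tendsto_const_nhds (x := F u)).prodMk_nhds hγ.continuousAt.tendsto
      rwa [hγ0] at this
    filter_upwards [ht.eventually h] with s hs k
    exact congrFun hs k

/-- A vector orthogonal to everything orthogonal to a finite family is a combination of it. -/
theorem exists_eq_sum_of_orthogonal {ι : Type} (J : Finset ι) (w : ι → Fin n → ℝ)
    (z : Fin n → ℝ) (h : ∀ v, (∀ l ∈ J, w l ⬝ᵥ v = 0) → z ⬝ᵥ v = 0) :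
    ∃ c : ι → ℝ, (∀ l, l ∉ J → c l = 0) ∧ ∀ j, z j = ∑ l ∈ J, c l * w l j := by
  classical
  let L : (Fin n → ℝ) → (Fin n → ℝ) →ₗ[ℝ] ℝ := fun y => dotProductBilin ℝ ℝ y
  have hL : ∀ y v, L y v = y ⬝ᵥ v := fun _ _ => rfl
  have hker : ⨅ l : J, LinearMap.ker (L (w l)) ≤ LinearMap.ker (L z) := fun v hv => by
    simp only [Submodule.mem_iInf, LinearMap.mem_ker, hL] at hv ⊢
    exact h v fun l hl => hv ⟨l, hl⟩
  obtain ⟨c, hc⟩ := Submodule.mem_span_range_iff_exists_fun ℝ |>.1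
    (mem_span_of_iInf_ker_le_ker hker)
  refine ⟨fun l => if hl : l ∈ J then c ⟨l, hl⟩ else 0, fun l hl => dif_neg hl, fun j => ?_⟩
  have hj := LinearMap.congr_fun hc (Pi.single j 1)
  rw [← Finset.sum_coe_sort J]
  simpa [hL, LinearMap.sum_apply] using hj.symm

variable {ι : Type} {q : ι → MvPolynomial (Fin n) ℝ} {u : Fin n → ℝ} {J E : Finset ι} {o : ι}

theorem exists_curve_on {J' : Finset ι} (hEJ' : E ⊆ J')
    (hJ0 : ∀ l ∈ J, eval u (q l) = 0) (hJ' : J' ⊆ J)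
    (hmin : ∀ᶠ x in 𝓝 u, (∀ l ∈ E, eval x (q l) = 0) → (∀ l ∈ J, l ∉ E → 0 ≤ eval x (q l)) →
      eval u (q o) ≤ eval x (q o))
    (hli : LinearIndepOn ℝ (fun l => gradAt (q l) u) (J' : Set ι)) {v : Fin n → ℝ}
    (hv : ∀ l ∈ J', gradAt (q l) u ⬝ᵥ v = 0)
    (hv' : ∀ l ∈ J, l ∉ J' → 0 < gradAt (q l) u ⬝ᵥ v) :
    ∃ x : ℝ → Fin n → ℝ, x 0 = u ∧ HasDerivAt x v 0 ∧
      (∀ᶠ s in 𝓝[>] 0, ∀ l ∈ J', eval (x s) (q l) = 0) ∧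
      ∀ᶠ s in 𝓝[>] 0, eval u (q o) ≤ eval (x s) (q o) := by
  obtain ⟨x, hx0, hx, hxJ⟩ := exists_curve (fun l : J' => q l) (u := u) (v := v) hli
    fun l => hv l l.2
  have hzero : ∀ᶠ s in 𝓝[>] (0 : ℝ), ∀ l ∈ J', eval (x s) (q l) = 0 := by
    filter_upwards [nhdsWithin_le_nhds hxJ] with s hs l hl
    exact (hs ⟨l, hl⟩).trans (hJ0 l (hJ' hl))
  refine ⟨x, hx0, hx, hzero, ?_⟩
  have hpos : ∀ᶠ s in 𝓝[>] (0 : ℝ), ∀ l ∈ J, l ∉ J' → 0 < eval (x s) (q l) := by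
    refine (Finset.eventually_all J).2 fun l hl => ?_
    by_cases hl' : l ∈ J'
    · exact Eventually.of_forall fun s h => absurd hl' h
    · have h := (tendsto_slope_eval_comp (q l) hx0 hx).mono_left
        (nhdsWithin_mono (0 : ℝ) (s := Set.Ioi 0) fun s hs => ne_of_gt hs)
      filter_upwards [h.eventually (lt_mem_nhds (hv' l hl hl')), self_mem_nhdsWithin] with s hs hs0 _
      rw [hJ0 l hl, sub_zero] at hs
      exact (div_pos_iff_of_pos_right hs0).1 hs
  have hxt : Tendsto x (𝓝[>] 0) (𝓝 u) := by
    have := hx.continuousAt.tendsto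
    rw [hx0] at this
    exact this.mono_left nhdsWithin_le_nhds
  filter_upwards [hzero, hpos, hxt.eventually hmin] with s h1 h2 h3
  refine h3 (fun l hl => h1 l (hEJ' hl)) fun l hl _ => ?_
  by_cases hl' : l ∈ J'
  · exact (h1 l hl').ge
  · exact (h2 l hl hl').le

/-- First order necessary condition. -/
theorem gradAt_nonneg_of_localMin {J' : Finset ι} (hEJ' : E ⊆ J')
    (hJ0 : ∀ l ∈ J, eval u (q l) = 0) (hJ' : J' ⊆ J)
    (hmin : ∀ᶠ x in 𝓝 u, (∀ l ∈ E, eval x (q l) = 0) → (∀ l ∈ J, l ∉ E → 0 ≤ eval x (q l)) →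
      eval u (q o) ≤ eval x (q o))
    (hli : LinearIndepOn ℝ (fun l => gradAt (q l) u) (J' : Set ι)) {v : Fin n → ℝ}
    (hv : ∀ l ∈ J', gradAt (q l) u ⬝ᵥ v = 0)
    (hv' : ∀ l ∈ J, l ∉ J' → 0 < gradAt (q l) u ⬝ᵥ v) :
    0 ≤ gradAt (q o) u ⬝ᵥ v := by
  obtain ⟨x, hx0, hx, -, hxo⟩ := exists_curve_on hEJ' hJ0 hJ' hmin hli hv hv'
  have h := (tendsto_slope_eval_comp (q o) hx0 hx).mono_left
    (nhdsWithin_mono (0 : ℝ) (s := Set.Ioi 0) fun s hs => ne_of_gt hs)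
  refine ge_of_tendsto h ?_
  filter_upwards [hxo, self_mem_nhdsWithin] with s hs hs0
  exact div_nonneg (sub_nonneg.2 hs) (le_of_lt hs0)

/-- Second order necessary condition. -/
theorem hessAt_nonneg_of_localMin (hE : E ⊆ J) (hJ0 : ∀ l ∈ J, eval u (q l) = 0)
    (hmin : ∀ᶠ x in 𝓝 u, (∀ l ∈ E, eval x (q l) = 0) → (∀ l ∈ J, l ∉ E → 0 ≤ eval x (q l)) →
      eval u (q o) ≤ eval x (q o))
    (hli : LinearIndepOn ℝ (fun l => gradAt (q l) u) (J : Set ι)) {c : ι → ℝ}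
    (hc : ∀ j, gradAt (q o) u j = ∑ l ∈ J, c l * gradAt (q l) u j) {v : Fin n → ℝ}
    (hv : ∀ l ∈ J, gradAt (q l) u ⬝ᵥ v = 0) :
    0 ≤ v ⬝ᵥ (hessAt (q o - ∑ l ∈ J, C (c l) * q l) u) *ᵥ v := by
  obtain ⟨x, hx0, hx, hxJ, hxo⟩ := exists_curve_on hE hJ0 subset_rfl hmin hli hv
    fun l hl hl' => absurd hl hl'
  have h := (tendsto_second_order (q o - ∑ l ∈ J, C (c l) * q l) hx0 hx).mono_left
    (nhdsWithin_mono (0 : ℝ) (s := Set.Ioi 0) fun s hs => ne_of_gt hs)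
  have hgrad : gradAt (q o - ∑ l ∈ J, C (c l) * q l) u = 0 := by
    ext j
    have := hc j
    simp only [gradAt, map_sub, map_sum, pderiv_C_mul, map_mul, eval_C, Pi.zero_apply] at this ⊢
    linarith
  have h2 : 0 ≤ 2⁻¹ * v ⬝ᵥ (hessAt (q o - ∑ l ∈ J, C (c l) * q l) u) *ᵥ v := by
    refine ge_of_tendsto h ?_
    filter_upwards [hxJ, hxo] with s hs hso
    rw [hgrad, zero_dotProduct, sub_zero]
    have e1 : ∑ l ∈ J, c l * eval (x s) (q l) = 0 :=
      Finset.sum_eq_zero fun l hl => by rw [hs l hl, mul_zero]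
    have e2 : ∑ l ∈ J, c l * eval u (q l) = 0 :=
      Finset.sum_eq_zero fun l hl => by rw [hJ0 l hl, mul_zero]
    simp only [map_sub, map_sum, map_mul, eval_C, e1, e2, sub_zero]
    exact div_nonneg (sub_nonneg.2 hso) (sq_nonneg _)
  linarith

end Optimality

/-! ### Generic tuples -/

section Generic

open Filter Topology

variable {n : ℕ} {ι : Type}

theorem mem_dependentGradients {q : ι → MvPolynomial (Fin n) ℝ} {J A : Finset ι} {k : ι}
    {u : Fin n → ℝ} {c : ι → ℝ} (hk : c k ≠ 0) (hJ : ∀ l ∈ J, eval u (q l) = 0)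
    (hc : ∀ j, ∑ l ∈ A, c l * gradAt (q l) u j = 0) : q ∈ dependentGradients n J A k := by
  refine ⟨u, fun l => c l / c k, div_self hk, hJ, fun j => ?_⟩
  simp only [div_mul_eq_mul_div, ← Finset.sum_div]
  exact (congrArg (· / c k) (hc j)).trans (zero_div _)

theorem mem_dependentLinearParts {q : ι → MvPolynomial (Fin n) ℝ} {A : Finset ι} {k : ι}
    {c : ι → ℝ} (hk : c k ≠ 0)
    (hc : ∀ j, ∑ l ∈ A, c l * coeff (Finsupp.single j 1) (q l) = 0) :
    q ∈ dependentLinearParts n A k := by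
  refine ⟨fun l => c l / c k, div_self hk, fun j => ?_⟩
  simp only [div_mul_eq_mul_div, ← Finset.sum_div, hc j, zero_div]

theorem mem_degenerateHessian {q : ι → MvPolynomial (Fin n) ℝ} {J A : Finset ι} {k : ι}
    {i : Fin n} {u v : Fin n → ℝ} {c w : ι → ℝ} (hk : c k ≠ 0) (hi : v i ≠ 0)
    (hJ : ∀ l ∈ J, eval u (q l) = 0) (hv : ∀ l ∈ A, gradAt (q l) u ⬝ᵥ v = 0)
    (hc : ∀ j, ∑ l ∈ A, c l * gradAt (q l) u j = 0)
    (hw : ∀ j, ∑ l ∈ A, c l * (hessAt (q l) u *ᵥ v) j = ∑ l ∈ J, w l * gradAt (q l) u j) :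
    q ∈ degenerateHessian n J A k i := by
  refine ⟨u, fun m => v m / v i, fun l => c l / c k, fun l => w l / (c k * v i), div_self hk,
    div_self hi, hJ, fun l hl => ?_, fun j => ?_, fun j => ?_⟩
  · simp only [← mul_div_assoc, ← Finset.sum_div]
    exact (congrArg (· / v i) (hv l hl)).trans (zero_div _)
  · simp only [div_mul_eq_mul_div, ← Finset.sum_div]
    exact (congrArg (· / c k) (hc j)).trans (zero_div _)
  · simp only [← mul_div_assoc, div_mul_eq_mul_div, ← Finset.sum_div, div_div]
    exact congrArg (· / (c k * v i)) (hw j)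

theorem eval_pderiv_of_totalDegree_le_one {p : MvPolynomial (Fin n) ℝ} (hp : p.totalDegree ≤ 1)
    (u : Fin n → ℝ) (j : Fin n) : eval u (pderiv j p) = coeff (Finsupp.single j 1) p := by
  have h : pderiv j p = C (coeff (Finsupp.single j 1) p) := by
    ext m
    rw [coeff_pderiv, coeff_C]
    split_ifs with hm
    · simp [← hm]
    · rw [coeff_eq_zero_of_totalDegree_lt, zero_mul]
      have hm' : m.degree ≠ 0 := fun h => hm ((Finsupp.degree_eq_zero_iff m).1 h).symm
      change p.totalDegree < (m + Finsupp.single j 1).degree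
      rw [map_add, Finsupp.degree_single]
      omega
  rw [h, eval_C]

theorem hessAt_isSymm (p : MvPolynomial (Fin n) ℝ) (u : Fin n → ℝ) : (hessAt p u).IsSymm := by
  ext i j
  simp only [Matrix.transpose_apply, hessAt, Matrix.of_apply]
  congr 1
  ext m
  simp only [coeff_pderiv, add_right_comm m, Finsupp.add_apply, Finsupp.single_apply]
  rcases eq_or_ne i j with rfl | hij
  · rfl
  · simp only [if_neg hij, if_neg hij.symm]
    push_cast
    ring

/-- A tuple is generic, for the degree bounds `D`, if it avoids the degenerate sets of
sufficiently small dimension. -/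
structure IsGeneric (D : ι → ℕ) (q : ι → MvPolynomial (Fin n) ℝ) : Prop where
  gradients : ∀ J A : Finset ι, ∀ k ∈ A, A.card ≤ J.card → q ∉ dependentGradients n J A k
  linearParts : ∀ A : Finset ι, ∀ k ∈ A, A.card ≤ n → q ∉ dependentLinearParts n A k
  hessian : ∀ J A : Finset ι, ∀ k ∈ A, 2 ≤ D k → ∀ i, q ∉ degenerateHessian n J A k i

theorem Thin.setOf_and {D : ι → ℕ} {P : Prop} {B : Set (ι → MvPolynomial (Fin n) ℝ)}
    (h : P → Thin D B) : Thin D {q | P ∧ q ∈ B} := by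
  by_cases hP : P
  · exact (h hP).mono fun q hq => hq.2
  · exact (Thin.empty D).mono fun q hq => hP hq.1

theorem thin_not_isGeneric [Finite ι] {D : ι → ℕ} (hD : ∀ a, 0 < D a) :
    Thin D {q : ι → MvPolynomial (Fin n) ℝ | ¬ IsGeneric D q} := by
  have h := Thin.iUnion (D := D) (κ := Finset ι × Finset ι × ι × (Fin n ⊕ Bool))
    (B := fun x => Sum.elim
      (fun i => {q | (x.2.2.1 ∈ x.2.1 ∧ 2 ≤ D x.2.2.1) ∧
        q ∈ degenerateHessian n x.1 x.2.1 x.2.2.1 i})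
      (fun b => bif b
        then {q | (x.2.2.1 ∈ x.2.1 ∧ x.2.1.card ≤ x.1.card) ∧
          q ∈ dependentGradients n x.1 x.2.1 x.2.2.1}
        else {q | (x.2.2.1 ∈ x.2.1 ∧ x.2.1.card ≤ n) ∧ q ∈ dependentLinearParts n x.2.1 x.2.2.1})
      x.2.2.2) (by
    rintro ⟨J, A, k, i | _ | _⟩
    · exact Thin.setOf_and fun h => thin_degenerateHessian hD h.1 h.2 i
    · exact Thin.setOf_and fun h => thin_dependentLinearParts hD h.1 h.2
    · exact Thin.setOf_and fun h => thin_dependentGradients hD h.1 h.2)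
  refine h.mono fun q hq => by_contra fun hU => hq ?_
  rw [Set.mem_iUnion, not_exists] at hU
  exact ⟨fun J A k hk hA hmem => hU (J, A, k, .inr true) ⟨⟨hk, hA⟩, hmem⟩,
    fun A k hk hA hmem => hU (∅, A, k, .inr false) ⟨⟨hk, hA⟩, hmem⟩,
    fun J A k hk hA i hmem => hU (J, A, k, .inl i) ⟨⟨hk, hA⟩, hmem⟩⟩

theorem sum_insert_update [DecidableEq ι] {J : Finset ι} {o : ι} (ho : o ∉ J)
    (c y : ι → ℝ) :
    ∑ l ∈ insert o J, Function.update (-c) o 1 l * y l = y o - ∑ l ∈ J, c l * y l := by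
  rw [Finset.sum_insert ho, Function.update_self, one_mul, sub_eq_add_neg, ← Finset.sum_neg_distrib]
  congr 1
  refine Finset.sum_congr rfl fun l hl => ?_
  rw [Function.update_of_ne (ne_of_mem_of_not_mem hl ho), Pi.neg_apply, neg_mul]

namespace IsGeneric

variable {D : ι → ℕ} {q : ι → MvPolynomial (Fin n) ℝ} {u : Fin n → ℝ} {J E : Finset ι} {o : ι}

theorem linearIndepOn_gradAt (hq : IsGeneric D q) (hJ : ∀ l ∈ J, eval u (q l) = 0) :
    LinearIndepOn ℝ (fun l => gradAt (q l) u) (J : Set ι) := by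
  rw [linearIndepOn_finset_iff]
  intro c hc k hk
  by_contra hck
  refine hq.gradients J J k hk le_rfl (mem_dependentGradients hck hJ fun j => ?_)
  simpa using congrFun hc j

theorem exists_multipliers (hq : IsGeneric D q) (ho : o ∉ J) (hE : E ⊆ J)
    (hJ : ∀ l ∈ J, eval u (q l) = 0)
    (hmin : ∀ᶠ x in 𝓝 u, (∀ l ∈ E, eval x (q l) = 0) → (∀ l ∈ J, l ∉ E → 0 ≤ eval x (q l)) →
      eval u (q o) ≤ eval x (q o)) :
    ∃ c : ι → ℝ, (∀ l, l ∉ J → c l = 0) ∧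
      (∀ j, gradAt (q o) u j = ∑ l ∈ J, c l * gradAt (q l) u j) ∧
      ∀ l ∈ J, l ∉ E → 0 < c l := by
  classical
  have hli := hq.linearIndepOn_gradAt hJ
  obtain ⟨c, hc0, hc⟩ := exists_eq_sum_of_orthogonal J (fun l => gradAt (q l) u) (gradAt (q o) u)
    fun v hv => by
      have h1 := gradAt_nonneg_of_localMin hE hJ subset_rfl hmin hli hv fun l hl hl' =>
        absurd hl hl'
      have h2 := gradAt_nonneg_of_localMin (v := -v) hE hJ subset_rfl hmin hli
        (fun l hl => by rw [dotProduct_neg, hv l hl, neg_zero]) fun l hl hl' => absurd hl hl'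
      rw [dotProduct_neg] at h2
      linarith
  refine ⟨c, hc0, hc, fun k hk hkE => lt_of_le_of_ne ?_ fun hck => ?_⟩
  · obtain ⟨v, hv, hvk⟩ : ∃ v, (∀ l ∈ J.erase k, gradAt (q l) u ⬝ᵥ v = 0) ∧
        gradAt (q k) u ⬝ᵥ v ≠ 0 := by
      by_contra! hcon
      obtain ⟨b, -, hb⟩ := exists_eq_sum_of_orthogonal (J.erase k) (fun l => gradAt (q l) u)
        (gradAt (q k) u) hcon
      refine hq.gradients J _ k (Finset.mem_insert_self k (J.erase k))
        (by rw [Finset.insert_erase hk]) (mem_dependentGradients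
          (c := Function.update (-b) k 1) (u := u) (by simp) hJ fun j => ?_)
      rw [sum_insert_update (Finset.notMem_erase k J), hb j, sub_self]
    have hv1 : ∀ l, gradAt (q l) u ⬝ᵥ ((gradAt (q k) u ⬝ᵥ v)⁻¹ • v) =
        (gradAt (q k) u ⬝ᵥ v)⁻¹ * (gradAt (q l) u ⬝ᵥ v) := fun l => by
      rw [dotProduct_smul, smul_eq_mul]
    have h := gradAt_nonneg_of_localMin (J' := J.erase k)
      (v := (gradAt (q k) u ⬝ᵥ v)⁻¹ • v)
      (fun l hl => Finset.mem_erase.2 ⟨ne_of_mem_of_not_mem hl hkE, hE hl⟩) hJ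
      (Finset.erase_subset k J) hmin (hli.mono (by simp))
      (fun l hl => by rw [hv1, hv l hl, mul_zero]) fun l hl hl' => by
        obtain rfl : l = k := by simpa [hl] using hl'
        rw [hv1, inv_mul_cancel₀ hvk]
        exact one_pos
    have hsum : gradAt (q o) u ⬝ᵥ v = c k * (gradAt (q k) u ⬝ᵥ v) := by
      have e : gradAt (q o) u = ∑ l ∈ J, c l • gradAt (q l) u := by
        ext j
        simpa using hc j
      rw [e, sum_dotProduct, Finset.sum_eq_single_of_mem k hk, smul_dotProduct, smul_eq_mul]
      intro l hl hlk
      rw [smul_dotProduct, hv l (Finset.mem_erase.2 ⟨hlk, hl⟩), smul_zero]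
    rw [hv1, hsum] at h
    rwa [mul_left_comm, inv_mul_cancel₀ hvk, mul_one] at h
  · have ho' : o ∉ J.erase k := fun h => ho (Finset.mem_of_mem_erase h)
    refine hq.gradients J _ o (Finset.mem_insert_self o (J.erase k))
      (by rw [Finset.card_insert_of_notMem ho', Finset.card_erase_add_one hk])
      (mem_dependentGradients (c := Function.update (-c) o 1) (u := u) (by simp) hJ fun j => ?_)
    rw [sum_insert_update ho', hc j, ← Finset.sum_erase_add _ _ hk, ← hck]
    ring

end IsGeneric

/-- A tangent null vector of a symmetric form that is nonnegative on the tangent space is mapped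
to the normal space. -/
theorem exists_mulVec_eq_sum {H : Matrix (Fin n) (Fin n) ℝ} (hH : H.IsSymm) (w : ι → Fin n → ℝ)
    (J : Finset ι) (h0 : ∀ t, (∀ l ∈ J, w l ⬝ᵥ t = 0) → 0 ≤ t ⬝ᵥ H *ᵥ t) {v : Fin n → ℝ}
    (hv : ∀ l ∈ J, w l ⬝ᵥ v = 0) (hv0 : v ⬝ᵥ H *ᵥ v ≤ 0) :
    ∃ c : ι → ℝ, ∀ j, (H *ᵥ v) j = ∑ l ∈ J, c l * w l j := by
  obtain ⟨c, -, hc⟩ := exists_eq_sum_of_orthogonal J w (H *ᵥ v) fun t ht => by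
    have hvv : v ⬝ᵥ H *ᵥ v = 0 := le_antisymm hv0 (h0 v hv)
    have hsymm : v ⬝ᵥ H *ᵥ t = (H *ᵥ v) ⬝ᵥ t := by
      rw [dotProduct_mulVec, ← mulVec_transpose, hH]
    have hd := discrim_le_zero (a := t ⬝ᵥ H *ᵥ t) (b := 2 * ((H *ᵥ v) ⬝ᵥ t)) (c := 0) fun s => by
      have h := h0 (v + s • t) fun l hl => by
        rw [dotProduct_add, dotProduct_smul, hv l hl, ht l hl, smul_zero, add_zero]
      simp only [mulVec_add, mulVec_smul, dotProduct_add, add_dotProduct, dotProduct_smul,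
        smul_dotProduct, smul_eq_mul, hvv, hsymm, dotProduct_comm t (H *ᵥ v)] at h
      linarith
    rw [discrim] at hd
    nlinarith
  exact ⟨c, hc⟩

/-- Independent vectors having a common nonzero orthogonal vector do not span. -/
theorem card_lt_of_orthogonal {w : ι → Fin n → ℝ} {J : Finset ι}
    (hw : LinearIndepOn ℝ w (J : Set ι)) {v : Fin n → ℝ} (hv0 : v ≠ 0)
    (hv : ∀ l ∈ J, w l ⬝ᵥ v = 0) : J.card < n := by
  have hspan : v ∉ Submodule.span ℝ (Set.range fun l : (J : Set ι) => w l) := fun hmem => by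
    have hle : Submodule.span ℝ (Set.range fun l : (J : Set ι) => w l) ≤
        LinearMap.ker ((dotProductBilin ℝ ℝ).flip v) := by
      rw [Submodule.span_le]
      rintro _ ⟨l, rfl⟩
      exact hv l l.2
    exact hv0 (dotProduct_self_eq_zero.1 (hle hmem))
  have h := (LinearIndependent.option hw hspan).fintype_card_le_finrank
  simpa [Nat.succ_le_iff] using h

theorem hessAt_sub_sum_mulVec (p : MvPolynomial (Fin n) ℝ) (q : ι → MvPolynomial (Fin n) ℝ)
    (J : Finset ι) (c : ι → ℝ) (u v : Fin n → ℝ) (j : Fin n) :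
    (hessAt (p - ∑ l ∈ J, C (c l) * q l) u *ᵥ v) j =
      (hessAt p u *ᵥ v) j - ∑ l ∈ J, c l * (hessAt (q l) u *ᵥ v) j := by
  have h : hessAt (p - ∑ l ∈ J, C (c l) * q l) u = hessAt p u - ∑ l ∈ J, c l • hessAt (q l) u := by
    ext i m
    simp [hessAt, Matrix.sum_apply]
  rw [h, sub_mulVec, sum_mulVec]
  simp [smul_mulVec]

namespace IsGeneric

variable {D : ι → ℕ} {q : ι → MvPolynomial (Fin n) ℝ} {u : Fin n → ℝ} {J E : Finset ι} {o : ι}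

theorem hessAt_pos (hq : IsGeneric D q) (hqD : ∀ a, (q a).totalDegree ≤ D a) (ho : o ∉ J)
    (hE : E ⊆ J) (hJ : ∀ l ∈ J, eval u (q l) = 0)
    (hmin : ∀ᶠ x in 𝓝 u, (∀ l ∈ E, eval x (q l) = 0) → (∀ l ∈ J, l ∉ E → 0 ≤ eval x (q l)) →
      eval u (q o) ≤ eval x (q o)) {c : ι → ℝ}
    (hc : ∀ j, gradAt (q o) u j = ∑ l ∈ J, c l * gradAt (q l) u j) {v : Fin n → ℝ} (hv0 : v ≠ 0)
    (hv : ∀ l ∈ J, gradAt (q l) u ⬝ᵥ v = 0) :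
    0 < v ⬝ᵥ (hessAt (q o - ∑ l ∈ J, C (c l) * q l) u) *ᵥ v := by
  classical
  have hli := hq.linearIndepOn_gradAt hJ
  by_contra! hneg
  obtain ⟨w, hw⟩ := exists_mulVec_eq_sum (hessAt_isSymm _ u) (fun l => gradAt (q l) u) J
    (fun t ht => hessAt_nonneg_of_localMin hE hJ hmin hli hc ht) hv hneg
  obtain ⟨i, hi⟩ := Function.ne_iff.1 hv0
  set c' : ι → ℝ := Function.update (-c) o 1
  have hgrad : ∀ j, ∑ l ∈ insert o J, c' l * gradAt (q l) u j = 0 := fun j => by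
    rw [sum_insert_update ho, hc j, sub_self]
  have hdeg : ∀ k ∈ insert o J, c' k ≠ 0 → D k ≤ 1 := fun k hk hck => by
    by_contra! hDk
    refine hq.hessian J (insert o J) k hk hDk i (mem_degenerateHessian (w := w) hck hi hJ ?_ hgrad ?_)
    · have e : gradAt (q o) u = ∑ l ∈ J, c l • gradAt (q l) u := by
        ext j
        simpa using hc j
      refine Finset.forall_mem_insert _ _ _ |>.2 ⟨?_, hv⟩
      rw [e, sum_dotProduct]
      exact Finset.sum_eq_zero fun l hl => by rw [smul_dotProduct, hv l hl, smul_zero]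
    · intro j
      rw [sum_insert_update ho, ← hessAt_sub_sum_mulVec, hw]
  have hco : c' o ≠ 0 := by simp [c']
  refine hq.linearParts ((insert o J).filter fun l => c' l ≠ 0) o
    (Finset.mem_filter.2 ⟨Finset.mem_insert_self o J, hco⟩) ?_
    (mem_dependentLinearParts hco fun j => ?_)
  · have h1 := card_lt_of_orthogonal hli hv0 hv
    have h2 := Finset.card_filter_le (insert o J) fun l => c' l ≠ 0
    have h3 := Finset.card_insert_le o J
    omega
  · rw [Finset.sum_filter]
    refine (Finset.sum_congr rfl fun l hl => ?_).trans (hgrad j)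
    split_ifs with hl0
    · rw [gradAt, eval_pderiv_of_totalDegree_le_one ((hqD l).trans (hdeg l hl hl0))]
    · rw [not_not.1 hl0, zero_mul]

end IsGeneric

end Generic

/-- **Theorem 1.2**: there is a nonzero polynomial `Φ` in the coefficients of
`(f, h₁,…,h_{m1}, g₁,…,g_{m2})` (with the given degree bounds) such that
whenever `Φ(f,h,g) ≠ 0`, at every local minimizer `u` of `f` over
`K = {x : h_i(x) = 0, g_j(x) ≥ 0}` the constraint qualification condition holds,
and the resulting Lagrange multipliers satisfy the strict complementarity and
second order sufficiency conditions. -/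
theorem generic_optimality_conditions
    (n m1 m2 : ℕ) (hm1 : m1 ≤ n)
    (d0 : ℕ) (d : Fin m1 → ℕ) (d' : Fin m2 → ℕ)
    (hd0 : 0 < d0) (hd : ∀ i, 0 < d i) (hd' : ∀ j, 0 < d' j) :
    ∃ Φ : MvPolynomial ((Unit ⊕ Fin m1 ⊕ Fin m2) × (Fin n →₀ ℕ)) ℝ,
      (∃ (f : MvPolynomial (Fin n) ℝ) (h : Fin m1 → MvPolynomial (Fin n) ℝ)
          (g : Fin m2 → MvPolynomial (Fin n) ℝ),
        f.totalDegree ≤ d0 ∧ (∀ i, (h i).totalDegree ≤ d i) ∧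
        (∀ j, (g j).totalDegree ≤ d' j) ∧ evalCoeffs Φ f h g ≠ 0) ∧
      ∀ (f : MvPolynomial (Fin n) ℝ) (h : Fin m1 → MvPolynomial (Fin n) ℝ)
          (g : Fin m2 → MvPolynomial (Fin n) ℝ),
        f.totalDegree ≤ d0 → (∀ i, (h i).totalDegree ≤ d i) →
        (∀ j, (g j).totalDegree ≤ d' j) →
        evalCoeffs Φ f h g ≠ 0 →
        ∀ (K : Set (Fin n → ℝ)),
          K = {x | (∀ i, eval x (h i) = 0) ∧ (∀ j, 0 ≤ eval x (g j))} →
          ∀ u ∈ K,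
            -- `u` is a local minimizer of `f` over `K`
            (∃ δ : ℝ, 0 < δ ∧ ∀ x ∈ K, dist x u < δ → eval u f ≤ eval x f) →
            CQC h g u ∧
            ∃ (lam : Fin m1 → ℝ) (mu : Fin m2 → ℝ),
              (∀ k : Fin n, eval u (pderiv k f)
                  = (∑ i, lam i * eval u (pderiv k (h i)))
                    + ∑ j, mu j * eval u (pderiv k (g j))) ∧
              (∀ j, mu j * eval u (g j) = 0) ∧ (∀ j, 0 ≤ mu j) ∧
              (∀ j, 0 < mu j + eval u (g j)) ∧
              SOSC f h g u lam mu := by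
  classical
  let D : Unit ⊕ Fin m1 ⊕ Fin m2 → ℕ := Sum.elim (fun _ => d0) (Sum.elim d d')
  have hD : ∀ a, 0 < D a := by
    rintro (_ | i | j)
    exacts [hd0, hd i, hd' j]
  obtain ⟨Φ, ⟨q₀, hq₀D, hq₀⟩, hΦ⟩ := (thin_not_isGeneric (n := n) hD).exists_polynomial
  refine ⟨Φ, ⟨q₀ (.inl ()), fun i => q₀ (.inr (.inl i)), fun j => q₀ (.inr (.inr j)),
    hq₀D (.inl ()), fun i => hq₀D (.inr (.inl i)), fun j => hq₀D (.inr (.inr j)), ?_⟩, ?_⟩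
  · have e : Sum.elim (fun _ : Unit => q₀ (.inl ()))
        (Sum.elim (fun i => q₀ (.inr (.inl i))) fun j => q₀ (.inr (.inr j))) = q₀ := by
      ext1 (_ | _ | _) <;> rfl
    rwa [evalCoeffs, e]
  rintro f h g hf hh hg hne K rfl u ⟨hu1, hu2⟩ ⟨δ, hδ, hloc⟩
  let q : Unit ⊕ Fin m1 ⊕ Fin m2 → MvPolynomial (Fin n) ℝ :=
    Sum.elim (fun _ => f) (Sum.elim h g)
  have hqD : ∀ a, (q a).totalDegree ≤ D a := by
    rintro (_ | i | j)
    exacts [hf, hh i, hg j]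
  have hgen : IsGeneric D q := by_contra fun hq => hne (hΦ q hq hqD)
  let o : Unit ⊕ Fin m1 ⊕ Fin m2 := .inl ()
  let E : Finset (Unit ⊕ Fin m1 ⊕ Fin m2) := Finset.univ.image fun i => .inr (.inl i)
  let J : Finset (Unit ⊕ Fin m1 ⊕ Fin m2) :=
    E ∪ (Finset.univ.filter fun j => eval u (g j) = 0).image fun j => .inr (.inr j)
  have ho : o ∉ J := by simp [J, E, o]
  have hE : E ⊆ J := Finset.subset_union_left
  have hJh : ∀ i, .inr (.inl i) ∈ J := fun i => by simp [J, E]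
  have hJg : ∀ j, .inr (.inr j) ∈ J ↔ eval u (g j) = 0 := fun j => by simp [J, E]
  have hEh : ∀ i, .inr (.inl i) ∈ E := fun i => by simp [E]
  have hEg : ∀ j, .inr (.inr j) ∉ E := fun j => by simp [E]
  have hJ : ∀ l ∈ J, eval u (q l) = 0 := by
    rintro (_ | i | j) hl
    exacts [absurd hl ho, hu1 i, (hJg j).1 hl]
  have hmin : ∀ᶠ x in nhds u, (∀ l ∈ E, eval x (q l) = 0) →
      (∀ l ∈ J, l ∉ E → 0 ≤ eval x (q l)) → eval u (q o) ≤ eval x (q o) := by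
    have hinactive : ∀ᶠ x in nhds u, ∀ j, eval u (g j) ≠ 0 → 0 < eval x (g j) :=
      Filter.eventually_all.2 fun j => by
        by_cases hj : eval u (g j) = 0
        · exact Filter.Eventually.of_forall fun x hx => absurd hj hx
        · have hcont : Continuous fun x : Fin n → ℝ => eval x (g j) := continuous_eval (g j)
          filter_upwards [hcont.continuousAt.eventually
            (lt_mem_nhds (lt_of_le_of_ne (hu2 j) (Ne.symm hj)))] with x hx _ using hx
    filter_upwards [hinactive, Metric.ball_mem_nhds u hδ] with x hx hxδ hxE hxJ
    refine hloc x ⟨fun i => hxE _ (hEh i), fun j => ?_⟩ hxδ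
    by_cases hj : eval u (g j) = 0
    · exact hxJ _ ((hJg j).2 hj) (hEg j)
    · exact (hx j hj).le
  obtain ⟨c, hc0, hc, hcpos⟩ := hgen.exists_multipliers ho hE hJ hmin
  have hsum : ∀ {M : Type} [AddCommMonoid M] (F : Unit ⊕ Fin m1 ⊕ Fin m2 → M),
      (∀ l, l ∉ J → F l = 0) →
      ∑ l ∈ J, F l = ∑ i, F (.inr (.inl i)) + ∑ j, F (.inr (.inr j)) := fun F hF => by
    rw [Finset.sum_subset (Finset.subset_univ J) fun l _ hl => hF l hl]
    simp [Fintype.sum_sum_type, hF (.inl ()) ho]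
  have hmu : ∀ j, eval u (g j) = 0 ∧ 0 < c (.inr (.inr j)) ∨
      0 < eval u (g j) ∧ c (.inr (.inr j)) = 0 := fun j => by
    by_cases hj : eval u (g j) = 0
    · exact .inl ⟨hj, hcpos _ ((hJg j).2 hj) (hEg j)⟩
    · exact .inr ⟨lt_of_le_of_ne (hu2 j) (Ne.symm hj), hc0 _ fun hl => hj ((hJg j).1 hl)⟩
  refine ⟨?_, fun i => c (.inr (.inl i)), fun j => c (.inr (.inr j)), fun k => ?_, fun j => ?_,
    fun j => ?_, fun j => ?_, fun v hv0 hvh hvg => ?_⟩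
  · let e : Fin m1 ⊕ {j : Fin m2 // eval u (g j) = 0} → (J : Set (Unit ⊕ Fin m1 ⊕ Fin m2)) :=
      Sum.elim (fun i => ⟨.inr (.inl i), hJh i⟩) fun j => ⟨.inr (.inr j.1), (hJg j.1).2 j.2⟩
    have he : Function.Injective e := by
      rintro (i | j) (i' | j') hij <;>
        simp only [e, Sum.elim_inl, Sum.elim_inr, Subtype.mk.injEq, Sum.inr.injEq, Sum.inl.injEq,
          reduceCtorEq] at hij
      exacts [congrArg _ hij, congrArg _ (Subtype.ext hij)]
    have hli := (hgen.linearIndepOn_gradAt hJ).comp e he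
    rw [CQC]
    convert hli using 1
    ext1 (i | j) <;> rfl
  · exact (hc k).trans (hsum _ fun l hl => by rw [hc0 l hl, zero_mul])
  · rcases hmu j with h | h <;> simp [h]
  · rcases hmu j with h | h <;> simp [h, h.2.le]
  · rcases hmu j with h | h <;> simp [h]
  · have hL := hsum (fun l => C (c l) * q l) fun l hl => by rw [hc0 l hl, C_0, zero_mul]
    have hpos := hgen.hessAt_pos hqD ho hE hJ hmin hc hv0 (by
      rintro (_ | i | j) hl
      exacts [absurd hl ho, hvh i, hvg j ((hJg j).1 hl)])
    rw [hL, ← sub_sub] at hpos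
    exact hpos
end
end
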